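/- arXiv:1711.09310 — 2 statements merged into one kernel-verified Lean document; each statement's English description precedes it below -/
import Mathlib

section
/- Let d ≥ 2 and let N be an even integer with N ≥ 2d. Let Δ and S be centrally symmetric geometric simplicial complexes of dimension d−1, each with exactly N vertices, whose underlying spaces are both homeomorphic to the unit (d−1)-sphere S^{d−1} = {x ∈ ℝ^d : |x| = 1}. If S is cs ⌊d/2⌋-neighborly, then f_j(Δ) ≤ f_j(S) for every j with 0 ≤ j ≤ d−1, where f_j denotes the number of j-dimensional simplices. -/
open Set

/-- A geometric simplicial complex `K` (with vertex involution `φ`) is centrally symmetric: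
`φ` is an involution of the vertex set carrying the vertex set of each face to the vertex set
of a face, and moving the vertex set of every face. -/
def IsCSComplex {E : Type*} [DecidableEq E] [AddCommGroup E] [Module ℝ E]
    (K : Geometry.SimplicialComplex ℝ E) (φ : E → E) : Prop :=
  (∀ v ∈ K.vertices, φ v ∈ K.vertices) ∧
  (∀ v ∈ K.vertices, φ (φ v) = v) ∧
  (∀ s ∈ K.faces, s.image φ ∈ K.faces) ∧
  (∀ s ∈ K.faces, s.image φ ≠ s)

/-- `K` has dimension `d - 1`: every face has at most `d` vertices and some face has `d`. -/
def HasDim {E : Type*} [AddCommGroup E] [Module ℝ E]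
    (K : Geometry.SimplicialComplex ℝ E) (d : ℕ) : Prop :=
  (∀ s ∈ K.faces, s.card ≤ d) ∧ ∃ s ∈ K.faces, s.card = d

/-- A cs complex `(K, φ)` is cs `k`-neighborly: every set of `k` vertices, no two of which
are antipodal, is the vertex set of a face. -/
def CSNeighborlyC {E : Type*} [DecidableEq E] [AddCommGroup E] [Module ℝ E]
    (K : Geometry.SimplicialComplex ℝ E) (φ : E → E) (k : ℕ) : Prop :=
  ∀ T : Finset E, ↑T ⊆ K.vertices → T.card = k → (∀ v ∈ T, φ v ∉ T) → T ∈ K.faces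

/-- The number of `j`-dimensional simplices of `K`. -/
noncomputable def fComplex {E : Type*} [AddCommGroup E] [Module ℝ E]
    (K : Geometry.SimplicialComplex ℝ E) (j : ℕ) : ℕ :=
  {s ∈ K.faces | s.card = j + 1}.ncard

set_option linter.unusedSectionVars false

namespace CSUpperBound

section Boundary

variable {k : Type*} [Field k] [CharP k 2]

lemma add_self_of_charTwo {M : Type*} [AddCommGroup M] [Module k M] (x : M) : x + x = 0 := by
  rw [← two_smul k x, CharTwo.two_eq_zero, zero_smul]

variable (k) in
lemma sum_sum_erase_eq_zero {M ι : Type*} [AddCommGroup M] [Module k M] [DecidableEq ι]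
    (s : Finset ι) (g : ι → ι → M) (hg : ∀ v w, g v w = g w v) :
    ∑ v ∈ s, ∑ w ∈ s.erase v, g v w = 0 := by
  rw [Finset.sum_sigma']
  refine Finset.sum_involution (fun p _ => ⟨p.2, p.1⟩) ?_ ?_ ?_ ?_
  · rintro ⟨v, w⟩ _
    simp only
    rw [hg w v]
    exact add_self_of_charTwo (k := k) _
  · rintro ⟨v, w⟩ h _ heq
    simp only [Finset.mem_sigma, Finset.mem_erase] at h
    simp only [Sigma.mk.injEq] at heq
    exact h.2.1 heq.1
  · rintro ⟨v, w⟩ h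
    simp only [Finset.mem_sigma, Finset.mem_erase] at h ⊢
    exact ⟨h.2.2, Ne.symm h.2.1, h.1⟩
  · rintro ⟨v, w⟩ _
    rfl

variable {V : Type*} [Fintype V] [DecidableEq V]

/-- The weighted simplicial boundary `e_S ↦ ∑ v ∈ S, θ v • e_{S \ v}` on chains over a field of
characteristic two, a chain being the function of its coefficients. -/
def bd (θ : V → k) : (Finset V → k) →ₗ[k] (Finset V → k) where
  toFun c G := ∑ v ∈ Gᶜ, θ v * c (insert v G)
  map_add' c c' := by
    ext G
    simp [mul_add, Finset.sum_add_distrib]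
  map_smul' a c := by
    ext G
    simp [Finset.mul_sum, mul_left_comm]

lemma bd_apply (θ : V → k) (c : Finset V → k) (G : Finset V) :
    bd θ c G = ∑ v ∈ Gᶜ, θ v * c (insert v G) := rfl

lemma bd_bd_apply (θ η : V → k) (c : Finset V → k) (G : Finset V) :
    bd θ (bd η c) G = ∑ v ∈ Gᶜ, ∑ w ∈ Gᶜ.erase v, θ v * (η w * c (insert w (insert v G))) := by
  simp only [bd_apply, Finset.mul_sum]
  refine Finset.sum_congr rfl fun v _ => ?_
  rw [Finset.compl_insert]

lemma bd_comm (θ η : V → k) (c : Finset V → k) : bd θ (bd η c) = bd η (bd θ c) := by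
  ext G
  rw [bd_bd_apply, bd_bd_apply, Finset.sum_comm' (s' := fun v => Gᶜ.erase v) (t' := Gᶜ)]
  · refine Finset.sum_congr rfl fun v _ => Finset.sum_congr rfl fun w _ => ?_
    rw [Finset.insert_comm]
    ring
  · intro v w
    simp only [Finset.mem_erase, Finset.mem_compl]
    tauto

lemma bd_bd (θ : V → k) (c : Finset V → k) : bd θ (bd θ c) = 0 := by
  ext G
  rw [bd_bd_apply]
  refine sum_sum_erase_eq_zero k _ _ fun v w => ?_
  rw [Finset.insert_comm]
  ring

lemma bd_sub_smul (θ η : V → k) (a : k) (c : Finset V → k) :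
    bd (θ - a • η) c = bd θ c - a • bd η c := by
  ext G
  simp only [bd_apply, Pi.sub_apply, Pi.smul_apply, smul_eq_mul, sub_mul, Finset.sum_sub_distrib,
    Finset.mul_sum, mul_assoc]

variable (k) in
/-- Chains supported on the members of `K` with `j` elements. -/
def chains (K : Set (Finset V)) (j : ℕ) : Submodule k (Finset V → k) where
  carrier := {c | ∀ S, c S ≠ 0 → S ∈ K ∧ S.card = j}
  add_mem' {c c'} hc hc' S hS := by
    by_cases h : c S = 0
    · exact hc' S fun h' => hS (by simp [h, h'])
    · exact hc S h
  zero_mem' S hS := absurd rfl hS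
  smul_mem' a c hc S hS := hc S fun h => hS (by simp [h])

lemma chains_mono {K L : Set (Finset V)} {j : ℕ} (h : ∀ S ∈ K, S.card = j → S ∈ L) :
    chains k K j ≤ chains k L j :=
  fun _ hc S hS => ⟨h S (hc S hS).1 (hc S hS).2, (hc S hS).2⟩

lemma bd_mem_chains {K : Set (Finset V)} (hK : IsLowerSet K) {j : ℕ} {c : Finset V → k}
    (hc : c ∈ chains k K (j + 1)) (θ : V → k) : bd θ c ∈ chains k K j := by
  intro S hS
  obtain ⟨v, hv, hne⟩ := Finset.exists_ne_zero_of_sum_ne_zero hS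
  obtain ⟨h1, h2⟩ := hc _ (right_ne_zero_of_mul hne)
  rw [Finset.card_insert_of_notMem (by simpa using hv)] at h2
  exact ⟨hK (Finset.subset_insert v S) h1, by omega⟩

lemma bd_eq_zero_of_chains_zero {K : Set (Finset V)} {c : Finset V → k}
    (hc : c ∈ chains k K 0) (θ : V → k) : bd θ c = 0 := by
  ext S
  refine Finset.sum_eq_zero fun v _ => ?_
  by_contra hne
  have := (hc _ (right_ne_zero_of_mul hne)).2
  rw [Finset.card_eq_zero] at this
  exact Finset.insert_ne_empty _ _ this

/-- The join of a chain with the vertex `v`. -/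
def join (v : V) : (Finset V → k) →ₗ[k] (Finset V → k) where
  toFun c S := if v ∈ S then c (S.erase v) else 0
  map_add' c c' := by
    ext S
    by_cases h : v ∈ S <;> simp [h]
  map_smul' a c := by
    ext S
    simp

lemma join_apply (v : V) (c : Finset V → k) (S : Finset V) :
    join v c S = if v ∈ S then c (S.erase v) else 0 := rfl

lemma join_mem_chains {K L : Set (Finset V)} {v : V} (hK : ∀ S ∈ K, insert v S ∈ L) {j : ℕ}
    {c : Finset V → k} (hc : c ∈ chains k K j) : join v c ∈ chains k L (j + 1) := by
  intro S hS
  rw [join_apply] at hS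
  split_ifs at hS with h
  · obtain ⟨h1, h2⟩ := hc _ hS
    have h3 := hK _ h1
    rw [Finset.insert_erase h] at h3
    exact ⟨h3, by rw [← h2, Finset.card_erase_add_one h]⟩
  · exact absurd rfl hS

lemma bd_join (θ : V → k) (v : V) (c : Finset V → k) :
    bd θ (join v c) = θ v • c + join v (bd θ c) := by
  ext G
  rw [bd_apply, Pi.add_apply, Pi.smul_apply, join_apply, smul_eq_mul]
  by_cases hv : v ∈ G
  · rw [if_pos hv, bd_apply, Finset.compl_erase,
      Finset.sum_insert (by simpa using hv), Finset.insert_erase hv, ← add_assoc,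
      add_self_of_charTwo (k := k), zero_add]
    refine Finset.sum_congr rfl fun w hw => ?_
    have hne : v ≠ w := fun h => by simp [h ▸ hv] at hw
    rw [join_apply, if_pos (Finset.mem_insert_of_mem hv),
      Finset.erase_insert_of_ne hne.symm]
  · rw [if_neg hv, add_zero, Finset.sum_eq_single v]
    · rw [join_apply, if_pos (Finset.mem_insert_self _ _), Finset.erase_insert hv]
    · intro w _ hne
      rw [join_apply, if_neg (by simp [hne.symm, hv]), mul_zero]
    · intro h
      simp [hv] at h

/-- The part of a chain away from the vertex `v`. -/
def away (v : V) (c : Finset V → k) (S : Finset V) : k := if v ∈ S then 0 else c S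

lemma join_away (v : V) (c : Finset V → k) : join v (away v c) = join v c := by
  ext S
  simp [join_apply, away]

lemma bd_away {θ : V → k} {v : V} (hθ : θ v = 0) (c : Finset V → k) :
    bd θ (away v c) = away v (bd θ c) := by
  ext G
  by_cases hv : v ∈ G
  · simp [away, bd_apply, hv]
  · simp only [away, bd_apply, Finset.mem_insert, hv, or_false]
    refine Finset.sum_congr rfl fun w _ => ?_
    split_ifs with h
    · simp [← h, hθ]
    · rfl

end Boundary

section CohenMacaulay

variable {k : Type*} [Field k] [CharP k 2] {V : Type*} [Fintype V] [DecidableEq V]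

/-- The link of `F` in `K`. -/
def link (K : Set (Finset V)) (F : Finset V) : Set (Finset V) := {S | Disjoint S F ∧ S ∪ F ∈ K}

/-- The closed star of `F` in `K`. -/
def star (K : Set (Finset V)) (F : Finset V) : Set (Finset V) := {S | S ∪ F ∈ K}

lemma isLowerSet_link {K : Set (Finset V)} (hK : IsLowerSet K) (F : Finset V) :
    IsLowerSet (link K F) := fun _ _ hTS hS =>
  ⟨hS.1.mono_left hTS, hK (Finset.union_subset_union_left hTS) hS.2⟩

lemma isLowerSet_star {K : Set (Finset V)} (hK : IsLowerSet K) (F : Finset V) :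
    IsLowerSet (star K F) := fun _ _ hTS hS => hK (Finset.union_subset_union_left hTS) hS

lemma star_empty (K : Set (Finset V)) : star K ∅ = K := by
  simp [star]

lemma link_empty (K : Set (Finset V)) : link K ∅ = K := by
  simp [link]

lemma link_link {K : Set (Finset V)} {v : V} {F : Finset V} (hF : v ∉ F) :
    link (link K {v}) F = link K (insert v F) := by
  ext S
  have h : S ∪ F ∪ {v} = S ∪ insert v F := by ext; simp
  simp only [link, Set.mem_ofPred_eq, h, Finset.disjoint_singleton_right, Finset.mem_union,
    Finset.disjoint_insert_right]
  tauto

lemma insert_mem_star {K : Set (Finset V)} {G : Finset V} {v : V} (hv : v ∈ G) :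
    ∀ S ∈ star K G, insert v S ∈ star K G := by
  intro S hS
  have : insert v S ∪ G = S ∪ G := by
    rw [Finset.insert_union, Finset.insert_eq_self.2 (Finset.mem_union_right _ hv)]
  simpa [star, this] using hS

lemma mem_star_link {K : Set (Finset V)} {G : Finset V} {v : V} (hv : v ∈ G) (S : Finset V) :
    S ∈ star (link K {v}) (G.erase v) ↔ v ∉ S ∧ S ∈ star K G := by
  have h : S ∪ G.erase v ∪ {v} = S ∪ G := by
    ext x
    by_cases hx : x = v <;> simp [hx, hv]
  simp only [star, link, Set.mem_ofPred_eq, h, Finset.disjoint_singleton_right, Finset.mem_union,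
    Finset.mem_erase]
  tauto

variable (k) in
/-- `K` has no reduced homology on cycles with fewer than `d` vertices. -/
def AcyclicBelow (d : ℕ) (K : Set (Finset V)) : Prop :=
  ∀ j < d, ∀ c ∈ chains k K j, bd 1 c = 0 → ∃ b ∈ chains k K (j + 1), bd 1 b = c

variable (k) in
/-- The homological Cohen-Macaulay property: Reisner's criterion. -/
def IsCM (d : ℕ) (K : Set (Finset V)) : Prop :=
  ∀ F ∈ K, AcyclicBelow k (d - F.card) (link K F)

lemma IsCM.link_singleton {d : ℕ} {K : Set (Finset V)} (h : IsCM k (d + 1) K) (v : V) :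
    IsCM k d (link K {v}) := by
  intro F hF
  have hv : v ∉ F := by simpa using hF.1
  have h' : insert v F ∈ K := by
    have := hF.2
    rwa [Finset.union_comm, ← Finset.insert_eq] at this
  have := h _ h'
  rw [Finset.card_insert_of_notMem hv, Nat.add_sub_add_right] at this
  rwa [link_link hv]

lemma AcyclicBelow.weighted {d : ℕ} {K : Set (Finset V)} (hK : IsLowerSet K)
    (h : AcyclicBelow k d K) {u : V → k} (hu : ∀ S ∈ K, ∀ v ∈ S, u v ≠ 0) {j : ℕ} (hj : j < d)
    {c : Finset V → k} (hc : c ∈ chains k K j) (hcy : bd u c = 0) :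
    ∃ b ∈ chains k K (j + 1), bd u b = c := by
  have key : ∀ b : Finset V → k,
      bd 1 (fun S => (∏ v ∈ S, u v) * b S) = fun S => (∏ v ∈ S, u v) * bd u b S := by
    intro b
    ext G
    simp only [bd_apply, Pi.one_apply, one_mul, Finset.mul_sum]
    refine Finset.sum_congr rfl fun v hv => ?_
    rw [Finset.prod_insert (by simpa using hv)]
    ring
  have hprod : ∀ S ∈ K, ∏ v ∈ S, u v ≠ 0 := fun S hS => Finset.prod_ne_zero_iff.2 (hu S hS)
  obtain ⟨b, hb, hbc⟩ := h j hj (fun S => (∏ v ∈ S, u v) * c S)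
    (fun S hS => hc S (right_ne_zero_of_mul hS)) (by rw [key, hcy]; ext; simp)
  have hb' : (fun S => (∏ v ∈ S, u v)⁻¹ * b S) ∈ chains k K (j + 1) :=
    fun S hS => hb S (right_ne_zero_of_mul hS)
  refine ⟨_, hb', ?_⟩
  have h1 := key (fun S => (∏ v ∈ S, u v)⁻¹ * b S)
  have h2 : (fun S => (∏ v ∈ S, u v) * ((∏ v ∈ S, u v)⁻¹ * b S)) = b := by
    ext S
    by_cases hS : b S = 0
    · simp [hS]
    · rw [mul_inv_cancel_left₀ (hprod S (hb S hS).1)]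
  rw [h2, hbc] at h1
  ext S
  by_cases hS : S ∈ K
  · exact (mul_left_cancel₀ (hprod S hS) (congrFun h1 S)).symm
  · have h3 : c S = 0 := by
      by_contra h3
      exact hS (hc S h3).1
    have h4 : bd u (fun S => (∏ v ∈ S, u v)⁻¹ * b S) S = 0 := by
      by_contra h4
      exact hS (bd_mem_chains hK hb' u S h4).1
    rw [h3, h4]

/-- Chains of `K` with `j` vertices killed by the first `r` of the boundaries `bd (u * t ^ m)`. -/
def stress (u t : V → k) (r j : ℕ) (K : Set (Finset V)) : Submodule k (Finset V → k) where
  carrier := {c | c ∈ chains k K j ∧ ∀ m < r, bd (u * t ^ m) c = 0}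
  add_mem' hc hc' := ⟨add_mem hc.1 hc'.1, fun m hm => by
    rw [map_add, hc.2 m hm, hc'.2 m hm, add_zero]⟩
  zero_mem' := ⟨zero_mem _, fun _ _ => map_zero _⟩
  smul_mem' a _ hc := ⟨Submodule.smul_mem _ a hc.1, fun m hm => by
    rw [map_smul, hc.2 m hm, smul_zero]⟩

lemma mem_stress {u t : V → k} {r j : ℕ} {K : Set (Finset V)} {c : Finset V → k} :
    c ∈ stress u t r j K ↔ c ∈ chains k K j ∧ ∀ m < r, bd (u * t ^ m) c = 0 := Iff.rfl

lemma stress_mono {u t : V → k} {r j : ℕ} {K L : Set (Finset V)}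
    (h : ∀ S ∈ K, S.card = j → S ∈ L) : stress u t r j K ≤ stress u t r j L :=
  fun _ hc => ⟨chains_mono h hc.1, hc.2⟩

lemma bd_mem_stress {u t : V → k} {r j : ℕ} {K : Set (Finset V)} (hK : IsLowerSet K)
    {c : Finset V → k} (hc : c ∈ stress u t r (j + 1) K) :
    bd (u * t ^ r) c ∈ stress u t (r + 1) j K := by
  refine ⟨bd_mem_chains hK hc.1 _, fun m hm => ?_⟩
  rcases Nat.lt_succ_iff_lt_or_eq.1 hm with h | rfl
  · rw [bd_comm, hc.2 m h, map_zero]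
  · exact bd_bd _ _

/-- Surjectivity of the boundaries `bd (u * t ^ r)` between stress spaces of the star of `G`. -/
def StressSurj (d r : ℕ) (u t : V → k) (K : Set (Finset V)) (G : Finset V) : Prop :=
  ∀ j, j + r + 1 ≤ d → ∀ z ∈ stress u t (r + 1) j (star K G),
    ∃ c ∈ stress u t r (j + 1) (star K G), bd (u * t ^ r) c = z

lemma stressSurj_zero_of_nonempty {d : ℕ} {u t : V → k} {K : Set (Finset V)} {G : Finset V}
    {v : V} (hv : v ∈ G) (huv : u v ≠ 0) : StressSurj d 0 u t K G := by
  intro j _ z hz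
  have hz0 : bd u z = 0 := by simpa using hz.2 0 one_pos
  refine ⟨(u v)⁻¹ • join v z, ⟨Submodule.smul_mem _ _
    (join_mem_chains (insert_mem_star hv) hz.1), by simp⟩, ?_⟩
  rw [pow_zero, mul_one, map_smul, bd_join, hz0, map_zero, add_zero, inv_smul_smul₀ huv]

/-- The weights induced on the link of `v`. -/
def linkWeight (u t : V → k) (v w : V) : k := u w * (t w - t v)

lemma linkWeight_mul_pow (u t : V → k) (v : V) (m : ℕ) :
    linkWeight u t v * t ^ m = u * t ^ (m + 1) - t v • (u * t ^ m) := by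
  ext w
  simp only [linkWeight, Pi.mul_apply, Pi.pow_apply, Pi.sub_apply, Pi.smul_apply, smul_eq_mul]
  ring

lemma bd_linkWeight (u t : V → k) (v : V) (m : ℕ) (c : Finset V → k) :
    bd (linkWeight u t v * t ^ m) c = bd (u * t ^ (m + 1)) c - t v • bd (u * t ^ m) c := by
  rw [linkWeight_mul_pow, bd_sub_smul]

lemma linkWeight_mul_pow_self (u t : V → k) (v : V) (m : ℕ) :
    (linkWeight u t v * t ^ m) v = 0 := by
  simp [linkWeight]

lemma stressSurj_succ_of_nonempty {d r : ℕ} {u t : V → k} {K : Set (Finset V)}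
    (hK : IsLowerSet K) {G : Finset V} {v : V} (hv : v ∈ G) (huv : u v ≠ 0)
    (h : StressSurj d r (linkWeight u t v) t (link K {v}) (G.erase v)) :
    StressSurj (d + 1) (r + 1) u t K G := by
  intro j hj z hz
  have haway : away v z ∈ stress (linkWeight u t v) t (r + 1) j
      (star (link K {v}) (G.erase v)) := by
    refine ⟨fun S hS => ?_, fun m hm => ?_⟩
    · by_cases hvS : v ∈ S
      · simp [away, hvS] at hS
      · simp only [away, hvS, if_false] at hS
        exact ⟨(mem_star_link hv S).2 ⟨hvS, (hz.1 S hS).1⟩, (hz.1 S hS).2⟩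
    · rw [bd_away (linkWeight_mul_pow_self u t v m), bd_linkWeight, hz.2 _ (by omega),
        hz.2 _ (by omega)]
      ext S
      simp [away]
  obtain ⟨a, ha, haz⟩ := h j (by omega) _ haway
  have hstar : ∀ S ∈ star (link K {v}) (G.erase v), insert v S ∈ star K G := fun S hS =>
    insert_mem_star hv S ((mem_star_link hv S).1 hS).2
  have hz0 : bd u z = 0 := by simpa using hz.2 0 (by omega)
  set c := (u v)⁻¹ • bd u (join v a) with hc
  have hcu : bd u c = 0 := by rw [hc, map_smul, bd_bd, smul_zero]
  have hstep : ∀ m, bd (linkWeight u t v * t ^ m) c =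
      (u v)⁻¹ • bd u (join v (bd (linkWeight u t v * t ^ m) a)) := by
    intro m
    rw [hc, map_smul, bd_comm, bd_join, linkWeight_mul_pow_self, zero_smul, zero_add]
  have hkill : ∀ m ≤ r, bd (u * t ^ m) c = 0 := by
    intro m
    induction m with
    | zero => intro _; simpa using hcu
    | succ m ih =>
      intro hm
      have h1 := bd_linkWeight u t v m c
      rw [hstep, ha.2 m (by omega), map_zero, map_zero, smul_zero, ih (by omega), smul_zero,
        sub_zero] at h1
      exact h1.symm
  refine ⟨c, ⟨Submodule.smul_mem _ _ (bd_mem_chains (isLowerSet_star hK G)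
    (join_mem_chains hstar ha.1) _), fun m hm => hkill m (by omega)⟩, ?_⟩
  have h1 := bd_linkWeight u t v r c
  rw [hkill r le_rfl, smul_zero, sub_zero, hstep, haz, join_away, bd_join, hz0, map_zero, add_zero,
    inv_smul_smul₀ huv] at h1
  exact h1.symm

/-- Families `b G S` of chains, the chain `b G` lying in the star of `G`, where `G` ranges over the
`g`-element members of `K`. -/
def StarFamily (u t : V → k) (r j g : ℕ) (K : Set (Finset V)) (b : Finset V → Finset V → k) :
    Prop :=
  (∀ G S, b G S ≠ 0 → G ∪ S ∈ K ∧ G.card = g ∧ S.card = j) ∧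
    ∀ G, ∀ m < r, bd (u * t ^ m) (b G) = 0

/-- The boundary of a family of chains in the index direction. -/
def famBd (b : Finset V → Finset V → k) (H S : Finset V) : k := bd 1 (fun G => b G S) H

lemma famBd_famBd (b : Finset V → Finset V → k) : famBd (famBd b) = 0 := by
  ext H S
  exact congrFun (bd_bd 1 fun G => b G S) H

lemma famBd_add (b b' : Finset V → Finset V → k) : famBd (b + b') = famBd b + famBd b' := by
  ext H S
  exact congrFun (map_add (bd 1) (fun G => b G S) (fun G => b' G S)) H

lemma famBd_eq_sum (b : Finset V → Finset V → k) (H : Finset V) :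
    famBd b H = ∑ v ∈ Hᶜ, b (insert v H) := by
  ext S
  simp [famBd, bd_apply]

lemma bd_famBd (θ : V → k) (b : Finset V → Finset V → k) (H : Finset V) :
    bd θ (famBd b H) = famBd (fun G => bd θ (b G)) H := by
  rw [famBd_eq_sum, famBd_eq_sum, map_sum]

/-- Exactness of the complex of star families. -/
def StarExact (d r j g : ℕ) (u t : V → k) (K : Set (Finset V)) : Prop :=
  g + j + r ≤ d → g + j + 1 ≤ d → ∀ b, StarFamily u t r j g K b → famBd b = 0 →
    ∃ c, StarFamily u t r j (g + 1) K c ∧ famBd c = b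

lemma starExact_zero {d : ℕ} {K : Set (Finset V)} (hK : IsLowerSet K) (hCM : IsCM k d K)
    (u t : V → k) (j g : ℕ) : StarExact d 0 j g u t K := by
  intro _ hd b hb hb0
  have key : ∀ S : Finset V, ∃ c ∈ chains k (star K S) (g + 1),
      bd 1 c = (fun G => b G S) ∧ (S.card ≠ j → c = 0) := by
    intro S
    have hbS : (fun G => b G S) ∈ chains k (star K S) g := fun G hG =>
      ⟨(hb.1 G S hG).1, (hb.1 G S hG).2.1⟩
    have hbS0 : bd 1 (fun G => b G S) = 0 := by
      ext H
      exact congrFun (congrFun hb0 H) S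
    by_cases hzero : (fun G => b G S) = 0
    · exact ⟨0, zero_mem _, by rw [map_zero, hzero], fun _ => rfl⟩
    obtain ⟨G, hG⟩ := Function.ne_iff.1 hzero
    have hS : S.card = j := (hb.1 G S hG).2.2
    rcases S.eq_empty_or_nonempty with rfl | ⟨v, hv⟩
    · have hKe : ∅ ∈ K := hK (Finset.empty_subset _) (hb.1 G ∅ hG).1
      have h := hCM ∅ hKe
      rw [link_empty] at h
      rw [star_empty] at hbS ⊢
      obtain ⟨c, hc, hcb⟩ := h g (by simp; omega) _ hbS hbS0
      exact ⟨c, hc, hcb, fun h => absurd hS h⟩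
    · refine ⟨join v (fun G => b G S), join_mem_chains (insert_mem_star hv) hbS, ?_,
        fun h => absurd hS h⟩
      rw [bd_join, hbS0, map_zero, add_zero, Pi.one_apply, one_smul]
  choose c hc hcb hcj using key
  refine ⟨fun G S => c S G, ⟨fun G S hGS => ?_, fun _ _ h => absurd h (by omega)⟩, ?_⟩
  · refine ⟨(hc S G hGS).1, (hc S G hGS).2, ?_⟩
    by_contra hne
    exact hGS (congrFun (hcj S hne) G)
  · ext H S
    exact congrFun (hcb S) H

lemma starFamily_zero {r g : ℕ} {u t : V → k} {K : Set (Finset V)} {b : Finset V → Finset V → k}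
    (h : StarFamily u t 0 0 g K b) : StarFamily u t r 0 g K b := by
  refine ⟨h.1, fun G m _ => bd_eq_zero_of_chains_zero (K := univ) (fun S hS => ?_) _⟩
  exact ⟨trivial, (h.1 G S hS).2.2⟩

lemma starExact_of_stressSurj {d r j g : ℕ} {u t : V → k} {K : Set (Finset V)}
    (hK : IsLowerSet K) (hCM : IsCM k d K)
    (h : ∀ s < r, ∀ G ∈ K, G.Nonempty → StressSurj d s u t K G) : StarExact d r j g u t K := by
  induction r generalizing j g with
  | zero => exact starExact_zero hK hCM u t j g
  | succ r ihr =>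
    have ihr := fun j g => @ihr j g fun s hs => h s (by omega)
    induction j generalizing g with
    | zero =>
      intro _ hd b hb hb0
      obtain ⟨c, hc, hcb⟩ := starExact_zero hK hCM u t 0 g (by omega) hd b
        ⟨hb.1, fun _ _ h => absurd h (by omega)⟩ hb0
      exact ⟨c, starFamily_zero hc, hcb⟩
    | succ j ihj =>
      intro hd hd' b hb hb0
      obtain ⟨c, hc, hcb⟩ := ihr (j + 1) g (by omega) (by omega) b
        ⟨hb.1, fun G m hm => hb.2 G m (by omega)⟩ hb0
      have hcstress : ∀ G, c G ∈ stress u t r (j + 1) (star K G) := fun G =>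
        ⟨fun S hS => ⟨by rw [star, Set.mem_ofPred_eq, Finset.union_comm]; exact (hc.1 G S hS).1,
          (hc.1 G S hS).2.2⟩, hc.2 G⟩
      have hbc : StarFamily u t (r + 1) j (g + 1) K fun G => bd (u * t ^ r) (c G) := by
        refine ⟨fun G S hGS => ?_, fun G => (bd_mem_stress (isLowerSet_star hK G)
          (hcstress G)).2⟩
        have h1 := (bd_mem_stress (isLowerSet_star hK G) (hcstress G)).1 S hGS
        refine ⟨by rw [Finset.union_comm]; exact h1.1, ?_, h1.2⟩
        by_contra hne
        have : c G = 0 := by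
          ext S
          by_contra hS
          exact hne (hc.1 G S hS).2.1
        simp [this] at hGS
      obtain ⟨e, he, hec⟩ := ihj (g := g + 1) (by omega) (by omega) _ hbc (by
        ext1 H
        rw [← bd_famBd, hcb, hb.2 H r (by omega)]
        rfl)
      have key : ∀ G, ∃ f ∈ stress u t r (j + 1) (star K G),
          bd (u * t ^ r) f = e G ∧ (G.card ≠ g + 1 + 1 → f = 0) := by
        intro G
        by_cases hz : e G = 0
        · exact ⟨0, zero_mem _, by rw [map_zero, hz], fun _ => rfl⟩
        obtain ⟨S, hS⟩ := Function.ne_iff.1 hz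
        obtain ⟨h1, h2, -⟩ := he.1 G S hS
        obtain ⟨f, hf, hfe⟩ := h r (by omega) G (hK Finset.subset_union_left h1)
          (Finset.card_pos.1 (by omega)) j (by omega) (e G)
          ⟨fun S hS => ⟨by rw [star, Set.mem_ofPred_eq, Finset.union_comm]; exact (he.1 G S hS).1,
            (he.1 G S hS).2.2⟩, he.2 G⟩
        exact ⟨f, hf, hfe, fun h => absurd h2 h⟩
      choose f hf hfe hfg using key
      refine ⟨c + famBd f, ⟨fun G S hGS => ?_, fun G m hm => ?_⟩, ?_⟩
      · by_cases hcGS : c G S = 0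
        · rw [Pi.add_apply, Pi.add_apply, hcGS, zero_add, famBd_eq_sum, Finset.sum_apply] at hGS
          obtain ⟨v, hv, hne⟩ := Finset.exists_ne_zero_of_sum_ne_zero hGS
          obtain ⟨h1, h2⟩ := (hf _).1 S hne
          refine ⟨hK ?_ h1, ?_, h2⟩
          · rw [Finset.union_comm S]
            exact Finset.union_subset_union_left (Finset.subset_insert _ _)
          · by_contra hcard
            rw [hfg (insert v G) (by
              rw [Finset.card_insert_of_notMem (by simpa using hv)]; omega)] at hne
            exact hne rfl
        · exact hc.1 G S hcGS
      · rw [Pi.add_apply, map_add, bd_famBd]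
        rcases Nat.lt_succ_iff_lt_or_eq.1 hm with hm' | rfl
        · have : (fun G => bd (u * t ^ m) (f G)) = 0 := by
            ext1 G'
            exact (hf G').2 m hm'
          rw [hc.2 G m hm', this, zero_add, famBd_eq_sum]
          simp
        · simp only [hfe]
          rw [hec]
          exact add_self_of_charTwo (k := k) _
      · rw [famBd_add, famBd_famBd, add_zero, hcb]

theorem stressSurj_of_isCM {d r : ℕ} {u t : V → k} (ht : Function.Injective t)
    {K : Set (Finset V)} (hK : IsLowerSet K) (hCM : IsCM k d K)
    (hu : ∀ S ∈ K, ∀ v ∈ S, u v ≠ 0) {G : Finset V} (hG : G ∈ K) : StressSurj d r u t K G := by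
  induction r using Nat.strong_induction_on generalizing d u K G with
  | h r ih =>
  have hne : ∀ s ≤ r, ∀ G ∈ K, G.Nonempty → StressSurj d s u t K G := by
    rintro s hs G hG ⟨v, hv⟩
    rcases s with _ | s
    · exact stressSurj_zero_of_nonempty hv (hu G hG v hv)
    · rcases d with _ | d
      · intro j hj
        omega
      · refine stressSurj_succ_of_nonempty hK hv (hu G hG v hv)
          (ih s (by omega) (isLowerSet_link hK _) (hCM.link_singleton v) ?_ ?_)
        · rintro S ⟨hvS, hS⟩ w hw
          refine mul_ne_zero (hu _ hS w (Finset.mem_union_left _ hw)) (sub_ne_zero.2 fun h => ?_)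
          exact Finset.disjoint_left.1 hvS hw (by simp [ht h])
        · exact ⟨by simp, by rwa [Finset.union_comm, ← Finset.insert_eq, Finset.insert_erase hv]⟩
  rcases G.eq_empty_or_nonempty with rfl | hGne
  swap
  · exact hne r le_rfl G hG hGne
  rw [StressSurj, star_empty]
  intro j hj z hz
  rcases r with _ | r
  · have h := hCM ∅ hG
    rw [link_empty] at h
    obtain ⟨b, hb, hbz⟩ := h.weighted hK hu (j := j) (by simp; omega) hz.1
      (by simpa using hz.2 0 one_pos)
    exact ⟨b, ⟨hb, by simp⟩, by simpa using hbz⟩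
  obtain ⟨b, hb, hbz⟩ := starExact_of_stressSurj (r := r + 1 + 1) (j := j) (g := 0) (d := d)
    hK hCM (fun s hs => hne s (by omega)) (by omega) (by omega)
    (fun G => if G = ∅ then z else 0) ⟨fun G S hGS => by
      by_cases hG : G = ∅
      · subst hG
        simpa using hz.1 S (by simpa using hGS)
      · simp [hG] at hGS, fun G m hm => by
      by_cases hG : G = ∅
      · simpa [hG] using hz.2 m hm
      · simp [hG]⟩ (by
      ext H S
      simp [famBd, bd_apply])
  have key : ∀ v : V, ∃ c ∈ stress u t (r + 1) (j + 1) K, bd (u * t ^ (r + 1)) c = b {v} := by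
    intro v
    by_cases hv : {v} ∈ K
    · obtain ⟨c, hc, hcb⟩ := hne (r + 1) le_rfl {v} hv (by simp) j hj (b {v})
        ⟨fun S hS => ⟨by rw [star, Set.mem_ofPred_eq, Finset.union_comm]; exact (hb.1 _ S hS).1,
            (hb.1 _ S hS).2.2⟩, hb.2 _⟩
      exact ⟨c, stress_mono (fun S hS _ => hK Finset.subset_union_left hS) hc, hcb⟩
    · refine ⟨0, zero_mem _, ?_⟩
      rw [map_zero]
      ext S
      by_contra hS
      exact hv (hK Finset.subset_union_left (hb.1 _ S (Ne.symm hS)).1)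
  choose c hc hcb using key
  refine ⟨∑ v, c v, Submodule.sum_mem _ fun v _ => hc v, ?_⟩
  have := congrFun hbz ∅
  rw [famBd_eq_sum] at this
  simpa [hcb] using this

end CohenMacaulay

section Dimensions

variable {k : Type*} [Field k] [CharP k 2] {V : Type*} [Fintype V] [DecidableEq V]

lemma finrank_chains (K : Set (Finset V)) (j : ℕ) :
    Module.finrank k (chains k K j) = {S ∈ K | S.card = j}.ncard := by
  classical
  let e : chains k K j ≃ₗ[k] ({S : Finset V // S ∈ K ∧ S.card = j} → k) :=
    { toFun := fun c x => c.1 x.1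
      map_add' := fun _ _ => rfl
      map_smul' := fun _ _ => rfl
      invFun := fun f => ⟨fun S => if h : S ∈ K ∧ S.card = j then f ⟨S, h⟩ else 0, fun S hS => by
        by_contra h
        exact hS (dif_neg h)⟩
      left_inv := fun c => by
        ext S
        by_cases h : S ∈ K ∧ S.card = j
        · exact dif_pos h
        · refine (dif_neg h).trans ?_
          by_contra h'
          exact h (c.2 S (Ne.symm h'))
      right_inv := fun f => by
        ext x
        exact dif_pos x.2 }
  rw [e.finrank_eq, Module.finrank_fintype_fun_eq_card, ← Nat.card_eq_fintype_card]
  rfl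

/-- The dimension of the stress space with weights `1, t, …, t ^ (r - 1)`. -/
noncomputable def stressDim (t : V → k) (K : Set (Finset V)) (r j : ℕ) : ℕ :=
  Module.finrank k (stress 1 t r j K)

lemma stressDim_zero_left (t : V → k) (K : Set (Finset V)) (j : ℕ) :
    stressDim t K 0 j = {S ∈ K | S.card = j}.ncard := by
  have h : stress 1 t 0 j K = chains k K j := by
    ext c
    simp [mem_stress]
  rw [← finrank_chains (k := k), stressDim, h]

lemma stressDim_zero_right (t : V → k) {K : Set (Finset V)} (hK : ∅ ∈ K) (r : ℕ) :
    stressDim t K r 0 = 1 := by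
  have h : stress 1 t r 0 K = chains k K 0 := by
    ext c
    exact ⟨fun h => h.1, fun h => ⟨h, fun m _ => bd_eq_zero_of_chains_zero h _⟩⟩
  have h' : {S ∈ K | S.card = 0} = {∅} := by
    ext S
    simp only [Finset.card_eq_zero, Set.mem_ofPred_eq, Set.mem_singleton_iff]
    exact ⟨fun h => h.2, fun h => ⟨h ▸ hK, h⟩⟩
  rw [stressDim, h, finrank_chains, h', Set.ncard_singleton]

lemma stressDim_le {t : V → k} {K L : Set (Finset V)} {r j : ℕ}
    (h : ∀ S ∈ K, S.card = j → S ∈ L) : stressDim t K r j ≤ stressDim t L r j :=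
  Submodule.finrank_mono (stress_mono h)

lemma stressDim_succ {t : V → k} {K : Set (Finset V)} (hK : IsLowerSet K) {r j : ℕ}
    (h : ∀ z ∈ stress 1 t (r + 1) j K, ∃ c ∈ stress 1 t r (j + 1) K, bd (1 * t ^ r) c = z) :
    stressDim t K r (j + 1) = stressDim t K (r + 1) (j + 1) + stressDim t K (r + 1) j := by
  let f : stress 1 t r (j + 1) K →ₗ[k] (Finset V → k) :=
    (bd (1 * t ^ r)).comp (stress 1 t r (j + 1) K).subtype
  have hr : LinearMap.range f = stress 1 t (r + 1) j K := by
    ext z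
    constructor
    · rintro ⟨c, rfl⟩
      exact bd_mem_stress hK c.2
    · intro hz
      obtain ⟨c, hc, hcz⟩ := h z hz
      exact ⟨⟨c, hc⟩, hcz⟩
  have hk : (LinearMap.ker f).map (stress 1 t r (j + 1) K).subtype =
      stress 1 t (r + 1) (j + 1) K := by
    ext c
    constructor
    · rintro ⟨c, hc, rfl⟩
      refine ⟨c.2.1, fun m hm => ?_⟩
      rcases Nat.lt_succ_iff_lt_or_eq.1 hm with h | rfl
      · exact c.2.2 m h
      · exact hc
    · intro hc
      exact ⟨⟨c, hc.1, fun m hm => hc.2 m (by omega)⟩, hc.2 r (by omega), rfl⟩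
  have := f.finrank_range_add_finrank_ker
  rw [hr, ← Submodule.finrank_map_subtype_eq, hk] at this
  rw [stressDim, stressDim, stressDim, ← this, add_comm]

lemma stressDim_succ_of_isCM {t : V → k} (ht : Function.Injective t) {K : Set (Finset V)}
    (hK : IsLowerSet K) (hK0 : ∅ ∈ K) {d : ℕ} (hCM : IsCM k d K) {r j : ℕ} (h : j + r + 1 ≤ d) :
    stressDim t K r (j + 1) = stressDim t K (r + 1) (j + 1) + stressDim t K (r + 1) j := by
  refine stressDim_succ hK fun z hz => ?_
  obtain ⟨c, hc, hcz⟩ := stressSurj_of_isCM (r := r) ht hK hCM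
    (fun _ _ _ _ => one_ne_zero) hK0 j h z (by rwa [star_empty])
  rw [star_empty] at hc
  exact ⟨c, hc, hcz⟩

end Dimensions

section Numerics

/-- The recursion satisfied by the dimensions of the stress spaces of a Cohen-Macaulay complex. -/
structure IsPascal (d : ℕ) (z : ℕ → ℕ → ℕ) : Prop where
  zero : ∀ r, z r 0 = 1
  succ : ∀ r j, j + r + 1 ≤ d → z r (j + 1) = z (r + 1) (j + 1) + z (r + 1) j

lemma IsPascal.le {d : ℕ} {z z' : ℕ → ℕ → ℕ} (hz : IsPascal d z) (hz' : IsPascal d z')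
    (h : ∀ i ≤ d, z (d + 1 - i) i ≤ z' (d + 1 - i) i) {r j : ℕ} (hrj : r + j ≤ d) :
    z r j ≤ z' r j := by
  have key : ∀ n j r, r + j + n = d + 1 → j ≤ d → z r j ≤ z' r j := by
    intro n
    induction n with
    | zero =>
      intro j r hr hj
      obtain rfl : r = d + 1 - j := by omega
      exact h j hj
    | succ n ihn =>
      intro j
      induction j with
      | zero => intro r _ _; rw [hz.zero, hz'.zero]
      | succ j ihj =>
        intro r hr hj
        rw [hz.succ r j (by omega), hz'.succ r j (by omega)]
        exact Nat.add_le_add (ihn _ _ (by omega) hj) (ihj _ (by omega) (by omega))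
  exact key (d + 1 - (r + j)) j r (by omega) (by omega)

lemma IsPascal.sum_eq {d : ℕ} {z : ℕ → ℕ → ℕ} (hz : IsPascal d z) (x : ℚ) :
    ∑ j ∈ Finset.range (d + 1), (z 0 j : ℚ) * x ^ j =
      ∑ i ∈ Finset.range (d + 1), (z (d + 1 - i) i : ℚ) * (x ^ i * (1 + x) ^ (d - i)) := by
  have key : ∀ m ≤ d, ∑ j ∈ Finset.range (m + 1), (z (d - m) j : ℚ) * x ^ j =
      ∑ i ∈ Finset.range (m + 1), (z (d + 1 - i) i : ℚ) * (x ^ i * (1 + x) ^ (m - i)) := by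
    intro m
    induction m with
    | zero => simp [hz.zero]
    | succ m ih =>
      intro hm
      have h1 : ∑ i ∈ Finset.range (m + 1), (z (d + 1 - i) i : ℚ) *
          (x ^ i * (1 + x) ^ (m + 1 - i)) = (1 + x) * ∑ i ∈ Finset.range (m + 1),
            (z (d + 1 - i) i : ℚ) * (x ^ i * (1 + x) ^ (m - i)) := by
        rw [Finset.mul_sum]
        refine Finset.sum_congr rfl fun i hi => ?_
        have hi' := Finset.mem_range.1 hi
        rw [show m + 1 - i = m - i + 1 by omega, pow_succ]
        ring
      have h2 : ∀ j ∈ Finset.range (m + 1), (z (d - (m + 1)) (j + 1) : ℚ) * x ^ (j + 1) =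
          z (d - m) (j + 1) * x ^ (j + 1) + z (d - m) j * x ^ (j + 1) := by
        intro j hj
        have hj' := Finset.mem_range.1 hj
        rw [hz.succ _ _ (by omega), show d - (m + 1) + 1 = d - m by omega]
        push_cast
        ring
      have h3 : ∑ j ∈ Finset.range (m + 1), (z (d - m) j : ℚ) * x ^ (j + 1) =
          x * ∑ j ∈ Finset.range (m + 1), (z (d - m) j : ℚ) * x ^ j := by
        rw [Finset.mul_sum]
        exact Finset.sum_congr rfl fun j _ => by ring
      have h4 : ∑ j ∈ Finset.range (m + 1), (z (d - m) (j + 1) : ℚ) * x ^ (j + 1) =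
          (∑ j ∈ Finset.range (m + 1), (z (d - m) j : ℚ) * x ^ j) +
            z (d - m) (m + 1) * x ^ (m + 1) - 1 := by
        rw [← Finset.sum_range_succ (fun j => (z (d - m) j : ℚ) * x ^ j),
          Finset.sum_range_succ' (fun j => (z (d - m) j : ℚ) * x ^ j), hz.zero]
        simp
      rw [Finset.sum_range_succ', Finset.sum_congr rfl h2, Finset.sum_add_distrib,
        Finset.sum_range_succ (fun i => (z (d + 1 - i) i : ℚ) * (x ^ i * (1 + x) ^ (m + 1 - i))),
        h1, ← ih (by omega), show d + 1 - (m + 1) = d - m by omega, h3, h4, hz.zero, Nat.sub_self]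
      push_cast
      ring
  simpa using key d le_rfl

lemma eq_zero_of_forall_sum_eq_zero {d : ℕ} {a : ℕ → ℚ}
    (h : ∀ x : ℚ, ∑ i ∈ Finset.range (d + 1), a i * (x ^ i * (1 + x) ^ (d - i)) = 0) {i : ℕ}
    (hi : i ≤ d) : a i = 0 := by
  let p : Polynomial ℚ := ∑ i ∈ Finset.range (d + 1), Polynomial.C (a i) * Polynomial.X ^ i
  have hp : p = 0 := by
    refine Polynomial.eq_zero_of_infinite_isRoot p
      ((Set.finite_singleton (1 : ℚ)).infinite_compl.mono fun y hy => ?_)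
    have hy' : 1 - y ≠ 0 := sub_ne_zero.2 (Ne.symm hy)
    have h1 := h (y / (1 - y))
    have h2 : 1 + y / (1 - y) = 1 / (1 - y) := by field_simp; ring
    have h3 : ∑ i ∈ Finset.range (d + 1), a i * ((y / (1 - y)) ^ i *
        (1 + y / (1 - y)) ^ (d - i)) = (∑ i ∈ Finset.range (d + 1), a i * y ^ i) *
          (1 / (1 - y)) ^ d := by
      rw [Finset.sum_mul]
      refine Finset.sum_congr rfl fun i hi => ?_
      have hi' : i ≤ d := by simpa [Nat.lt_succ_iff] using hi
      rw [h2, div_eq_mul_one_div y, mul_pow, mul_assoc (y ^ i), ← pow_add,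
        Nat.add_sub_cancel' hi', mul_assoc]
    rw [h3] at h1
    have h4 := (mul_eq_zero.1 h1).resolve_right (pow_ne_zero _ (one_div_ne_zero hy'))
    simpa [p, Polynomial.IsRoot, Polynomial.eval_finsetSum] using h4
  have := congrArg (fun q => q.coeff i) hp
  simpa [p, Polynomial.finsetSum_coeff, Polynomial.coeff_C_mul, Polynomial.coeff_X_pow,
    Nat.lt_succ_iff, hi] using this

lemma IsPascal.symm {d : ℕ} {z : ℕ → ℕ → ℕ} (hz : IsPascal d z)
    (hE : ∀ x : ℚ, ∑ j ∈ Finset.range (d + 1), (z 0 j : ℚ) * (-1 - x) ^ j =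
      (-1) ^ d * ∑ j ∈ Finset.range (d + 1), (z 0 j : ℚ) * x ^ j) {i : ℕ} (hi : i ≤ d) :
    z (d + 1 - i) i = z (d + 1 - (d - i)) (d - i) := by
  have key : ∀ x : ℚ, ∑ i ∈ Finset.range (d + 1),
      ((z (d + 1 - i) i : ℚ) - z (d + 1 - (d - i)) (d - i)) * (x ^ i * (1 + x) ^ (d - i)) = 0 := by
    intro x
    have h1 := hE x
    rw [hz.sum_eq, hz.sum_eq, ← Finset.sum_range_reflect] at h1
    have h2 : ∑ j ∈ Finset.range (d + 1), (z (d + 1 - (d + 1 - 1 - j)) (d + 1 - 1 - j) : ℚ) *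
        ((-1 - x) ^ (d + 1 - 1 - j) * (1 + (-1 - x)) ^ (d - (d + 1 - 1 - j))) =
        (-1) ^ d * ∑ i ∈ Finset.range (d + 1), (z (d + 1 - (d - i)) (d - i) : ℚ) *
          (x ^ i * (1 + x) ^ (d - i)) := by
      rw [Finset.mul_sum]
      refine Finset.sum_congr rfl fun j hj => ?_
      have hj' : j ≤ d := by simpa [Nat.lt_succ_iff] using hj
      rw [Nat.add_sub_cancel, Nat.sub_sub_self hj', show -1 - x = -1 * (1 + x) by ring,
        show 1 + -1 * (1 + x) = -1 * x by ring, mul_pow, mul_pow]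
      have : (-1 : ℚ) ^ d = (-1) ^ (d - j) * (-1) ^ j := by
        rw [← pow_add, Nat.sub_add_cancel hj']
      rw [this]
      ring
    rw [h2] at h1
    have h3 := mul_left_cancel₀ (pow_ne_zero d (by norm_num : (-1 : ℚ) ≠ 0)) h1
    simp only [sub_mul, Finset.sum_sub_distrib]
    rw [h3, sub_self]
  have := eq_zero_of_forall_sum_eq_zero key hi
  exact_mod_cast sub_eq_zero.1 this

end Numerics

section Antistar

variable {k : Type*} [Field k] [CharP k 2] {V : Type*} [Fintype V] [DecidableEq V]

/-- The faces of `K` that do not contain `F`. -/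
def antistar (K : Set (Finset V)) (F : Finset V) : Set (Finset V) := {S | S ∈ K ∧ ¬ F ⊆ S}

lemma isLowerSet_antistar {K : Set (Finset V)} (hK : IsLowerSet K) (F : Finset V) :
    IsLowerSet (antistar K F) := fun _ _ hTS hS =>
  ⟨hK hTS hS.1, fun h => hS.2 (h.trans hTS)⟩

/-- The coefficients of a chain along the faces containing `F`, as a chain on the link. -/
def linkPart (F : Finset V) : (Finset V → k) →ₗ[k] (Finset V → k) where
  toFun c G := if Disjoint G F then c (G ∪ F) else 0
  map_add' c c' := by
    ext G
    by_cases h : Disjoint G F <;> simp [h]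
  map_smul' a c := by
    ext G
    simp

lemma linkPart_apply (F : Finset V) (c : Finset V → k) (G : Finset V) :
    linkPart F c G = if Disjoint G F then c (G ∪ F) else 0 := rfl

lemma bd_linkPart (F : Finset V) (c : Finset V → k) :
    bd 1 (linkPart F c) = linkPart F (bd 1 c) := by
  ext G
  rw [linkPart_apply, bd_apply]
  split_ifs with h
  · rw [bd_apply]
    symm
    refine Finset.sum_subset_zero_on_sdiff ?_ ?_ ?_
    · exact Finset.compl_subset_compl.2 Finset.subset_union_left
    · intro v hv
      have hvF : v ∈ F := by
        simp only [Finset.mem_sdiff, Finset.mem_compl, Finset.mem_union, not_or, not_and,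
          not_not] at hv
        exact hv.2 hv.1
      rw [linkPart_apply, if_neg (by simp [hvF]), mul_zero]
    · intro v hv
      have hvF : v ∉ F := by
        simp only [Finset.mem_compl, Finset.mem_union, not_or] at hv
        exact hv.2
      rw [linkPart_apply, if_pos (by simp [hvF, h]), Finset.insert_union]
  · refine Finset.sum_eq_zero fun v _ => ?_
    rw [linkPart_apply, if_neg (by simp [h]), mul_zero]

lemma linkPart_mem_chains {K : Set (Finset V)} {F : Finset V} {j : ℕ} {c : Finset V → k}
    (hc : c ∈ chains k K (j + F.card)) : linkPart F c ∈ chains k (link K F) j := by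
  intro S hS
  rw [linkPart_apply] at hS
  split_ifs at hS with h
  · obtain ⟨h1, h2⟩ := hc _ hS
    rw [Finset.card_union_of_disjoint h] at h2
    exact ⟨⟨h, h1⟩, by omega⟩
  · exact absurd rfl hS

lemma linkPart_eq_zero {K : Set (Finset V)} {F : Finset V} {j : ℕ} {c : Finset V → k}
    (hc : c ∈ chains k (antistar K F) j) : linkPart F c = 0 := by
  ext S
  by_contra h
  rw [linkPart_apply] at h
  split_ifs at h
  · exact (hc _ h).1.2 Finset.subset_union_right
  · exact h rfl

/-- The join of a chain with the face `F`. -/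
def joinFace (F : Finset V) (c : Finset V → k) (S : Finset V) : k :=
  if F ⊆ S then c (S \ F) else 0

lemma joinFace_mem_chains {K : Set (Finset V)} {F : Finset V} {j : ℕ} {c : Finset V → k}
    (hc : c ∈ chains k (link K F) j) : joinFace F c ∈ chains k K (j + F.card) := by
  intro S hS
  rw [joinFace] at hS
  split_ifs at hS with h
  · obtain ⟨h1, h2⟩ := hc _ hS
    have h3 := h1.2
    rw [Finset.sdiff_union_of_subset h] at h3
    exact ⟨h3, by rw [← h2, Finset.card_sdiff_add_card_eq_card h]⟩
  · exact absurd rfl hS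

lemma linkPart_joinFace {K : Set (Finset V)} {F : Finset V} {j : ℕ} {c : Finset V → k}
    (hc : c ∈ chains k (link K F) j) : linkPart F (joinFace F c) = c := by
  ext S
  rw [linkPart_apply]
  split_ifs with h
  · rw [joinFace, if_pos Finset.subset_union_right, Finset.union_sdiff_cancel_right h]
  · by_contra h'
    exact h (hc _ (Ne.symm h')).1.1

lemma acyclicBelow_of_antistar {d : ℕ} {K : Set (Finset V)}
    {F : Finset V} (hFd : F.card = d)
    (hA : AcyclicBelow k d (antistar K F)) : AcyclicBelow k d K := by
  intro j hj c hc hcy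
  obtain ⟨b, hb, hbc⟩ := hA j hj c (fun S hS => ⟨⟨(hc S hS).1, fun h => by
    have := Finset.card_le_card h
    have := (hc S hS).2
    omega⟩, (hc S hS).2⟩) hcy
  exact ⟨b, chains_mono (fun S hS _ => hS.1) hb, hbc⟩

lemma isCM_of_antistar {d : ℕ} {K : Set (Finset V)} (hK : IsLowerSet K)
    {F₀ : Finset V} (hF₀d : F₀.card = d)
    (hF₀ : AcyclicBelow k d (antistar K F₀))
    (hA : ∀ F ∈ K, F.Nonempty → AcyclicBelow k d (antistar K F)) : IsCM k d K := by
  have hKd := acyclicBelow_of_antistar hF₀d hF₀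
  intro F hF
  rcases F.eq_empty_or_nonempty with rfl | hne
  · rwa [Finset.card_empty, Nat.sub_zero, link_empty]
  intro j hj z hz hzc
  obtain ⟨m, hm⟩ : ∃ m, F.card = m + 1 := ⟨F.card - 1, by have := hne.card_pos; omega⟩
  have he := joinFace_mem_chains hz
  rw [hm, ← add_assoc] at he
  have hle := linkPart_joinFace hz
  have hy := bd_mem_chains hK he 1
  have hly : linkPart F (bd 1 (joinFace F z)) = 0 := by
    rw [← bd_linkPart, hle, hzc]
  have hyA : bd 1 (joinFace F z) ∈ chains k (antistar K F) (j + m) := by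
    refine fun S hS => ⟨⟨(hy S hS).1, fun hFS => hS ?_⟩, (hy S hS).2⟩
    have := congrFun hly (S \ F)
    rwa [linkPart_apply, if_pos Finset.sdiff_disjoint, Finset.sdiff_union_of_subset hFS] at this
  obtain ⟨b, hb, hby⟩ := hA F hF hne (j + m) (by omega) _ hyA (bd_bd _ _)
  obtain ⟨w, hw, hwe⟩ := hKd (j + m + 1) (by omega) (joinFace F z - b)
    (sub_mem he (chains_mono (fun S hS _ => hS.1) hb)) (by rw [map_sub, hby, sub_self])
  refine ⟨linkPart F w, linkPart_mem_chains (by rwa [hm, show j + 1 + (m + 1) = j + m + 1 + 1 by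
    ring]), ?_⟩
  rw [bd_linkPart, hwe, map_sub, hle, linkPart_eq_zero hb, sub_zero]

lemma exists_superset_card_eq {d : ℕ} {K : Set (Finset V)} (hCM : IsCM k d K) {F : Finset V}
    (hF : F ∈ K) {m : ℕ} (hFm : F.card ≤ m) (hm : m ≤ d) : ∃ G ∈ K, F ⊆ G ∧ G.card = m := by
  induction m, hFm using Nat.le_induction with
  | base => exact ⟨F, hF, subset_rfl, rfl⟩
  | succ m _ ih =>
    obtain ⟨G, hG, hFG, hGm⟩ := ih (by omega)
    have h0 : (Pi.single ∅ 1 : Finset V → k) ∈ chains k (link K G) 0 := by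
      intro S hS
      have : S = ∅ := by
        by_contra h
        exact hS (by simp [h])
      subst this
      exact ⟨⟨by simp, by simpa using hG⟩, rfl⟩
    obtain ⟨b, hb, hb0⟩ := hCM G hG 0 (by omega) _ h0 (bd_eq_zero_of_chains_zero h0 _)
    have hb1 : b ≠ 0 := by
      rintro rfl
      have := congrFun hb0 ∅
      simp at this
    obtain ⟨S, hS⟩ := Function.ne_iff.1 hb1
    obtain ⟨⟨hSG, hSK⟩, hS1⟩ := hb S hS
    exact ⟨S ∪ G, hSK, hFG.trans Finset.subset_union_right, by
      rw [Finset.card_union_of_disjoint hSG]; omega⟩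

/-- The number of faces with `j` elements. -/
noncomputable def faceCount (K : Set (Finset V)) (j : ℕ) : ℕ := {S ∈ K | S.card = j}.ncard

lemma sum_faceCount_mul {K : Set (Finset V)} {d : ℕ} (hKd : ∀ S ∈ K, S.card ≤ d) (g : ℕ → ℚ) :
    ∑ j ∈ Finset.range (d + 1), (faceCount K j : ℚ) * g j =
      ∑ S ∈ K.toFinite.toFinset, g S.card := by
  rw [← Finset.sum_fiberwise_of_maps_to (t := Finset.range (d + 1)) (g := Finset.card)]
  · refine Finset.sum_congr rfl fun j _ => ?_
    rw [Finset.sum_congr rfl (g := fun _ => g j), Finset.sum_const, nsmul_eq_mul]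
    · congr 2
      rw [faceCount, ← Set.ncard_coe_finset]
      congr 1
      ext S
      simp
    · intro S hS
      rw [(Finset.mem_filter.1 hS).2]
  · intro S hS
    rw [Finset.mem_range, Nat.lt_succ_iff]
    exact hKd S (by simpa using hS)

variable (k) in
lemma sum_neg_one_pow_of_acyclic {K : Set (Finset V)} (hK : IsLowerSet K)
    (h : ∀ n, AcyclicBelow k n K) :
    ∑ S ∈ K.toFinite.toFinset, (-1 : ℚ) ^ S.card = 0 := by
  have hcard : ∀ S ∈ K, S.card ≤ Fintype.card V := fun S _ => Finset.card_le_univ S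
  have hz : ∀ j, stressDim (1 : V → k) K 0 (j + 1) =
      stressDim (1 : V → k) K 1 (j + 1) + stressDim (1 : V → k) K 1 j := by
    refine fun j => stressDim_succ hK fun z hz => ?_
    obtain ⟨c, hc, hcz⟩ := h (j + 1) j (by omega) z hz.1 (by simpa using hz.2 0 one_pos)
    exact ⟨c, ⟨hc, by simp⟩, by simpa using hcz⟩
  have hs : ∀ n, ∑ j ∈ Finset.range (n + 1), (faceCount K j : ℚ) * (-1) ^ j =
      (-1) ^ n * stressDim (1 : V → k) K 1 n := by
    intro n
    induction n with
    | zero =>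
      have : stress 1 (1 : V → k) 1 0 K = chains k K 0 := by
        ext c
        exact ⟨fun h => h.1, fun h => ⟨h, fun m _ => bd_eq_zero_of_chains_zero h _⟩⟩
      rw [stressDim, this, finrank_chains]
      simp [faceCount]
    | succ n ih =>
      rw [Finset.sum_range_succ, ih, faceCount, ← stressDim_zero_left (1 : V → k), hz]
      push_cast
      ring
  have htop : stressDim (1 : V → k) K 0 (Fintype.card V + 1) = 0 := by
    rw [stressDim_zero_left, Set.ncard_eq_zero]
    ext S
    simp only [Set.mem_ofPred_eq, Set.mem_empty_iff_false, iff_false, not_and]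
    intro hS h
    have := hcard S hS
    omega
  have htop' : stressDim (1 : V → k) K 1 (Fintype.card V + 1) = 0 := by
    have := hz (Fintype.card V)
    omega
  rw [← sum_faceCount_mul (fun S hS => (hcard S hS).trans (Nat.le_succ _)) (fun j => (-1) ^ j), hs,
    htop']
  simp

lemma sum_superset_eq {d : ℕ} {K : Set (Finset V)} (hK : IsLowerSet K)
    (hKd : ∀ S ∈ K, S.card ≤ d) {F₀ : Finset V} (hF₀ : F₀ ∈ K) (hF₀d : F₀.card = d) (hd : 0 < d)
    (hA : ∀ F ∈ K, F.Nonempty → ∀ n, AcyclicBelow k n (antistar K F)) {F : Finset V}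
    (hF : F ∈ K) :
    ∑ S ∈ K.toFinite.toFinset with F ⊆ S, (-1 : ℚ) ^ S.card = (-1) ^ d := by
  have key : ∀ F ∈ K, F.Nonempty → ∑ S ∈ K.toFinite.toFinset with F ⊆ S, (-1 : ℚ) ^ S.card =
      ∑ S ∈ K.toFinite.toFinset, (-1 : ℚ) ^ S.card := by
    intro F hF hne
    have := sum_neg_one_pow_of_acyclic k (isLowerSet_antistar hK F) (hA F hF hne)
    rw [← Finset.sum_filter_add_sum_filter_not K.toFinite.toFinset (fun S => F ⊆ S)]
    have h : (antistar K F).toFinite.toFinset =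
        K.toFinite.toFinset.filter fun S => ¬ F ⊆ S := by
      ext S
      simp [antistar]
    rw [← h, this, add_zero]
  have hF₀ne : F₀.Nonempty := Finset.card_pos.1 (by omega)
  have h0 : ∑ S ∈ K.toFinite.toFinset with F₀ ⊆ S, (-1 : ℚ) ^ S.card = (-1) ^ d := by
    have : (K.toFinite.toFinset.filter fun S => F₀ ⊆ S) = {F₀} := by
      ext S
      simp only [Finset.mem_filter, Set.Finite.mem_toFinset, Finset.mem_singleton]
      constructor
      · rintro ⟨hS, h⟩
        exact (Finset.eq_of_subset_of_card_le h (by rw [hF₀d]; exact hKd S hS)).symm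
      · rintro rfl
        exact ⟨hF₀, subset_rfl⟩
    rw [this, Finset.sum_singleton, hF₀d]
  rw [key F₀ hF₀ hF₀ne] at h0
  rcases F.eq_empty_or_nonempty with rfl | hne
  · simpa using h0
  · rw [key F hF hne, h0]

lemma sum_faceCount_reflect {d : ℕ} {K : Set (Finset V)} (hK : IsLowerSet K)
    (hKd : ∀ S ∈ K, S.card ≤ d)
    (hE : ∀ F ∈ K, ∑ S ∈ K.toFinite.toFinset with F ⊆ S, (-1 : ℚ) ^ S.card = (-1) ^ d) (x : ℚ) :
    ∑ j ∈ Finset.range (d + 1), (faceCount K j : ℚ) * (-1 - x) ^ j =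
      (-1) ^ d * ∑ j ∈ Finset.range (d + 1), (faceCount K j : ℚ) * x ^ j := by
  rw [sum_faceCount_mul hKd (fun j => (-1 - x) ^ j), sum_faceCount_mul hKd (fun j => x ^ j)]
  have h1 : ∀ S : Finset V, (-1 - x) ^ S.card = ∑ F ∈ S.powerset, (-1) ^ S.card * x ^ F.card := by
    intro S
    rw [← Finset.mul_sum]
    have := Finset.sum_pow_mul_eq_add_pow x 1 S
    simp only [one_pow, mul_one] at this
    rw [this, ← mul_pow]
    congr 1
    ring
  simp only [h1]
  rw [Finset.sum_comm' (s' := fun F => K.toFinite.toFinset.filter fun S => F ⊆ S)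
    (t' := K.toFinite.toFinset), Finset.mul_sum]
  · refine Finset.sum_congr rfl fun F hF => ?_
    rw [← Finset.sum_mul, hE F (by simpa using hF)]
  · intro S F
    simp only [Set.Finite.mem_toFinset, Finset.mem_powerset, Finset.mem_filter]
    exact ⟨fun h => ⟨⟨h.1, h.2⟩, hK h.2 h.1⟩, fun h => h.1⟩

end Antistar

section UpperBound

variable {V : Type*} [Fintype V] [DecidableEq V]

/-- The combinatorial shadow of a triangulated sphere of dimension `d - 1`: homologically, the
complex is a point once a nonempty face is removed. -/
structure IsSphereLike (k : Type*) [Field k] [CharP k 2] (d : ℕ) (K : Set (Finset V)) : Prop where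
  lower : IsLowerSet K
  empty_mem : ∅ ∈ K
  card_le : ∀ S ∈ K, S.card ≤ d
  exists_facet : ∃ S ∈ K, S.card = d
  acyclic : ∀ F ∈ K, F.Nonempty → ∀ n, AcyclicBelow k n (antistar K F)

variable {k : Type*} [Field k] [CharP k 2] {d : ℕ} {K L : Set (Finset V)}

lemma IsSphereLike.isCM (h : IsSphereLike k d K) (hd : 0 < d) : IsCM k d K := by
  obtain ⟨F, hF, hFd⟩ := h.exists_facet
  exact isCM_of_antistar h.lower hFd (h.acyclic F hF (Finset.card_pos.1 (by omega)) d)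
    fun F hF hne => h.acyclic F hF hne d

lemma IsSphereLike.isPascal (h : IsSphereLike k d K) (hd : 0 < d) {t : V → k}
    (ht : Function.Injective t) : IsPascal d (stressDim t K) where
  zero r := stressDim_zero_right t h.empty_mem r
  succ _ _ hrj := stressDim_succ_of_isCM ht h.lower h.empty_mem (h.isCM hd) hrj

lemma IsSphereLike.stressDim_symm (h : IsSphereLike k d K) (hd : 0 < d) {t : V → k}
    (ht : Function.Injective t) {i : ℕ} (hi : i ≤ d) :
    stressDim t K (d + 1 - i) i = stressDim t K (d + 1 - (d - i)) (d - i) := by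
  obtain ⟨F, hF, hFd⟩ := h.exists_facet
  refine (h.isPascal hd ht).symm (fun x => ?_) hi
  simp only [stressDim_zero_left]
  exact sum_faceCount_reflect h.lower h.card_le
    (fun _ => sum_superset_eq h.lower h.card_le hF hFd hd h.acyclic) x

theorem IsSphereLike.faceCount_le [Infinite k] (hK : IsSphereLike k d K) (hL : IsSphereLike k d L)
    (hd : 0 < d) (h : ∀ S ∈ K, S.card ≤ d / 2 → S ∈ L) {j : ℕ} (hj : j ≤ d) :
    faceCount K j ≤ faceCount L j := by
  obtain ⟨t⟩ : Nonempty (V ↪ k) :=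
    ⟨((Fintype.equivFin V).toEmbedding.trans Fin.valEmbedding).trans (Infinite.natEmbedding k)⟩
  have key : ∀ i ≤ d / 2, stressDim t K (d + 1 - i) i ≤ stressDim t L (d + 1 - i) i :=
    fun i hi => stressDim_le fun S hS hSi => h S hS (hSi ▸ hi)
  have := (hK.isPascal hd t.injective).le (hL.isPascal hd t.injective) (fun i hi => by
    rcases le_or_gt i (d / 2) with h | h
    · exact key i h
    · rw [hK.stressDim_symm hd t.injective hi, hL.stressDim_symm hd t.injective hi]
      exact key (d - i) (by omega)) (r := 0) (j := j) (by omega)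
  rwa [stressDim_zero_left, stressDim_zero_left] at this

end UpperBound

section Carriers

variable {k : Type*} [Field k] [CharP k 2] {A B : Type*} [DecidableEq A] [DecidableEq B]

variable (k A) in
/-- The simplicial boundary of finitely supported chains on an arbitrary vertex set. -/
noncomputable def bdry : (Finset A →₀ k) →ₗ[k] (Finset A →₀ k) :=
  Finsupp.linearCombination k fun S => ∑ v ∈ S, Finsupp.single (S.erase v) 1

lemma bdry_single (S : Finset A) :
    bdry k A (Finsupp.single S 1) = ∑ v ∈ S, Finsupp.single (S.erase v) 1 := by
  simp [bdry]

variable (k) in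
/-- Reduced acyclicity of a complex. -/
def Acyclic (K : Set (Finset A)) : Prop :=
  ∀ z ∈ Finsupp.supported k k K, bdry k A z = 0 → ∃ w ∈ Finsupp.supported k k K, bdry k A w = z

lemma single_mem_supported {K : Set (Finset A)} {S : Finset A} (hS : S ∈ K) (a : k) :
    Finsupp.single S a ∈ Finsupp.supported k k K :=
  Finsupp.single_mem_supported k a hS

lemma linear_mem_supported {M : Type*} [AddCommGroup M] [Module k M] {K : Set (Finset A)}
    {P : Submodule k M} {f : (Finset A →₀ k) →ₗ[k] M}
    (hf : ∀ S ∈ K, f (Finsupp.single S 1) ∈ P) {z : Finset A →₀ k}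
    (hz : z ∈ Finsupp.supported k k K) : f z ∈ P := by
  rw [Finsupp.supported_eq_span_single] at hz
  refine (Submodule.span_le (p := P.comap f)).2 ?_ hz
  rintro _ ⟨S, hS, rfl⟩
  exact hf S hS

lemma linear_eq_on_supported {M : Type*} [AddCommGroup M] [Module k M] {K : Set (Finset A)}
    {f g : (Finset A →₀ k) →ₗ[k] M}
    (hf : ∀ S ∈ K, f (Finsupp.single S 1) = g (Finsupp.single S 1)) {z : Finset A →₀ k}
    (hz : z ∈ Finsupp.supported k k K) : f z = g z := by
  have := linear_mem_supported (P := ⊥) (f := f - g) (K := K)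
    (fun S hS => by simp [hf S hS]) hz
  simpa [sub_eq_zero] using this

variable (k) in
/-- A cone is acyclic. -/
lemma acyclic_of_cone {K : Set (Finset A)} (b : A) (hb : ∀ S ∈ K, insert b S ∈ K) :
    Acyclic k K := by
  intro z hz hz0
  let J : (Finset A →₀ k) →ₗ[k] (Finset A →₀ k) :=
    Finsupp.linearCombination k fun S => if b ∈ S then 0 else Finsupp.single (insert b S) 1
  have hJ : ∀ S, J (Finsupp.single S 1) =
      if b ∈ S then 0 else Finsupp.single (insert b S) 1 := fun S => by simp [J]
  have key : ∀ c, bdry k A (J c) + J (bdry k A c) = c := by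
    intro c
    suffices (bdry k A).comp J + J.comp (bdry k A) = LinearMap.id from LinearMap.congr_fun this c
    ext1 S
    ext1
    simp only [LinearMap.comp_apply, Finsupp.lsingle_apply, LinearMap.add_apply, bdry_single,
      map_sum, hJ, LinearMap.id_apply]
    by_cases h : b ∈ S
    · rw [if_pos h, map_zero, zero_add, Finset.sum_eq_single_of_mem b h]
      · simp [Finset.insert_erase h]
      · intro v _ hv
        rw [if_pos (by simp [h, hv.symm])]
    · rw [if_neg h, bdry_single, Finset.sum_insert h, Finset.erase_insert h, add_assoc,
        ← Finset.sum_add_distrib, Finset.sum_eq_zero, add_zero]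
      intro v hv
      have hne : b ≠ v := fun h' => h (h' ▸ hv)
      rw [if_neg (by simp [h]), Finset.erase_insert_of_ne hne]
      exact add_self_of_charTwo (k := k) _
  refine ⟨J z, linear_mem_supported (fun S hS => ?_) hz, by simpa [hz0] using key z⟩
  rw [hJ]
  split_ifs
  · exact zero_mem _
  · exact single_mem_supported (hb S hS) 1

variable (k) in
/-- The chain map induced by a map of vertices. -/
noncomputable def push (f : A → B) : (Finset A →₀ k) →ₗ[k] (Finset B →₀ k) :=
  Finsupp.linearCombination k fun S =>
    if (S.image f).card = S.card then Finsupp.single (S.image f) 1 else 0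

lemma push_single (f : A → B) (S : Finset A) : push k f (Finsupp.single S 1) =
    if (S.image f).card = S.card then Finsupp.single (S.image f) 1 else 0 := by
  simp [push]

lemma push_single_mem {f : A → B} {S : Finset A} {T : Set (Finset B)} (h : S.image f ∈ T) :
    push k f (Finsupp.single S 1) ∈ Finsupp.supported k k T := by
  rw [push_single]
  split_ifs
  · exact single_mem_supported h 1
  · exact zero_mem _

lemma bdry_push_single (f : A → B) (S : Finset A) :
    bdry k B (push k f (Finsupp.single S 1)) = ∑ v ∈ S, push k f (Finsupp.single (S.erase v) 1) := by
  simp only [push_single]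
  by_cases h : (S.image f).card = S.card
  · have hinj := Finset.card_image_iff.1 h
    rw [if_pos h, bdry_single, Finset.sum_image hinj]
    refine Finset.sum_congr rfl fun v hv => ?_
    have : (S.erase v).image f = (S.image f).erase (f v) := by
      ext y
      simp only [Finset.mem_image, Finset.mem_erase]
      constructor
      · rintro ⟨x, ⟨hx, hxS⟩, rfl⟩
        exact ⟨fun h => hx (hinj hxS hv h), x, hxS, rfl⟩
      · rintro ⟨hy, x, hxS, rfl⟩
        exact ⟨x, ⟨fun h => hy (h ▸ rfl), hxS⟩, rfl⟩
    rw [if_pos, this]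
    exact Finset.card_image_iff.2 (hinj.mono (by simp))
  · rw [if_neg h, map_zero]
    have hninj : ¬ Set.InjOn f S := fun h' => h (Finset.card_image_iff.2 h')
    simp only [Set.InjOn] at hninj
    push Not at hninj
    obtain ⟨a, ha, b, hb, hab, hne⟩ := hninj
    have ha' : a ∈ S := ha
    have hb' : b ∈ S := hb
    have himg : (S.erase a).image f = (S.erase b).image f := by
      ext y
      simp only [Finset.mem_image, Finset.mem_erase]
      constructor
      · rintro ⟨x, ⟨hx, hxS⟩, rfl⟩
        by_cases hxb : x = b
        · exact ⟨a, ⟨hne, ha'⟩, by rw [hxb, hab]⟩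
        · exact ⟨x, ⟨hxb, hxS⟩, rfl⟩
      · rintro ⟨x, ⟨hx, hxS⟩, rfl⟩
        by_cases hxa : x = a
        · exact ⟨b, ⟨hne.symm, hb'⟩, by rw [hxa, hab]⟩
        · exact ⟨x, ⟨hxa, hxS⟩, rfl⟩
    rw [← Finset.add_sum_erase _ _ ha', ← Finset.add_sum_erase _ _
      (Finset.mem_erase.2 ⟨hne.symm, hb'⟩), Finset.sum_eq_zero, add_zero, himg,
      Finset.card_erase_of_mem ha', Finset.card_erase_of_mem hb']
    · exact (add_self_of_charTwo (k := k) _).symm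
    · intro v hv
      simp only [Finset.mem_erase] at hv
      rw [if_neg]
      intro h
      exact hne (Finset.card_image_iff.1 h (by simp [ha', Ne.symm hv.2.1])
        (by simp [hb', Ne.symm hv.1]) hab)

lemma bdry_push (f : A → B) (z : Finset A →₀ k) :
    bdry k B (push k f z) = push k f (bdry k A z) := by
  suffices (bdry k B).comp (push k f) = (push k f).comp (bdry k A) from LinearMap.congr_fun this z
  ext1 S
  ext1
  simp only [LinearMap.comp_apply, Finsupp.lsingle_apply, bdry_single, map_sum]
  exact bdry_push_single f S

lemma push_id (z : Finset A →₀ k) : push k id z = z := by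
  suffices push k (id : A → A) = LinearMap.id by rw [this, LinearMap.id_apply]
  ext1 S
  ext1
  simp [push_single]

section CarrierLemma

variable {D : Type*} [AddCommGroup D] [Module k D]

/-- Extension of `e` over all simplices by a choice of fillings. -/
noncomputable def fill (t : Finset A → D) (Y : Finset A → D → D) (e : D) (S : Finset A) : D :=
  Finset.strongInduction (p := fun _ => D) (fun S ih => if S = ∅ then e else
    Y S (t S + ∑ v ∈ S.attach, ih (S.erase v) (Finset.erase_ssubset v.2))) S

lemma fill_empty (t : Finset A → D) (Y : Finset A → D → D) (e : D) : fill t Y e ∅ = e := by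
  rw [fill, Finset.strongInduction_eq, if_pos rfl]

lemma fill_of_nonempty (t : Finset A → D) (Y : Finset A → D → D) (e : D) {S : Finset A}
    (hS : S.Nonempty) : fill t Y e S = Y S (t S + ∑ v ∈ S, fill t Y e (S.erase v)) := by
  rw [fill, Finset.strongInduction_eq, if_neg hS.ne_empty,
    ← Finset.sum_attach S fun v => fill t Y e (S.erase v)]
  rfl

variable (k) in
/-- The acyclic carrier lemma. -/
lemma exists_carried (δ : D →ₗ[k] D) {L : Set (Finset A)} (hL : IsLowerSet L)
    (Φ : Finset A → Submodule k D) (hmono : ∀ T ∈ L, ∀ S ⊆ T, Φ S ≤ Φ T)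
    (hac : ∀ S ∈ L, S.Nonempty → ∀ x ∈ Φ S, δ x = 0 → ∃ y ∈ Φ S, δ y = x)
    (t : Finset A → D) (htΦ : ∀ S ∈ L, t S ∈ Φ S)
    (ht : ∀ S ∈ L, δ (t S) = ∑ v ∈ S, t (S.erase v))
    (e : D) (heΦ : e ∈ Φ ∅) (he : δ e = t ∅) :
    ∃ h : Finset A → D, h ∅ = e ∧
      ∀ S ∈ L, h S ∈ Φ S ∧ δ (h S) = t S + ∑ v ∈ S, h (S.erase v) := by
  classical
  choose! Y hYΦ hY using hac
  refine ⟨fill t Y e, fill_empty t Y e, fun S => ?_⟩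
  induction S using Finset.strongInduction with
  | H S ih =>
    intro hS
    rcases S.eq_empty_or_nonempty with rfl | hne
    · rw [fill_empty]
      exact ⟨heΦ, by simpa using he⟩
    have ih' : ∀ v ∈ S, fill t Y e (S.erase v) ∈ Φ (S.erase v) ∧ δ (fill t Y e (S.erase v)) =
        t (S.erase v) + ∑ w ∈ S.erase v, fill t Y e ((S.erase v).erase w) :=
      fun v hv => ih _ (Finset.erase_ssubset hv) (hL (Finset.erase_subset v S) hS)
    have hx : t S + ∑ v ∈ S, fill t Y e (S.erase v) ∈ Φ S :=
      add_mem (htΦ S hS) (sum_mem fun v hv => hmono S hS _ (Finset.erase_subset v S) (ih' v hv).1)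
    have hx0 : δ (t S + ∑ v ∈ S, fill t Y e (S.erase v)) = 0 := by
      rw [map_add, map_sum, ht S hS, Finset.sum_congr rfl fun v hv => (ih' v hv).2,
        Finset.sum_add_distrib, ← add_assoc, add_self_of_charTwo (k := k), zero_add]
      refine sum_sum_erase_eq_zero k S (fun v w => fill t Y e ((S.erase v).erase w)) ?_
      intro v w
      rw [Finset.erase_right_comm]
    rw [fill_of_nonempty t Y e hne]
    exact ⟨hYΦ S hS hne _ hx hx0, hY S hS hne _ hx hx0⟩

end CarrierLemma

variable (k) in
lemma exists_carried_map {L : Set (Finset A)} (hL : IsLowerSet L)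
    (Φ : Finset A → Set (Finset B)) (hmono : ∀ T ∈ L, ∀ S ⊆ T, Φ S ⊆ Φ T)
    (hac : ∀ S ∈ L, S.Nonempty → Acyclic k (Φ S)) (h0 : ∅ ∈ Φ ∅) :
    ∃ α : (Finset A →₀ k) →ₗ[k] (Finset B →₀ k),
      α (Finsupp.single ∅ 1) = Finsupp.single ∅ 1 ∧
      ∀ S ∈ L, α (Finsupp.single S 1) ∈ Finsupp.supported k k (Φ S) ∧
        bdry k B (α (Finsupp.single S 1)) = ∑ v ∈ S, α (Finsupp.single (S.erase v) 1) := by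
  obtain ⟨h, hh0, hh⟩ := exists_carried k (bdry k B) hL (fun S => Finsupp.supported k k (Φ S))
    (fun T hT S hST => Finsupp.supported_mono (hmono T hT S hST))
    (fun S hS hne => hac S hS hne) 0 (fun S _ => zero_mem _) (fun S _ => by simp)
    (Finsupp.single ∅ 1) (single_mem_supported h0 1) (by simp [bdry_single])
  exact ⟨Finsupp.linearCombination k h, by simpa using hh0, fun S hS => by simpa using hh S hS⟩

lemma exists_homotopy {L : Set (Finset A)} (hL : IsLowerSet L)
    (Φ : Finset A → Set (Finset B)) (hmono : ∀ T ∈ L, ∀ S ⊆ T, Φ S ⊆ Φ T)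
    (hac : ∀ S ∈ L, S.Nonempty → Acyclic k (Φ S))
    {α β : (Finset A →₀ k) →ₗ[k] (Finset B →₀ k)}
    (h0 : α (Finsupp.single ∅ 1) = β (Finsupp.single ∅ 1))
    (hαΦ : ∀ S ∈ L, α (Finsupp.single S 1) ∈ Finsupp.supported k k (Φ S))
    (hα : ∀ S ∈ L, bdry k B (α (Finsupp.single S 1)) = ∑ v ∈ S, α (Finsupp.single (S.erase v) 1))
    (hβΦ : ∀ S ∈ L, β (Finsupp.single S 1) ∈ Finsupp.supported k k (Φ S))
    (hβ : ∀ S ∈ L, bdry k B (β (Finsupp.single S 1)) = ∑ v ∈ S, β (Finsupp.single (S.erase v) 1))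
    {T : Set (Finset B)} (hT : ∀ S ∈ L, Φ S ⊆ T)
    {z : Finset A →₀ k} (hz : z ∈ Finsupp.supported k k L) (hz0 : bdry k A z = 0) :
    ∃ w ∈ Finsupp.supported k k T, bdry k B w = α z + β z := by
  obtain ⟨h, hh0, hh⟩ := exists_carried k (bdry k B) hL (fun S => Finsupp.supported k k (Φ S))
    (fun T hT S hST => Finsupp.supported_mono (hmono T hT S hST))
    (fun S hS hne => hac S hS hne)
    (fun S => α (Finsupp.single S 1) + β (Finsupp.single S 1))
    (fun S hS => add_mem (hαΦ S hS) (hβΦ S hS))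
    (fun S hS => by rw [map_add, hα S hS, hβ S hS, Finset.sum_add_distrib])
    0 (zero_mem _) (by rw [map_zero, h0, add_self_of_charTwo (k := k)])
  have hH : ∀ S, Finsupp.linearCombination k h (Finsupp.single S 1) = h S := fun S => by simp
  refine ⟨Finsupp.linearCombination k h z, linear_mem_supported (fun S hS => ?_) hz, ?_⟩
  · rw [hH]
    exact Finsupp.supported_mono (hT S hS) (hh S hS).1
  · have := linear_eq_on_supported (f := (bdry k B).comp (Finsupp.linearCombination k h))
      (g := α + β + (Finsupp.linearCombination k h).comp (bdry k A)) (fun S hS => ?_) hz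
    · simpa [hz0] using this
    · simp only [LinearMap.comp_apply, LinearMap.add_apply, bdry_single, map_sum, hH]
      exact (hh S hS).2

/-- Contiguous vertex maps send a cycle to homologous cycles. -/
lemma exists_bdry_eq_of_contiguous {L : Set (Finset A)} (hL : IsLowerSet L) {T : Set (Finset B)}
    (hT : IsLowerSet T) {f g : A → B} (hfg : ∀ S ∈ L, S.image f ∪ S.image g ∈ T)
    {z : Finset A →₀ k} (hz : z ∈ Finsupp.supported k k L) (hz0 : bdry k A z = 0) :
    ∃ w ∈ Finsupp.supported k k T, bdry k B w = push k f z + push k g z := by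
  refine exists_homotopy hL (fun S => {R | R ⊆ S.image f ∪ S.image g}) ?_ ?_ ?_ ?_ ?_ ?_ ?_ ?_
    hz hz0
  · intro U _ S hSU R hR
    exact Finset.Subset.trans hR (Finset.union_subset_union (Finset.image_subset_image hSU)
      (Finset.image_subset_image hSU))
  · rintro S - ⟨v, hv⟩
    refine acyclic_of_cone k (f v) fun R hR => Finset.insert_subset ?_ hR
    exact Finset.mem_union_left _ (Finset.mem_image_of_mem f hv)
  · simp [push_single]
  · exact fun S _ => push_single_mem Finset.subset_union_left
  · exact fun S _ => bdry_push_single f S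
  · exact fun S _ => push_single_mem Finset.subset_union_right
  · exact fun S _ => bdry_push_single g S
  · exact fun S hS R hR => hT hR (hfg S hS)

/-- A vertex map that is connected to a constant by contiguous steps kills cycles. -/
lemma exists_bdry_eq_push {L : Set (Finset A)} (hL : IsLowerSet L) {T : Set (Finset B)}
    (hT : IsLowerSet T) (f : ℕ → A → B) (M : ℕ)
    (hf : ∀ m < M, ∀ S ∈ L, S.image (f m) ∪ S.image (f (m + 1)) ∈ T) {b : B} (hb : {b} ∈ T)
    (hM : ∀ S ∈ L, ∀ x ∈ S, f M x = b)
    {z : Finset A →₀ k} (hz : z ∈ Finsupp.supported k k L) (hz0 : bdry k A z = 0) :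
    ∃ w ∈ Finsupp.supported k k T, bdry k B w = push k (f 0) z := by
  have step : ∀ m ≤ M, ∃ w ∈ Finsupp.supported k k T,
      bdry k B w = push k (f 0) z + push k (f m) z := by
    intro m
    induction m with
    | zero => exact fun _ => ⟨0, zero_mem _, by rw [map_zero, add_self_of_charTwo (k := k)]⟩
    | succ m ih =>
      intro hm
      obtain ⟨w, hw, hw'⟩ := ih (by omega)
      obtain ⟨u, hu, hu'⟩ := exists_bdry_eq_of_contiguous hL hT (hf m (by omega)) hz hz0
      refine ⟨w + u, add_mem hw hu, ?_⟩
      rw [map_add, hw', hu', add_assoc, ← add_assoc (push k (f m) z),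
        add_self_of_charTwo (k := k), zero_add]
  obtain ⟨w, hw, hw'⟩ := step M le_rfl
  have hP : push k (f M) z ∈ Finsupp.supported k k {R : Finset B | R ⊆ {b}} := by
    refine linear_mem_supported (fun S hS => push_single_mem ?_) hz
    intro y hy
    obtain ⟨x, hx, rfl⟩ := Finset.mem_image.1 hy
    simp [hM S hS x hx]
  have hP0 : bdry k B (push k (f M) z) = 0 := by
    rw [bdry_push, hz0, map_zero]
  obtain ⟨u, hu, hu'⟩ := acyclic_of_cone k b (K := {R : Finset B | R ⊆ {b}})
    (fun R hR => Finset.insert_subset (Finset.mem_singleton_self b) hR) _ hP hP0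
  refine ⟨w + u, add_mem hw (Finsupp.supported_mono (fun R hR => hT hR hb) hu), ?_⟩
  rw [map_add, hw', hu', add_assoc, add_self_of_charTwo (k := k), add_zero]

end Carriers

section VietorisRips

variable {k : Type*} [Field k] [CharP k 2]

/-- The Vietoris-Rips complex of `C` at scale `δ`. -/
def vietorisRips {E : Type*} [PseudoMetricSpace E] (C : Set E) (δ : ℝ) : Set (Finset E) :=
  {S | ↑S ⊆ C ∧ ∀ x ∈ S, ∀ y ∈ S, dist x y < δ}

lemma isLowerSet_vietorisRips {E : Type*} [PseudoMetricSpace E] (C : Set E) (δ : ℝ) :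
    IsLowerSet (vietorisRips C δ) := fun _ _ hTS hS =>
  ⟨(Finset.coe_subset.2 hTS).trans hS.1, fun x hx y hy => hS.2 x (hTS hx) y (hTS hy)⟩

lemma vietorisRips_mono {E : Type*} [PseudoMetricSpace E] {C C' : Set E} (h : C ⊆ C') (δ : ℝ) :
    vietorisRips C δ ⊆ vietorisRips C' δ := fun _ hS => ⟨hS.1.trans h, hS.2⟩

lemma exists_forall_dist_add_lt {E : Type*} [PseudoMetricSpace E] (P : Finset E) (c : E) (δ : ℝ) :
    ∃ M : ℕ, 0 < M ∧ ∀ x ∈ P, ∀ y ∈ P, dist x y < δ → dist x y + dist y c / M < δ := by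
  have h : ∀ᶠ M : ℕ in Filter.atTop, ∀ x ∈ P, ∀ y ∈ P, dist x y < δ →
      dist x y + dist y c / M < δ := by
    rw [Filter.eventually_all_finset]
    intro x _
    rw [Filter.eventually_all_finset]
    intro y _
    by_cases hxy : dist x y < δ
    · have := (tendsto_const_div_atTop_nhds_zero_nat (dist y c)).const_add (dist x y)
      rw [add_zero] at this
      filter_upwards [this.eventually (gt_mem_nhds hxy)] with M hM _ using hM
    · exact Filter.Eventually.of_forall fun _ h => absurd h hxy
  obtain ⟨M, hM, hM0⟩ := (h.and (Filter.eventually_gt_atTop 0)).exists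
  exact ⟨M, hM0, hM⟩

variable (k) in
lemma acyclic_vietorisRips {E : Type*} [NormedAddCommGroup E] [NormedSpace ℝ E] [DecidableEq E]
    {C : Set E} (hC : Convex ℝ C) (hne : C.Nonempty) {δ : ℝ} (hδ : 0 < δ) :
    Acyclic k (vietorisRips C δ) := by
  obtain ⟨c, hc⟩ := hne
  intro z hz hz0
  let P : Finset E := z.support.sup id
  obtain ⟨M, hM0, hM⟩ := exists_forall_dist_add_lt P c δ
  have hM0' : (0 : ℝ) < M := by exact_mod_cast hM0
  let L : Set (Finset E) := {S | S ⊆ P ∧ S ∈ vietorisRips C δ}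
  have hL : IsLowerSet L := fun _ _ hTS hS => ⟨Finset.Subset.trans hTS hS.1,
    isLowerSet_vietorisRips C δ hTS hS.2⟩
  have hzL : z ∈ Finsupp.supported k k L := fun S hS =>
    ⟨Finset.le_sup (f := id) hS, hz hS⟩
  let f : ℕ → E → E := fun m x => AffineMap.lineMap x c ((m : ℝ) / M)
  have hfC : ∀ m ≤ M, ∀ x ∈ C, f m x ∈ C := fun m hm x hx =>
    hC.lineMap_mem hx hc ⟨by positivity, by rw [div_le_one hM0']; exact_mod_cast hm⟩
  have hfm : ∀ m ≤ M, ∀ x y, dist (f m x) (f m y) ≤ dist x y := by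
    intro m hm x y
    have h1 : (m : ℝ) / M ≤ 1 := by rw [div_le_one hM0']; exact_mod_cast hm
    have h0 : 0 ≤ (m : ℝ) / M := by positivity
    have : f m x - f m y = (1 - (m : ℝ) / M) • (x - y) := by
      simp only [f, AffineMap.lineMap_apply_module]
      module
    rw [dist_eq_norm, this, norm_smul, Real.norm_of_nonneg (by linarith), dist_eq_norm]
    exact mul_le_of_le_one_left (norm_nonneg _) (by linarith)
  have hff : ∀ m y, dist (f m y) (f (m + 1) y) = dist y c / M := by
    intro m y
    have : f m y - f (m + 1) y = ((1 : ℝ) / M) • (y - c) := by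
      simp only [f, AffineMap.lineMap_apply_module]
      push_cast
      rw [add_div]
      module
    rw [dist_eq_norm, this, norm_smul, Real.norm_of_nonneg (by positivity), dist_eq_norm]
    ring
  have hadd : ∀ m < M, ∀ S ∈ L, ∀ x ∈ S, ∀ y ∈ S, dist (f m x) (f (m + 1) y) < δ := by
    intro m hm S hS x hx y hy
    refine lt_of_le_of_lt (dist_triangle _ (f m y) _) ?_
    rw [hff]
    have := hM x (hS.1 hx) y (hS.1 hy) (hS.2.2 x hx y hy)
    linarith [hfm m hm.le x y]
  have hstep : ∀ m < M, ∀ S ∈ L, S.image (f m) ∪ S.image (f (m + 1)) ∈ vietorisRips C δ := by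
    refine fun m hm S hS => ⟨?_, ?_⟩
    · intro y hy
      simp only [Finset.coe_union, Finset.coe_image, Set.mem_union, Set.mem_image,
        Finset.mem_coe] at hy
      rcases hy with ⟨x, hx, rfl⟩ | ⟨x, hx, rfl⟩
      · exact hfC m hm.le x (hS.2.1 hx)
      · exact hfC (m + 1) hm x (hS.2.1 hx)
    · intro x hx y hy
      simp only [Finset.mem_union, Finset.mem_image] at hx hy
      rcases hx with ⟨x, hx, rfl⟩ | ⟨x, hx, rfl⟩ <;> rcases hy with ⟨y, hy, rfl⟩ | ⟨y, hy, rfl⟩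
      · exact (hfm m hm.le x y).trans_lt (hS.2.2 x hx y hy)
      · exact hadd m hm S hS x hx y hy
      · rw [dist_comm]
        exact hadd m hm S hS y hy x hx
      · exact (hfm (m + 1) hm x y).trans_lt (hS.2.2 x hx y hy)
  obtain ⟨w, hw, hwz⟩ := exists_bdry_eq_push hL (isLowerSet_vietorisRips C δ) f M hstep (b := c)
    ⟨by simpa using hc, by simpa using hδ⟩ (fun S _ x _ => by simp [f, hM0.ne']) hzL hz0
  have hf0 : f 0 = id := by
    ext x
    simp [f]
  rw [hf0, push_id] at hwz
  exact ⟨w, hw, hwz⟩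

end VietorisRips

section Realization

variable {k : Type*} [Field k] [CharP k 2] {V : Type*} [Fintype V] [DecidableEq V]

/-- The cell of `S` in the standard simplex on `V`. -/
def cell (S : Finset V) : Set (V → ℝ) := {b ∈ stdSimplex ℝ V | ∀ v ∉ S, b v = 0}

lemma cell_mono {S T : Finset V} (h : S ⊆ T) : cell S ⊆ cell T :=
  fun _ hb => ⟨hb.1, fun v hv => hb.2 v fun hv' => hv (h hv')⟩

lemma isCompact_cell (S : Finset V) : IsCompact (cell S) := by
  have : cell S = stdSimplex ℝ V ∩ {b | ∀ v ∉ S, b v = 0} := rfl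
  rw [this]
  refine (isCompact_stdSimplex ℝ V).inter_right ?_
  simp only [Set.ofPred_forall]
  exact isClosed_iInter fun v => isClosed_iInter fun _ =>
    isClosed_eq (continuous_apply v) continuous_const

lemma convex_cell (S : Finset V) : Convex ℝ (cell S) := by
  intro x hx y hy a b ha hb hab
  refine ⟨convex_stdSimplex ℝ V hx.1 hy.1 ha hb hab, fun v hv => ?_⟩
  simp [hx.2 v hv, hy.2 v hv]

lemma cell_nonempty {S : Finset V} (hS : S.Nonempty) : (cell S).Nonempty := by
  obtain ⟨v, hv⟩ := hS
  refine ⟨Pi.single v 1, single_mem_stdSimplex ℝ v, fun w hw => ?_⟩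
  exact Pi.single_eq_of_ne (fun h : w = v => hw (h ▸ hv)) 1

/-- The geometric realization of an abstract complex on `V`. -/
def realization (K : Set (Finset V)) : Set (V → ℝ) := ⋃ S ∈ K, cell S

lemma mem_realization {K : Set (Finset V)} {b : V → ℝ} :
    b ∈ realization K ↔ ∃ S ∈ K, b ∈ cell S := by
  simp [realization]

lemma cell_subset_realization {K : Set (Finset V)} {S : Finset V} (hS : S ∈ K) :
    cell S ⊆ realization K := fun _ hb => mem_realization.2 ⟨S, hS, hb⟩

lemma realization_subset (K : Set (Finset V)) : realization K ⊆ stdSimplex ℝ V := by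
  intro b hb
  obtain ⟨S, _, hS⟩ := mem_realization.1 hb
  exact hS.1

lemma isCompact_realization (K : Set (Finset V)) : IsCompact (realization K) :=
  K.toFinite.isCompact_biUnion fun S _ => isCompact_cell S

lemma exists_inv_card_le {b : V → ℝ} (hb : b ∈ stdSimplex ℝ V) :
    ∃ v, (Fintype.card V : ℝ)⁻¹ ≤ b v := by
  have hne : Nonempty V := by
    by_contra h
    rw [not_nonempty_iff] at h
    simpa using hb.2
  obtain ⟨v, _, hv⟩ := Finset.exists_le_of_sum_le (s := Finset.univ)
    (f := fun _ : V => (Fintype.card V : ℝ)⁻¹) (g := b) Finset.univ_nonempty (by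
      rw [hb.2]
      simp)
  exact ⟨v, hv⟩

/-- A contraction of the realization, read off on the nearest vertices at small scale. -/
lemma exists_contiguous_of_nullhomotopic {K : Set (Finset V)} (hK : IsLowerSet K)
    (h : (ContinuousMap.id (realization K)).Nullhomotopic) :
    ∃ δ > 0, ∃ (f : ℕ → (V → ℝ) → V) (M : ℕ) (v₀ : V), {v₀} ∈ K ∧
      (∀ m < M, ∀ S ∈ vietorisRips (realization K) δ, S.image (f m) ∪ S.image (f (m + 1)) ∈ K) ∧
      (∀ x ∈ realization K, f M x = v₀) ∧ ∀ S ∈ K, ∀ x ∈ cell S, f 0 x ∈ S := by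
  classical
  obtain ⟨y₀, ⟨F⟩⟩ := h
  have hne : Nonempty V := by
    obtain ⟨v, _⟩ := exists_inv_card_le (realization_subset K y₀.2)
    exact ⟨v⟩
  have hε : 0 < (Fintype.card V : ℝ)⁻¹ := by positivity
  set ε := (Fintype.card V : ℝ)⁻¹
  have hρ : ∀ b : V → ℝ, ∃ v, b ∈ stdSimplex ℝ V → ε ≤ b v := fun b => by
    by_cases hb : b ∈ stdSimplex ℝ V
    · obtain ⟨v, hv⟩ := exists_inv_card_le hb
      exact ⟨v, fun _ => hv⟩
    · exact ⟨hne.some, fun h => absurd h hb⟩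
  choose ρ hρ using hρ
  have : CompactSpace (realization K) := isCompact_iff_compactSpace.1 (isCompact_realization K)
  obtain ⟨δ, hδ, hF⟩ := Metric.uniformContinuous_iff.1
    (CompactSpace.uniformContinuous_of_continuous F.continuous) ε hε
  obtain ⟨M, hM⟩ := exists_nat_one_div_lt hδ
  let τ : ℕ → unitInterval := fun m => Set.projIcc (0 : ℝ) 1 zero_le_one ((m : ℝ) / (M + 1))
  have hM0 : (0 : ℝ) < (M : ℝ) + 1 := by positivity
  have hτ : ∀ m, dist (τ (m + 1)) (τ m) < δ := by
    intro m
    refine lt_of_le_of_lt ((LipschitzWith.projIcc (zero_le_one' ℝ)).dist_le_mul _ _) ?_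
    rw [NNReal.coe_one, one_mul, Real.dist_eq, ← sub_div]
    push_cast
    rwa [add_sub_cancel_left, abs_of_pos (by positivity)]
  have hτ0 : τ 0 = 0 := by
    simp only [τ, Nat.cast_zero, zero_div]
    exact Set.projIcc_left (zero_le_one' ℝ)
  have hτM : τ (M + 1) = 1 := by
    simp only [τ]
    rw [Nat.cast_add_one, div_self hM0.ne']
    exact Set.projIcc_right (zero_le_one' ℝ)
  let f : ℕ → (V → ℝ) → V := fun m x =>
    if hx : x ∈ realization K then ρ (F (τ m, ⟨x, hx⟩)) else ρ y₀
  have hfx : ∀ m x (hx : x ∈ realization K), f m x = ρ (F (τ m, ⟨x, hx⟩)) :=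
    fun m x hx => dif_pos hx
  have hcell : ∀ {b : V → ℝ} {S : Finset V}, b ∈ cell S → ρ b ∈ S := by
    intro b S hb
    by_contra h
    have h1 := hρ b hb.1
    rw [hb.2 _ h] at h1
    linarith
  have hclose : ∀ {b b' : V → ℝ} {S : Finset V}, b ∈ cell S → b' ∈ stdSimplex ℝ V →
      dist b' b < ε → ρ b' ∈ S := by
    intro b b' S hb hb' hd
    by_contra h
    have h1 := hρ b' hb'
    have h2 := (dist_le_pi_dist b' b (ρ b')).trans_lt hd
    rw [hb.2 _ h, Real.dist_eq, sub_zero, abs_lt] at h2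
    linarith [h2.2]
  have h0K : ∅ ∈ K := by
    obtain ⟨S, hS, _⟩ := mem_realization.1 y₀.2
    exact hK (Finset.empty_subset S) hS
  have hstep : ∀ m < M + 1, ∀ S ∈ vietorisRips (realization K) δ,
      S.image (f m) ∪ S.image (f (m + 1)) ∈ K := by
    intro m _ S hS
    rcases S.eq_empty_or_nonempty with rfl | ⟨y, hy⟩
    · simpa using h0K
    obtain ⟨T, hT, hbT⟩ := mem_realization.1 (F (τ m, ⟨y, hS.1 hy⟩)).2
    refine hK ?_ hT
    intro v hv
    simp only [Finset.mem_union, Finset.mem_image] at hv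
    rcases hv with ⟨x, hx, rfl⟩ | ⟨x, hx, rfl⟩ <;> rw [hfx _ x (hS.1 hx)]
    · refine hclose hbT (realization_subset K (Subtype.prop _)) (hF ?_)
      rw [Prod.dist_eq, dist_self]
      exact max_lt hδ (hS.2 x hx y hy)
    · refine hclose hbT (realization_subset K (Subtype.prop _)) (hF ?_)
      rw [Prod.dist_eq]
      exact max_lt (hτ m) (hS.2 x hx y hy)
  obtain ⟨T₀, hT₀, hyT₀⟩ := mem_realization.1 y₀.2
  refine ⟨δ, hδ, f, M + 1, ρ y₀, hK (Finset.singleton_subset_iff.2 (hcell hyT₀)) hT₀, hstep,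
    fun x hx => ?_, fun S hS x hx => ?_⟩
  · rw [hfx _ x hx, hτM, F.apply_one]
    rfl
  · rw [hfx _ x (cell_subset_realization hS hx), hτ0, F.apply_zero]
    exact hcell hx

variable (k) in
/-- A complex with contractible realization is acyclic. -/
theorem acyclic_of_nullhomotopic {K : Set (Finset V)} (hK : IsLowerSet K)
    (h : (ContinuousMap.id (realization K)).Nullhomotopic) : Acyclic k K := by
  classical
  obtain ⟨δ, hδ, f, M, v₀, hv₀, hstep, hM, hf0⟩ := exists_contiguous_of_nullhomotopic hK h
  intro z hz hz0
  obtain ⟨α, hα0, hα⟩ := exists_carried_map k hK (fun S => vietorisRips (cell S) δ)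
    (fun T _ S hST => vietorisRips_mono (cell_mono hST) δ)
    (fun S _ hne => acyclic_vietorisRips k (convex_cell S) (cell_nonempty hne) hδ)
    ⟨by simp, by simp⟩
  have hαz : α z ∈ Finsupp.supported k k (vietorisRips (realization K) δ) :=
    linear_mem_supported (fun S hS => Finsupp.supported_mono
      (vietorisRips_mono (cell_subset_realization hS) δ) (hα S hS).1) hz
  have hαz0 : bdry k _ (α z) = 0 := by
    have := linear_eq_on_supported (f := (bdry k _).comp α) (g := α.comp (bdry k _)) (fun S hS => by
      simp only [LinearMap.comp_apply, bdry_single, map_sum]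
      exact (hα S hS).2) hz
    rw [LinearMap.comp_apply, LinearMap.comp_apply, hz0, map_zero] at this
    exact this
  obtain ⟨w, hw, hwz⟩ := exists_bdry_eq_push (isLowerSet_vietorisRips (realization K) δ) hK f
    M hstep hv₀ (fun S hS x hx => hM x (hS.1 hx)) hαz hαz0
  have h0 : push k (f 0) (α (Finsupp.single ∅ 1)) = Finsupp.single ∅ 1 := by
    rw [hα0, push_single, Finset.image_empty, Finset.card_empty, Finset.card_empty, if_pos rfl]
  have hpush : ∀ S ∈ K, push k (f 0) (α (Finsupp.single S 1)) ∈
      Finsupp.supported k k {R : Finset V | R ⊆ S} := by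
    refine fun S hS => linear_mem_supported (fun R hR => push_single_mem fun v hv => ?_) (hα S hS).1
    obtain ⟨x, hx, rfl⟩ := Finset.mem_image.1 hv
    exact hf0 S hS x (hR.1 hx)
  have hbd : ∀ S ∈ K, bdry k V (push k (f 0) (α (Finsupp.single S 1))) =
      ∑ v ∈ S, push k (f 0) (α (Finsupp.single (S.erase v) 1)) := by
    intro S hS
    rw [bdry_push, (hα S hS).2, map_sum]
  obtain ⟨u, hu, huz⟩ := exists_homotopy hK (fun S => {R : Finset V | R ⊆ S})
    (fun T _ S hST R hR => Finset.Subset.trans hR hST)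
    (fun S _ ⟨v, hv⟩ => acyclic_of_cone k v fun R hR => Finset.insert_subset hv hR)
    (α := (push k (f 0)).comp α) (β := LinearMap.id) (T := K) h0 hpush hbd
    (fun S _ => single_mem_supported (Finset.Subset.refl S) 1)
    (fun S _ => bdry_single S) (fun S hS R hR => hK hR hS) hz hz0
  refine ⟨w + u, add_mem hw hu, ?_⟩
  rw [map_add, hwz, huz, LinearMap.comp_apply, LinearMap.id_apply, ← add_assoc,
    add_self_of_charTwo (k := k), zero_add]

lemma bdry_apply (w : Finset V →₀ k) (G : Finset V) :
    bdry k V w G = ∑ v ∈ Gᶜ, w (insert v G) := by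
  induction w using Finsupp.induction_linear with
  | zero => simp
  | add w w' h h' => simp [h, h', Finset.sum_add_distrib]
  | single S a =>
    have : (Finsupp.single S a : Finset V →₀ k) = a • Finsupp.single S 1 := by simp
    rw [this, map_smul, bdry_single, Finsupp.smul_apply, Finsupp.finsetSum_apply]
    simp only [Finsupp.smul_apply, ← Finset.smul_sum, Finsupp.single_apply]
    congr 1
    rw [← Finset.sum_filter, ← Finset.sum_filter]
    congr 1
    ext v
    simp only [Finset.mem_filter, Finset.mem_compl]
    constructor
    · rintro ⟨hv, rfl⟩
      exact ⟨Finset.notMem_erase v S, (Finset.insert_erase hv).symm⟩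
    · rintro ⟨hv, rfl⟩
      exact ⟨Finset.mem_insert_self v G, Finset.erase_insert hv⟩

lemma Acyclic.acyclicBelow {K : Set (Finset V)} (h : Acyclic k K) (n : ℕ) :
    AcyclicBelow k n K := by
  intro j _ c hc hc0
  obtain ⟨w, hw, hwc⟩ := h (Finsupp.equivFunOnFinite.symm c)
    (fun S hS => (hc S (by simpa using hS)).1) (by
      ext G
      rw [bdry_apply]
      simpa [bd_apply] using congrFun hc0 G)
  refine ⟨fun S => if S.card = j + 1 then w S else 0, fun S hS => ?_, ?_⟩
  · simp only [ne_eq, ite_eq_right_iff, not_forall] at hS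
    exact ⟨hw (by simpa using hS.2), hS.1⟩
  · ext G
    have hG := DFunLike.congr_fun hwc G
    rw [bdry_apply] at hG
    rw [bd_apply]
    by_cases hj : G.card = j
    · rw [show c G = Finsupp.equivFunOnFinite.symm c G from rfl, ← hG]
      refine Finset.sum_congr rfl fun v hv => ?_
      rw [if_pos, Pi.one_apply, one_mul]
      rw [Finset.card_insert_of_notMem (by simpa using hv), hj]
    · have : c G = 0 := by
        by_contra h
        exact hj (hc G h).2
      rw [this]
      refine Finset.sum_eq_zero fun v hv => ?_
      rw [if_neg, mul_zero]
      rw [Finset.card_insert_of_notMem (by simpa using hv)]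
      omega

end Realization

section PuncturedSphere

variable {V : Type*} [Fintype V] [DecidableEq V]

/-- The least coordinate of `b` along `F`. -/
noncomputable def minCoord (F : Finset V) (hF : F.Nonempty) (b : V → ℝ) : ℝ :=
  F.inf' hF b

lemma continuous_minCoord (F : Finset V) (hF : F.Nonempty) : Continuous (minCoord F hF) := by
  have : minCoord F hF = F.inf' hF fun v b => b v := by
    ext b
    rw [minCoord, Finset.inf'_apply]
  rw [this]
  exact Continuous.finset_inf' hF fun v _ => continuous_apply v

/-- The barycenter of the cell of `F`. -/
noncomputable def barycenter (F : Finset V) (v : V) : ℝ := if v ∈ F then (F.card : ℝ)⁻¹ else 0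

lemma barycenter_mem_cell {F : Finset V} (hF : F.Nonempty) : barycenter F ∈ cell F := by
  have := hF.card_pos
  refine ⟨⟨fun v => ?_, ?_⟩, fun v hv => if_neg hv⟩
  · rw [barycenter]
    split_ifs <;> positivity
  · simp only [barycenter, Finset.sum_ite_mem, Finset.univ_inter, Finset.sum_const, nsmul_eq_mul]
    field_simp

lemma minCoord_nonneg {F : Finset V} (hF : F.Nonempty) {b : V → ℝ} (hb : b ∈ stdSimplex ℝ V) :
    0 ≤ minCoord F hF b :=
  Finset.le_inf' hF b fun v _ => hb.1 v

lemma minCoord_eq_zero {F : Finset V} (hF : F.Nonempty) {b : V → ℝ} (hb : b ∈ stdSimplex ℝ V)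
    {v : V} (hv : v ∈ F) (hbv : b v = 0) : minCoord F hF b = 0 :=
  le_antisymm (hbv ▸ Finset.inf'_le b hv) (minCoord_nonneg hF hb)

lemma one_sub_minCoord_pos {F : Finset V} (hF : F.Nonempty) {b : V → ℝ}
    (hb : b ∈ stdSimplex ℝ V) (hne : b ≠ barycenter F) : 0 < 1 - F.card * minCoord F hF b := by
  have h1 : ∀ v ∈ F, minCoord F hF b ≤ b v := fun v hv => Finset.inf'_le b hv
  have hcard : (0 : ℝ) < F.card := by exact_mod_cast hF.card_pos
  have h2 : F.card * minCoord F hF b ≤ ∑ v ∈ F, b v := by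
    rw [← nsmul_eq_mul]
    exact Finset.card_nsmul_le_sum F b _ h1
  have h3 : ∑ v ∈ F, b v + ∑ v ∈ Fᶜ, b v = 1 := by rw [Finset.sum_add_sum_compl, hb.2]
  have h4 : 0 ≤ ∑ v ∈ Fᶜ, b v := Finset.sum_nonneg fun v _ => hb.1 v
  by_contra h
  have h5 : F.card * minCoord F hF b = 1 := by linarith
  have h6 : ∑ v ∈ Fᶜ, b v = 0 := by linarith
  have h7 : ∑ v ∈ F, (b v - minCoord F hF b) = 0 := by
    rw [Finset.sum_sub_distrib, Finset.sum_const, nsmul_eq_mul]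
    linarith
  refine hne (funext fun v => ?_)
  rw [barycenter]
  split_ifs with hv
  · have := (Finset.sum_eq_zero_iff_of_nonneg fun v hv => sub_nonneg.2 (h1 v hv)).1 h7 v hv
    rw [sub_eq_zero.1 this]
    exact eq_inv_of_mul_eq_one_right h5
  · exact (Finset.sum_eq_zero_iff_of_nonneg fun v _ => hb.1 v).1 h6 v (by simpa using hv)

/-- Pushing away from the barycenter of `F`. -/
noncomputable def pushAway (F : Finset V) (hF : F.Nonempty) (b : V → ℝ) (v : V) : ℝ :=
  (b v - if v ∈ F then minCoord F hF b else 0) / (1 - F.card * minCoord F hF b)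

lemma continuousOn_pushAway {F : Finset V} (hF : F.Nonempty) {s : Set (V → ℝ)}
    (hs : ∀ b ∈ s, 1 - F.card * minCoord F hF b ≠ 0) : ContinuousOn (pushAway F hF) s := by
  refine continuousOn_pi.2 fun v => ContinuousOn.div ?_ ?_ hs
  · refine ((continuous_apply v).sub ?_).continuousOn
    split_ifs
    · exact continuous_minCoord F hF
    · exact continuous_const
  · exact (continuous_const.sub (continuous_const.mul (continuous_minCoord F hF))).continuousOn

lemma pushAway_mem {K : Set (Finset V)} (hK : IsLowerSet K) {F : Finset V} (hF : F.Nonempty)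
    {b : V → ℝ} (hb : b ∈ realization K) (hne : b ≠ barycenter F) :
    pushAway F hF b ∈ realization (antistar K F) := by
  obtain ⟨S, hS, hbS⟩ := mem_realization.1 hb
  have hpos := one_sub_minCoord_pos hF hbS.1 hne
  obtain ⟨v, hv, hmin⟩ := Finset.exists_mem_eq_inf' hF b
  change minCoord F hF b = b v at hmin
  refine mem_realization.2 ⟨S.erase v, ⟨hK (Finset.erase_subset v S) hS, fun h =>
    Finset.notMem_erase v S (h hv)⟩, ⟨fun w => ?_, ?_⟩, fun w hw => ?_⟩
  · refine div_nonneg ?_ hpos.le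
    split_ifs with hw
    · exact sub_nonneg.2 (Finset.inf'_le b hw)
    · simpa using hbS.1.1 w
  · simp only [pushAway]
    rw [← Finset.sum_div, Finset.sum_sub_distrib, hbS.1.2, Finset.sum_ite_mem, Finset.univ_inter,
      Finset.sum_const, nsmul_eq_mul, div_self hpos.ne']
  · rw [pushAway, div_eq_zero_iff]
    left
    rw [Finset.mem_erase, not_and_or, not_not] at hw
    rcases hw with rfl | hw
    · rw [if_pos hv, hmin, sub_self]
    · rw [hbS.2 w hw]
      split_ifs with hwF
      · rw [minCoord_eq_zero hF hbS.1 hwF (hbS.2 w hw), sub_self]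
      · exact sub_self 0

lemma minCoord_of_mem_antistar {K : Set (Finset V)} {F : Finset V} (hF : F.Nonempty)
    {b : V → ℝ} (hb : b ∈ realization (antistar K F)) : minCoord F hF b = 0 := by
  obtain ⟨S, ⟨_, hFS⟩, hbS⟩ := mem_realization.1 hb
  obtain ⟨v, hv, hvS⟩ := Finset.not_subset.1 hFS
  exact minCoord_eq_zero hF hbS.1 hv (hbS.2 v hvS)

lemma pushAway_of_mem_antistar {K : Set (Finset V)} {F : Finset V} (hF : F.Nonempty)
    {b : V → ℝ} (hb : b ∈ realization (antistar K F)) : pushAway F hF b = b := by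
  ext v
  simp [pushAway, minCoord_of_mem_antistar hF hb]

lemma ne_barycenter_of_mem_antistar {K : Set (Finset V)} {F : Finset V} (hF : F.Nonempty)
    {b : V → ℝ} (hb : b ∈ realization (antistar K F)) : b ≠ barycenter F := by
  rintro rfl
  have h := minCoord_of_mem_antistar hF hb
  obtain ⟨v, hv, hmin⟩ := Finset.exists_mem_eq_inf' hF (barycenter F)
  change minCoord F hF _ = _ at hmin
  rw [hmin, barycenter, if_pos hv] at h
  have : (0 : ℝ) < F.card := by exact_mod_cast hF.card_pos
  exact (inv_pos.2 this).ne' h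

lemma realization_antistar_subset (K : Set (Finset V)) (F : Finset V) :
    realization (antistar K F) ⊆ realization K :=
  Set.biUnion_mono (fun _ hS => hS.1) fun _ _ => subset_rfl

/-- In a triangulated sphere, the complement of an open face star is contractible. -/
theorem nullhomotopic_antistar {E : Type*} [NormedAddCommGroup E] [InnerProductSpace ℝ E]
    {K : Set (Finset V)} (hK : IsLowerSet K) (h : realization K ≃ₜ Metric.sphere (0 : E) 1)
    {F : Finset V} (hFK : F ∈ K) (hF : F.Nonempty) :
    (ContinuousMap.id (realization (antistar K F))).Nullhomotopic := by
  let p : realization K := ⟨barycenter F, cell_subset_realization hFK (barycenter_mem_cell hF)⟩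
  have hq : ‖(h p : E)‖ = 1 := by simp
  let st := stereographic hq
  have hst : st.source = {h p}ᶜ := stereographic_source hq
  have hst' : st.target = Set.univ := stereographic_target hq
  let i : realization (antistar K F) → realization K :=
    Set.inclusion (realization_antistar_subset K F)
  have hi : ∀ x, h (i x) ∈ st.source := by
    intro x
    rw [hst, Set.mem_compl_singleton_iff, h.injective.ne_iff]
    intro hx
    exact ne_barycenter_of_mem_antistar hF x.2 (congrArg Subtype.val hx)
  let f : C(realization (antistar K F), (Submodule.span ℝ {(h p : E)})ᗮ) :=
    ⟨fun x => st (h (i x)), st.continuousOn.comp_continuous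
      (h.continuous.comp (continuous_inclusion _)) hi⟩
  have hg : ∀ e, (h.symm (st.symm e) : V → ℝ) ≠ barycenter F := by
    intro e he
    have h1 : st.symm e ∈ st.source := st.map_target (by rw [hst']; trivial)
    rw [hst, Set.mem_compl_singleton_iff] at h1
    refine h1 ?_
    rw [← h.apply_symm_apply (st.symm e)]
    congr 1
    exact Subtype.ext he
  have hsymm : Continuous st.symm := by
    have := st.continuousOn_symm
    rwa [hst', continuousOn_univ] at this
  let g : C((Submodule.span ℝ {(h p : E)})ᗮ, realization (antistar K F)) :=
    ⟨fun e => ⟨pushAway F hF (h.symm (st.symm e)),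
      pushAway_mem hK hF (h.symm (st.symm e)).2 (hg e)⟩,
      Continuous.subtype_mk ((continuousOn_pushAway hF (s := {b | b ∈ stdSimplex ℝ V ∧
        b ≠ barycenter F}) fun b hb => (one_sub_minCoord_pos hF hb.1 hb.2).ne').comp_continuous
          (continuous_subtype_val.comp (h.symm.continuous.comp hsymm))
          fun e => ⟨realization_subset K (h.symm (st.symm e)).2, hg e⟩) _⟩
  have hgf : (g.comp (ContinuousMap.id _)).comp f = ContinuousMap.id _ := by
    ext x : 2
    change pushAway F hF (h.symm (st.symm (st (h (i x))))) = x
    rw [st.left_inv (hi x), h.symm_apply_apply]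
    exact pushAway_of_mem_antistar hF x.2
  rw [← hgf]
  exact ((id_nullhomotopic _).comp_right g).comp_left f

/-- Triangulations of spheres are sphere-like. -/
theorem isSphereLike_of_homeomorph (k : Type*) [Field k] [CharP k 2] {E : Type*}
    [NormedAddCommGroup E] [InnerProductSpace ℝ E] {d : ℕ} {K : Set (Finset V)}
    (hK : IsLowerSet K) (hcard : ∀ S ∈ K, S.card ≤ d) (hfacet : ∃ S ∈ K, S.card = d)
    (h : realization K ≃ₜ Metric.sphere (0 : E) 1) : IsSphereLike k d K where
  lower := hK
  empty_mem := by
    obtain ⟨S, hS, _⟩ := hfacet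
    exact hK (Finset.empty_subset S) hS
  card_le := hcard
  exists_facet := hfacet
  acyclic F hF hne n := (acyclic_of_nullhomotopic k (isLowerSet_antistar hK F)
    (nullhomotopic_antistar hK h hF hne)).acyclicBelow n

end PuncturedSphere

section Geometric

variable {V : Type*} [Fintype V] [DecidableEq V] {E : Type*} [AddCommGroup E] [Module ℝ E]

/-- The abstract complex on `V` of the faces of `K`, together with the empty one, along a
labelling `e` of points by `V`. -/
def labelledFaces (K : Geometry.SimplicialComplex ℝ E) (e : V ↪ E) : Set (Finset V) :=
  {S | S = ∅ ∨ S.map e ∈ K.faces}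

variable {K : Geometry.SimplicialComplex ℝ E} {e : V ↪ E}

lemma isLowerSet_labelledFaces : IsLowerSet (labelledFaces K e) := by
  rintro S T hTS (rfl | hS)
  · exact Or.inl (Finset.subset_empty.1 hTS)
  · rcases T.eq_empty_or_nonempty with rfl | hT
    · exact Or.inl rfl
    · exact Or.inr (K.down_closed hS (Finset.map_subset_map.2 hTS) (hT.map))

lemma exists_map_eq_of_mem_faces (he : range e = K.vertices) {s : Finset E} (hs : s ∈ K.faces) :
    ∃ S : Finset V, S.map e = s := by
  have : ∀ x ∈ s, x ∈ range e := by
    intro x hx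
    rw [he, K.vertices_eq]
    exact mem_biUnion hs hx
  refine ⟨s.preimage e e.injective.injOn, ?_⟩
  ext x
  simp only [Finset.mem_map, Finset.mem_preimage]
  refine ⟨?_, fun hx => ?_⟩
  · rintro ⟨v, hv, rfl⟩
    exact hv
  · obtain ⟨v, rfl⟩ := this x hx
    exact ⟨v, hx, rfl⟩

/-- The point with barycentric coordinates `b` with respect to the points `e`. -/
def placement (e : V ↪ E) (b : V → ℝ) : E := ∑ v, b v • e v

lemma placement_eq_sum {S : Finset V} {b : V → ℝ} (hb : ∀ v ∉ S, b v = 0) :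
    placement e b = ∑ v ∈ S, b v • e v :=
  (Finset.sum_subset (Finset.subset_univ S) fun v _ hv => by rw [hb v hv, zero_smul]).symm

lemma sum_of_mem_cell {S : Finset V} {b : V → ℝ} (hb : b ∈ cell S) : ∑ v ∈ S, b v = 1 :=
  (Finset.sum_subset (Finset.subset_univ S) fun v _ hv => hb.2 v hv).trans hb.1.2

lemma image_placement_cell (e : V ↪ E) (S : Finset V) :
    placement e '' cell S = convexHull ℝ (S.map e : Set E) := by
  ext x
  rw [Finset.mem_convexHull']
  simp only [Finset.mem_map, forall_exists_index, and_imp, forall_apply_eq_imp_iff₂,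
    Finset.sum_map]
  constructor
  · rintro ⟨b, hb, rfl⟩
    refine ⟨Function.extend e b 0, fun v _ => ?_, ?_, ?_⟩
    · rw [e.injective.extend_apply]
      exact hb.1.1 v
    · simp only [e.injective.extend_apply]
      exact sum_of_mem_cell hb
    · simp only [e.injective.extend_apply]
      exact (placement_eq_sum hb.2).symm
  · rintro ⟨w, h0, h1, rfl⟩
    refine ⟨fun v => if v ∈ S then w (e v) else 0, ⟨⟨fun v => ?_, ?_⟩, fun v hv => if_neg hv⟩, ?_⟩
    · dsimp only
      split_ifs with hv
      exacts [h0 v hv, le_rfl]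
    · rw [← h1]
      simp
    · simp [placement, ite_smul]

lemma injOn_placement_cell {S : Finset V} (hS : S.map e ∈ K.faces) :
    InjOn (placement e) (cell S) := by
  intro b hb b' hb' h
  have hw : ∀ x ∈ S.map e, Function.extend e (b - b') 0 x = 0 := by
    refine (K.indep hS).eq_zero_of_sum_eq_zero_subtype ?_ ?_
    · simp [e.injective.extend_apply, sum_of_mem_cell hb, sum_of_mem_cell hb']
    · rw [placement_eq_sum hb.2, placement_eq_sum hb'.2] at h
      simp [e.injective.extend_apply, sub_smul, h]
  ext v
  by_cases hv : v ∈ S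
  · have := hw (e v) (Finset.mem_map_of_mem e hv)
    rw [e.injective.extend_apply] at this
    exact sub_eq_zero.1 this
  · rw [hb.2 v hv, hb'.2 v hv]

lemma map_mem_faces_of_mem_cell {S : Finset V} (hS : S ∈ labelledFaces K e) {b : V → ℝ}
    (hb : b ∈ cell S) : S.map e ∈ K.faces := by
  refine hS.resolve_left ?_
  rintro rfl
  simpa using sum_of_mem_cell hb

lemma injOn_placement : InjOn (placement e) (realization (labelledFaces K e)) := by
  classical
  intro b hb b' hb' h
  obtain ⟨S, hS, hbS⟩ := mem_realization.1 hb
  obtain ⟨T, hT, hbT⟩ := mem_realization.1 hb'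
  have hS' := map_mem_faces_of_mem_cell hS hbS
  have hT' := map_mem_faces_of_mem_cell hT hbT
  have hx : placement e b ∈ convexHull ℝ ((S ∩ T).map e : Set E) := by
    rw [Finset.map_inter, Finset.coe_inter]
    refine K.inter_subset_convexHull hS' hT' ⟨?_, ?_⟩
    · exact image_placement_cell e S ▸ mem_image_of_mem _ hbS
    · rw [h]
      exact image_placement_cell e T ▸ mem_image_of_mem _ hbT
  rw [← image_placement_cell] at hx
  obtain ⟨c, hc, hcb⟩ := hx
  rw [← injOn_placement_cell hS' (cell_mono Finset.inter_subset_left hc) hbS hcb]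
  exact injOn_placement_cell hT' (cell_mono Finset.inter_subset_right hc) hbT (hcb.trans h)

lemma image_placement_realization (he : range e = K.vertices) :
    placement e '' realization (labelledFaces K e) = K.space := by
  refine Subset.antisymm ?_ fun x hx => ?_
  · rintro _ ⟨b, hb, rfl⟩
    obtain ⟨S, hS, hbS⟩ := mem_realization.1 hb
    exact K.mem_space_iff.2 ⟨_, map_mem_faces_of_mem_cell hS hbS,
      image_placement_cell e S ▸ mem_image_of_mem _ hbS⟩
  · obtain ⟨s, hs, hxs⟩ := K.mem_space_iff.1 hx
    obtain ⟨S, rfl⟩ := exists_map_eq_of_mem_faces he hs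
    rw [← image_placement_cell] at hxs
    exact image_mono (cell_subset_realization (Or.inr hs)) hxs

/-- The underlying space of a geometric complex realizes its abstract complex. -/
noncomputable def realizationHomeomorph [TopologicalSpace E] [ContinuousAdd E]
    [ContinuousSMul ℝ E] [T2Space E] (he : range e = K.vertices) :
    realization (labelledFaces K e) ≃ₜ K.space :=
  have : CompactSpace (realization (labelledFaces K e)) :=
    isCompact_iff_compactSpace.1 (isCompact_realization _)
  Continuous.homeoOfEquivCompactToT2
    (f := (Equiv.Set.imageOfInjOn _ _ injOn_placement).trans
      (Equiv.setCongr (image_placement_realization he)))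
    (Continuous.subtype_mk (f := fun b : realization (labelledFaces K e) => placement e b)
      (continuous_finsetSum _ fun v _ =>
        ((continuous_apply v).comp continuous_subtype_val).smul continuous_const) _)

lemma faceCount_labelledFaces (he : range e = K.vertices) (j : ℕ) :
    faceCount (labelledFaces K e) (j + 1) = fComplex K j := by
  rw [faceCount, fComplex, ← Set.ncard_image_of_injective _ (Finset.map_injective e)]
  congr 1
  ext s
  constructor
  · rintro ⟨S, ⟨hS, hSj⟩, rfl⟩
    refine ⟨hS.resolve_left ?_, by simpa using hSj⟩
    rintro rfl
    simp at hSj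
  · rintro ⟨hs, hsj⟩
    obtain ⟨S, rfl⟩ := exists_map_eq_of_mem_faces he hs
    exact ⟨S, ⟨Or.inr hs, by simpa using hsj⟩, rfl⟩

theorem isSphereLike_labelledFaces (k : Type*) [Field k] [CharP k 2] [TopologicalSpace E]
    [ContinuousAdd E] [ContinuousSMul ℝ E] [T2Space E] (he : range e = K.vertices) {d : ℕ}
    (hdim : HasDim K d) {F : Type*} [NormedAddCommGroup F] [InnerProductSpace ℝ F]
    (h : K.space ≃ₜ Metric.sphere (0 : F) 1) : IsSphereLike k d (labelledFaces K e) := by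
  refine isSphereLike_of_homeomorph k isLowerSet_labelledFaces ?_ ?_
    ((realizationHomeomorph he).trans h)
  · rintro S (rfl | hS)
    · simp
    · simpa using hdim.1 _ hS
  · obtain ⟨s, hs, hsd⟩ := hdim.2
    obtain ⟨S, rfl⟩ := exists_map_eq_of_mem_faces he hs
    exact ⟨S, Or.inr hs, by simpa using hsd⟩

end Geometric

section CentrallySymmetric

/-- Two fixed-point-free involutions on sets of the same size are conjugate. -/
lemma exists_equiv_of_involutive {V W : Type*} [Fintype V] [Fintype W] [DecidableEq V]
    (hcard : Fintype.card V = Fintype.card W) {σ : V → V} {τ : W → W}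
    (hσ : Function.Involutive σ) (hτ : Function.Involutive τ) (hσ' : ∀ v, σ v ≠ v)
    (hτ' : ∀ w, τ w ≠ w) : ∃ β : V ≃ W, ∀ v, β (σ v) = τ (β v) := by
  let γ := Fintype.equivOfCardEq hcard
  have key : ∀ f : Equiv.Perm V, f ^ 2 = 1 → (∀ v, f v ≠ v) →
      f.cycleType = Multiset.replicate (Fintype.card V / 2) 2 := by
    intro f hf hf'
    have h1 := Equiv.Perm.cycleType_of_pow_prime_eq_one hf
    have h2 : f.support = Finset.univ := by
      ext v
      simp [hf' v]
    have h3 := f.sum_cycleType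
    rw [h2, Finset.card_univ, h1] at h3
    rw [h1, ← h3]
    simp
  have hconj : IsConj (hσ.toPerm σ) (γ.symm.permCongr (hτ.toPerm τ)) := by
    rw [Equiv.Perm.isConj_iff_cycleType_eq, key, key]
    · ext v
      simp [pow_two, hτ _]
    · intro v hv
      exact hτ' (γ v) (by simpa [Equiv.symm_apply_eq] using hv)
    · ext v
      simp [pow_two, hσ _]
    · exact hσ'
  obtain ⟨c, hc⟩ := isConj_iff.1 hconj
  refine ⟨c.trans γ, fun v => ?_⟩
  have := congrArg (fun f : Equiv.Perm V => γ (f (c v))) hc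
  simpa using this

variable {E : Type*} [DecidableEq E] [AddCommGroup E] [Module ℝ E]
  {K : Geometry.SimplicialComplex ℝ E} {φ : E → E}

lemma _root_.IsCSComplex.apply_ne (h : IsCSComplex K φ) {v : E} (hv : v ∈ K.vertices) :
    φ v ≠ v := fun hv' => h.2.2.2 {v} hv (by simp [hv'])

lemma _root_.IsCSComplex.apply_notMem (h : IsCSComplex K φ) {s : Finset E} (hs : s ∈ K.faces)
    {v : E} (hv : v ∈ s) : φ v ∉ s := by
  intro hv'
  have hvK : v ∈ K.vertices := by
    rw [K.vertices_eq]
    exact mem_biUnion hs hv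
  refine h.2.2.2 {v, φ v} (K.down_closed hs (by simp [Finset.insert_subset_iff, hv, hv'])
    (Finset.insert_nonempty _ _)) ?_
  rw [Finset.image_insert, Finset.image_singleton, h.2.1 v hvK, Finset.pair_comm]

/-- The antipodal map on the vertex set. -/
def antipode (h : IsCSComplex K φ) (v : K.vertices) : K.vertices := ⟨φ v, h.1 v v.2⟩

lemma antipode_involutive (h : IsCSComplex K φ) : Function.Involutive (antipode h) :=
  fun v => Subtype.ext (h.2.1 v v.2)

lemma antipode_ne (h : IsCSComplex K φ) (v : K.vertices) : antipode h v ≠ v :=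
  fun hv => h.apply_ne v.2 (congrArg Subtype.val hv)

end CentrallySymmetric

end CSUpperBound

open CSUpperBound

theorem stmt13 {M₁ M₂ : ℕ} (d N : ℕ) (hd : 2 ≤ d) (hN : 2 * d ≤ N) (heven : Even N)
    (Δ : Geometry.SimplicialComplex ℝ (Fin M₁ → ℝ)) (φΔ : (Fin M₁ → ℝ) → (Fin M₁ → ℝ))
    (S : Geometry.SimplicialComplex ℝ (Fin M₂ → ℝ)) (φS : (Fin M₂ → ℝ) → (Fin M₂ → ℝ))
    (hΔcs : IsCSComplex Δ φΔ) (hScs : IsCSComplex S φS)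
    (hΔdim : HasDim Δ d) (hSdim : HasDim S d)
    (hΔN : Δ.vertices.ncard = N) (hSN : S.vertices.ncard = N)
    (hΔsph : Nonempty (Δ.space ≃ₜ Metric.sphere (0 : EuclideanSpace ℝ (Fin d)) 1))
    (hSsph : Nonempty (S.space ≃ₜ Metric.sphere (0 : EuclideanSpace ℝ (Fin d)) 1))
    (hSneighb : CSNeighborlyC S φS (d / 2)) :
    ∀ j, j ≤ d - 1 → fComplex Δ j ≤ fComplex S j := by
  intro j hj
  obtain ⟨hΔ⟩ := hΔsph
  obtain ⟨hS⟩ := hSsph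
  have : Fintype Δ.vertices := (Set.finite_of_ncard_ne_zero (by omega)).fintype
  have : Fintype S.vertices := (Set.finite_of_ncard_ne_zero (by omega)).fintype
  obtain ⟨β, hβ⟩ := exists_equiv_of_involutive
    (by rw [← Nat.card_eq_fintype_card, ← Nat.card_eq_fintype_card, Nat.card_coe_set_eq,
      Nat.card_coe_set_eq, hΔN, hSN])
    (antipode_involutive hΔcs) (antipode_involutive hScs) (antipode_ne hΔcs) (antipode_ne hScs)
  let e : Δ.vertices ↪ (Fin M₁ → ℝ) := Function.Embedding.subtype _
  let e' : Δ.vertices ↪ (Fin M₂ → ℝ) := β.toEmbedding.trans (Function.Embedding.subtype _)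
  have he : range e = Δ.vertices := Subtype.range_coe
  have he' : range e' = S.vertices := by
    simp [e', Function.Embedding.trans, Set.range_comp]
  let k := AlgebraicClosure (ZMod 2)
  have : CharP k 2 := charP_of_injective_algebraMap (algebraMap (ZMod 2) k).injective 2
  have hK := isSphereLike_labelledFaces k he hΔdim hΔ
  have hL := isSphereLike_labelledFaces k he' hSdim hS
  rw [← faceCount_labelledFaces he, ← faceCount_labelledFaces he']
  refine hK.faceCount_le hL (by omega) (fun F hF hFd => ?_) (by omega)
  obtain ⟨G, hG, hFG, hGd⟩ := exists_superset_card_eq (hK.isCM (by omega)) hF hFd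
    (Nat.div_le_self d 2)
  refine hL.lower hFG (Or.inr (hSneighb _ ?_ (by simpa using hGd) ?_))
  · rw [← he', Finset.coe_map]
    exact image_subset_range _ _
  · simp only [Finset.mem_map, forall_exists_index, and_imp, forall_apply_eq_imp_iff₂]
    rintro v hv ⟨w, hw, hwv⟩
    have hw' : w = antipode hΔcs v := β.injective ((Subtype.ext hwv).trans (hβ v).symm)
    have hG' : G.map e ∈ Δ.faces := hG.resolve_left (by rintro rfl; simp at hv)
    refine hΔcs.apply_notMem hG' (Finset.mem_map_of_mem e hv) ?_
    exact Finset.mem_map.2 ⟨w, hw, congrArg Subtype.val hw'⟩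
end

section
/- Let Δ be a connected normal pseudomanifold of dimension d−1 with d−1 ≥ 3. Then g_2(Δ) = f_1(Δ) − d·f_0(Δ) + C(d+1, 2) ≥ 0, i.e., f_1(Δ) ≥ d·f_0(Δ) − C(d+1, 2). -/
open Finset

/-- The number of faces of `Δ` with `c` vertices (i.e. of dimension `c - 1`). -/
def fnum {V : Type*} (Δ : Finset (Finset V)) (c : ℕ) : ℕ :=
  (Δ.filter fun F => F.card = c).card

/-- The link of a face `F` in `Δ`: all faces `G` with `F ∩ G = ∅` and `F ∪ G ∈ Δ`. -/
def lk {V : Type*} [DecidableEq V] (Δ : Finset (Finset V)) (F : Finset V) :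
    Finset (Finset V) :=
  Δ.filter fun G => Disjoint F G ∧ F ∪ G ∈ Δ

/-- Two vertices are adjacent in `Δ` if they are distinct and span an edge of `Δ`. -/
def Adj {V : Type*} [DecidableEq V] (Δ : Finset (Finset V)) (u v : V) : Prop :=
  u ≠ v ∧ ({u, v} : Finset V) ∈ Δ

/-- A complex is connected if any two of its vertices are joined by a path of edges. -/
def ConnComplex {V : Type*} [DecidableEq V] (Δ : Finset (Finset V)) : Prop :=
  ∀ u v : V, ({u} : Finset V) ∈ Δ → ({v} : Finset V) ∈ Δ →
    Relation.ReflTransGen (Adj Δ) u v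

section LowerBound

variable {V : Type*} [DecidableEq V]

/-- Normal pseudomanifolds of dimension `d - 1`. -/
structure IsNormalPseudomanifold (d : ℕ) (Δ : Finset (Finset V)) : Prop where
  empty_mem : ∅ ∈ Δ
  down : ∀ F ∈ Δ, ∀ G, G ⊆ F → G ∈ Δ
  card_le : ∀ F ∈ Δ, F.card ≤ d
  pure : ∀ F ∈ Δ, ∃ G ∈ Δ, F ⊆ G ∧ G.card = d
  ridge : ∀ F ∈ Δ, F.card = d - 1 → (Δ.filter fun G => F ⊆ G ∧ G.card = d).card = 2
  links : ∀ F ∈ Δ, F.card ≤ d - 2 → ConnComplex (lk Δ F)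

/-- The edges of `Δ` with at least one endpoint in `A`. -/
def edgesMeeting (Δ : Finset (Finset V)) (A : Finset V) : Finset (Finset V) :=
  Δ.filter fun e => e.card = 2 ∧ ¬ Disjoint e A

lemma mem_edgesMeeting {Δ : Finset (Finset V)} {A e : Finset V} :
    e ∈ edgesMeeting Δ A ↔ e ∈ Δ ∧ e.card = 2 ∧ ¬ Disjoint e A := by
  simp [edgesMeeting]

lemma exists_step_of_reflTransGen {α : Type*} {r : α → α → Prop} {Q : α → Prop} {s a : α}
    (h : Relation.ReflTransGen r s a) (hs : Q s) (ha : ¬ Q a) :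
    ∃ v w, r v w ∧ Q v ∧ ¬ Q w := by
  by_contra! hcon
  exact ha (h.rec hs fun _ hbc hb => hcon _ _ hbc hb)

lemma lk_empty (Δ : Finset (Finset V)) : lk Δ ∅ = Δ := by
  ext G
  simp [lk]

/-- The triangles of `Δ` with at least one vertex in `A`. -/
def trianglesMeeting (Δ : Finset (Finset V)) (A : Finset V) : Finset (Finset V) :=
  Δ.filter fun τ => τ.card = 3 ∧ ¬ Disjoint τ A

lemma mem_trianglesMeeting {Δ : Finset (Finset V)} {A τ : Finset V} :
    τ ∈ trianglesMeeting Δ A ↔ τ ∈ Δ ∧ τ.card = 3 ∧ ¬ Disjoint τ A := by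
  simp [trianglesMeeting]

/-- The triangles of `Δ` with exactly one vertex in `A`. -/
def boundaryTriangles (Δ : Finset (Finset V)) (A : Finset V) : Finset (Finset V) :=
  Δ.filter fun τ => τ.card = 3 ∧ (τ ∩ A).card = 1

lemma mem_boundaryTriangles {Δ : Finset (Finset V)} {A τ : Finset V} :
    τ ∈ boundaryTriangles Δ A ↔ τ ∈ Δ ∧ τ.card = 3 ∧ (τ ∩ A).card = 1 := by
  simp [boundaryTriangles]

lemma triple_mem_boundaryTriangles {Δ : Finset (Finset V)} {A : Finset V} {a b c : V}
    (hΔ : {b, a, c} ∈ Δ) (ha : a ∈ A) (hb : b ∉ A) (hc : c ∉ A) (hbc : b ≠ c) :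
    {b, a, c} ∈ boundaryTriangles Δ A := by
  have hba : b ≠ a := fun e => hb (e ▸ ha)
  have hac : a ≠ c := fun e => hc (e ▸ ha)
  refine mem_boundaryTriangles.2 ⟨hΔ, ?_, card_eq_one.2 ⟨a, ?_⟩⟩
  · rw [card_insert_of_notMem (by simp [hba, hbc]), card_pair hac]
  · ext x
    simp only [mem_inter, mem_insert, mem_singleton]
    constructor
    · rintro ⟨rfl | rfl | rfl, hx⟩
      · exact absurd hx hb
      · rfl
      · exact absurd hx hc
    · rintro rfl
      exact ⟨by simp, ha⟩

/-- `v` can be reached from `u` along edges of `Δ` with both endpoints in `A`. -/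
def ReachableWithin (Δ : Finset (Finset V)) (A : Finset V) (u v : V) : Prop :=
  Relation.ReflTransGen (fun x y => Adj Δ x y ∧ x ∈ A ∧ y ∈ A) u v

lemma finrank_add_le_of_comp_eq_zero {K M N P : Type*} [Field K] [AddCommGroup M]
    [Module K M] [AddCommGroup N] [Module K N] [AddCommGroup P] [Module K P]
    [FiniteDimensional K M] [FiniteDimensional K N] (f : M →ₗ[K] N) (g : N →ₗ[K] P)
    (hgf : g ∘ₗ f = 0) (hg : Function.Surjective g)
    (hf : Module.finrank K (LinearMap.ker f) ≤ 1) :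
    Module.finrank K P + Module.finrank K M ≤ Module.finrank K N + 1 := by
  have h1 := f.finrank_range_add_finrank_ker
  have h2 := g.finrank_range_add_finrank_ker
  rw [LinearMap.range_eq_top.2 hg, finrank_top] at h2
  have h3 := Submodule.finrank_mono (LinearMap.range_le_ker_iff.2 hgf)
  omega

namespace IsNormalPseudomanifold

variable {d : ℕ} {Δ : Finset (Finset V)}

lemma connected (h : IsNormalPseudomanifold d Δ) : ConnComplex Δ := by
  have := h.links ∅ h.empty_mem (by simp)
  rwa [lk_empty] at this

lemma mem_lk_singleton (h : IsNormalPseudomanifold d Δ) {v : V} {G : Finset V} :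
    G ∈ lk Δ {v} ↔ v ∉ G ∧ insert v G ∈ Δ := by
  simp only [lk, mem_filter, disjoint_singleton_left, singleton_union]
  exact ⟨fun hG => hG.2, fun hG => ⟨h.down _ hG.2 _ (subset_insert _ _), hG⟩⟩

lemma lk_lk_singleton (h : IsNormalPseudomanifold d Δ) {v : V} {F : Finset V} (hv : v ∉ F) :
    lk (lk Δ {v}) F = lk Δ (insert v F) := by
  ext G
  have key : G ∈ lk (lk Δ {v}) F ↔ G ∈ lk Δ {v} ∧ Disjoint F G ∧ F ∪ G ∈ lk Δ {v} := by
    simp only [lk, mem_filter]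
  rw [key, h.mem_lk_singleton, h.mem_lk_singleton]
  simp only [lk, mem_filter, disjoint_insert_left, mem_union, not_or, insert_union]
  constructor
  · rintro ⟨⟨h1, h2⟩, h3, h4, h5⟩
    exact ⟨h.down _ h2 _ (subset_insert _ _), ⟨h1, h3⟩, h5⟩
  · rintro ⟨h1, ⟨h2, h3⟩, h4⟩
    exact ⟨⟨h2, h.down _ h4 _ (insert_subset_insert _ subset_union_right)⟩, h3, ⟨hv, h2⟩, h4⟩

lemma link_singleton (h : IsNormalPseudomanifold (d + 1) Δ) (hd : 2 ≤ d) {v : V}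
    (hv : {v} ∈ Δ) : IsNormalPseudomanifold d (lk Δ {v}) where
  empty_mem := h.mem_lk_singleton.2 ⟨by simp, by simpa using hv⟩
  down F hF G hG := by
    rw [h.mem_lk_singleton] at hF ⊢
    exact ⟨fun hvG => hF.1 (hG hvG), h.down _ hF.2 _ (insert_subset_insert _ hG)⟩
  card_le F hF := by
    rw [h.mem_lk_singleton] at hF
    have := h.card_le _ hF.2
    rw [card_insert_of_notMem hF.1] at this
    omega
  pure F hF := by
    rw [h.mem_lk_singleton] at hF
    obtain ⟨G, hG, hFG, hc⟩ := h.pure _ hF.2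
    have hvG : v ∈ G := hFG (mem_insert_self _ _)
    refine ⟨G.erase v, h.mem_lk_singleton.2 ⟨by simp, by rwa [insert_erase hvG]⟩, ?_, ?_⟩
    · intro x hx
      exact mem_erase.2 ⟨fun hxv => hF.1 (hxv ▸ hx), hFG (mem_insert_of_mem hx)⟩
    · rw [card_erase_of_mem hvG, hc]; rfl
  ridge F hF hc := by
    rw [h.mem_lk_singleton] at hF
    rw [← h.ridge _ hF.2 (by rw [card_insert_of_notMem hF.1]; omega)]
    refine card_bij (fun G _ => insert v G) ?_ ?_ ?_
    · intro G hG
      simp only [mem_filter, h.mem_lk_singleton] at hG ⊢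
      refine ⟨hG.1.2, insert_subset_insert _ hG.2.1, ?_⟩
      rw [card_insert_of_notMem hG.1.1, hG.2.2]
    · intro G hG G' hG' heq
      simp only [mem_filter, h.mem_lk_singleton] at hG hG'
      rw [← erase_insert hG.1.1, ← erase_insert hG'.1.1, heq]
    · intro G hG
      simp only [mem_filter] at hG
      have hvG : v ∈ G := hG.2.1 (mem_insert_self _ _)
      refine ⟨G.erase v, ?_, insert_erase hvG⟩
      simp only [mem_filter, h.mem_lk_singleton]
      refine ⟨⟨by simp, by rw [insert_erase hvG]; exact hG.1⟩, ?_, ?_⟩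
      · intro x hx
        exact mem_erase.2 ⟨fun hxv => hF.1 (hxv ▸ hx), hG.2.1 (mem_insert_of_mem hx)⟩
      · rw [card_erase_of_mem hvG, hG.2.2]; rfl
  links F hF hc := by
    rw [h.mem_lk_singleton] at hF
    rw [h.lk_lk_singleton hF.1]
    exact h.links _ hF.2 (by rw [card_insert_of_notMem hF.1]; omega)

/-- If all vertex links satisfy the edge estimate in one dimension less, so does `Δ`. -/
lemma edge_estimate_of_links (h : IsNormalPseudomanifold (d + 1) Δ)
    (hlk : ∀ v, {v} ∈ Δ → ∀ σ ∈ lk Δ {v}, σ.card = d → ∀ A : Finset V,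
      (∀ a ∈ A, {a} ∈ lk Δ {v}) → Disjoint A σ → d * A.card ≤ (edgesMeeting (lk Δ {v}) A).card)
    {σ : Finset V} (hσ : σ ∈ Δ) (hσc : σ.card = d + 1) (A : Finset V)
    (hA : ∀ a ∈ A, {a} ∈ Δ) (hAσ : Disjoint A σ) :
    (d + 1) * A.card ≤ (edgesMeeting Δ A).card := by
  induction A using Finset.strongInduction with
  | H A ih =>
  rcases A.eq_empty_or_nonempty with rfl | ⟨a, ha⟩
  · simp
  obtain ⟨s, hs⟩ : σ.Nonempty := card_pos.1 (by omega)
  have hsΔ : {s} ∈ Δ := h.down _ hσ _ (by simpa using hs)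
  obtain ⟨v, w, hvw, ⟨τ, hτ, hvτ, hτc, hτA⟩, hw⟩ := exists_step_of_reflTransGen
    (Q := fun v => ∃ τ ∈ Δ, v ∈ τ ∧ τ.card = d + 1 ∧ Disjoint A τ)
    (h.connected s a hsΔ (hA a ha)) ⟨σ, hσ, hs, hσc, hAσ⟩
    (fun ⟨τ, _, haτ, _, hdis⟩ => disjoint_left.1 hdis ha haτ)
  have hv : {v} ∈ Δ := h.down _ hτ _ (by simpa using hvτ)
  have hvA : v ∉ A := fun hv => disjoint_left.1 hτA hv hvτ
  set B := A.filter fun a => {a} ∈ lk Δ {v} with hB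
  have hBne : B.Nonempty := by
    obtain ⟨ρ, hρ, hsub, hρc⟩ := h.pure _ hvw.2
    have : ¬ Disjoint A ρ := fun hd => hw ⟨ρ, hρ, hsub (by simp), hρc, hd⟩
    obtain ⟨x, hxA, hxρ⟩ := not_disjoint_iff.1 this
    refine ⟨x, mem_filter.2 ⟨hxA, h.mem_lk_singleton.2 ⟨?_, h.down _ hρ _ ?_⟩⟩⟩
    · simpa using fun hvx : v = x => hvA (hvx ▸ hxA)
    · intro y hy
      rcases mem_insert.1 hy with rfl | hy
      · exact hsub (by simp)
      · rwa [mem_singleton.1 hy]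
  have hBA : B ⊆ A := filter_subset _ _
  have h1 : d * B.card ≤ (edgesMeeting (lk Δ {v}) B).card := by
    refine hlk v hv (τ.erase v) (h.mem_lk_singleton.2 ⟨by simp, by rwa [insert_erase hvτ]⟩)
      (by rw [card_erase_of_mem hvτ, hτc]; rfl) B (fun a ha => (mem_filter.1 ha).2) ?_
    exact disjoint_of_subset_left hBA (disjoint_of_subset_right (erase_subset _ _) hτA)
  have h2 : (d + 1) * (A \ B).card ≤ (edgesMeeting Δ (A \ B)).card := by
    refine ih _ (sdiff_ssubset hBA hBne) (fun a ha => hA a (mem_sdiff.1 ha).1) ?_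
    exact disjoint_of_subset_left sdiff_subset hAσ
  have h3 : (B.image fun b => ({v, b} : Finset V)).card = B.card := by
    refine card_image_of_injOn fun b hb c hc hbc => ?_
    have hbv : b ≠ v := fun e => hvA (e ▸ hBA hb)
    have : b ∈ ({v, c} : Finset V) := by
      have : b ∈ ({v, b} : Finset V) := by simp
      rwa [show ({v, b} : Finset V) = {v, c} from hbc] at this
    simpa [hbv] using this
  have hd1 : Disjoint (edgesMeeting (lk Δ {v}) B) (B.image fun b => ({v, b} : Finset V)) := by
    refine disjoint_left.2 fun e he he' => ?_
    obtain ⟨b, -, rfl⟩ := mem_image.1 he'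
    exact (h.mem_lk_singleton.1 (mem_edgesMeeting.1 he).1).1 (by simp)
  have hd2 : Disjoint (edgesMeeting (lk Δ {v}) B ∪ B.image fun b => ({v, b} : Finset V))
      (edgesMeeting Δ (A \ B)) := by
    refine disjoint_left.2 fun e he he' => ?_
    obtain ⟨x, hxe, hx⟩ := not_disjoint_iff.1 (mem_edgesMeeting.1 he').2.2
    obtain ⟨hxA, hxB⟩ := mem_sdiff.1 hx
    rcases mem_union.1 he with he | he
    · have := h.mem_lk_singleton.1 (mem_edgesMeeting.1 he).1
      refine hxB (mem_filter.2 ⟨hxA, h.mem_lk_singleton.2 ⟨?_, h.down _ this.2 _ ?_⟩⟩)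
      · simpa using fun hvx : v = x => hvA (hvx ▸ hxA)
      · exact insert_subset_insert _ (by simpa using hxe)
    · obtain ⟨b, hb, rfl⟩ := mem_image.1 he
      rcases mem_insert.1 hxe with rfl | hxe
      · exact hvA hxA
      · exact hxB (mem_singleton.1 hxe ▸ hb)
  have hsub : (edgesMeeting (lk Δ {v}) B ∪ B.image fun b => ({v, b} : Finset V)) ∪
      edgesMeeting Δ (A \ B) ⊆ edgesMeeting Δ A := by
    intro e he
    rw [mem_edgesMeeting]
    rcases mem_union.1 he with he | he
    · rcases mem_union.1 he with he | he
      · obtain ⟨h1, h2, h3⟩ := mem_edgesMeeting.1 he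
        exact ⟨(mem_filter.1 h1).1, h2, fun hd => h3 (disjoint_of_subset_right hBA hd)⟩
      · obtain ⟨b, hb, rfl⟩ := mem_image.1 he
        have hbv : v ≠ b := fun e => hvA (e ▸ hBA hb)
        refine ⟨(h.mem_lk_singleton.1 (mem_filter.1 hb).2).2, card_pair hbv, ?_⟩
        exact not_disjoint_iff.2 ⟨b, by simp, hBA hb⟩
    · obtain ⟨h1, h2, h3⟩ := mem_edgesMeeting.1 he
      exact ⟨h1, h2, fun hd => h3 (disjoint_of_subset_right sdiff_subset hd)⟩
  have hle := card_le_card hsub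
  rw [card_union_of_disjoint hd2, card_union_of_disjoint hd1, h3] at hle
  have hcard := card_sdiff_add_card_eq_card hBA
  nlinarith

lemma adj_left_mem (h : IsNormalPseudomanifold d Δ) {u v : V} (huv : Adj Δ u v) : {u} ∈ Δ :=
  h.down _ huv.2 _ (by simp)

lemma adj_right_mem (h : IsNormalPseudomanifold d Δ) {u v : V} (huv : Adj Δ u v) : {v} ∈ Δ :=
  h.down _ huv.2 _ (by simp)

lemma adj_link_singleton (h : IsNormalPseudomanifold d Δ) {v x y : V} :
    Adj (lk Δ {v}) x y ↔ x ≠ y ∧ v ≠ x ∧ v ≠ y ∧ {v, x, y} ∈ Δ := by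
  rw [Adj, h.mem_lk_singleton]
  simp [and_assoc]

lemma singleton_mem_link_singleton (h : IsNormalPseudomanifold d Δ) {v x : V} :
    {x} ∈ lk Δ {v} ↔ Adj Δ v x := by
  rw [Adj, h.mem_lk_singleton]
  simp

lemma link_path (h : IsNormalPseudomanifold 3 Δ) {v x y : V} (hx : Adj Δ v x) (hy : Adj Δ v y) :
    Relation.ReflTransGen (Adj (lk Δ {v})) x y :=
  h.links {v} (h.adj_left_mem hx) (by simp) x y (h.singleton_mem_link_singleton.2 hx)
    (h.singleton_mem_link_singleton.2 hy)

lemma eq_or_eq_of_edge_subset (h : IsNormalPseudomanifold 3 Δ) {e τ₁ τ₂ τ : Finset V}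
    (he : e.card = 2) (h₁ : τ₁ ∈ Δ) (hc₁ : τ₁.card = 3) (he₁ : e ⊆ τ₁) (h₂ : τ₂ ∈ Δ)
    (hc₂ : τ₂.card = 3) (he₂ : e ⊆ τ₂) (hne : τ₁ ≠ τ₂) (hτ : τ ∈ Δ) (hc : τ.card = 3)
    (heτ : e ⊆ τ) : τ = τ₁ ∨ τ = τ₂ := by
  have hr := h.ridge e (h.down _ h₁ _ he₁) he
  have hsub : ({τ₁, τ₂} : Finset (Finset V)) ⊆ Δ.filter fun G => e ⊆ G ∧ G.card = 3 := by
    intro x hx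
    rcases mem_insert.1 hx with rfl | hx
    · exact mem_filter.2 ⟨h₁, he₁, hc₁⟩
    · rw [mem_singleton.1 hx]
      exact mem_filter.2 ⟨h₂, he₂, hc₂⟩
  have heq := eq_of_subset_of_card_le hsub (by rw [hr, card_pair hne])
  have : τ ∈ ({τ₁, τ₂} : Finset (Finset V)) := heq ▸ mem_filter.2 ⟨hτ, heτ, hc⟩
  simpa using this

/-- Counting pairs (edge meeting `A`, triangle containing it). -/
lemma two_mul_edgesMeeting_add_le (h : IsNormalPseudomanifold 3 Δ) (A : Finset V) :
    2 * (edgesMeeting Δ A).card + (boundaryTriangles Δ A).card ≤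
      3 * (trianglesMeeting Δ A).card := by
  have hcount := sum_card_bipartiteAbove_eq_sum_card_bipartiteBelow
    (s := edgesMeeting Δ A) (t := trianglesMeeting Δ A) (fun e τ => e ⊆ τ)
  have h1 : ∑ e ∈ edgesMeeting Δ A, #(bipartiteAbove (fun e τ => e ⊆ τ) (trianglesMeeting Δ A) e)
      = 2 * (edgesMeeting Δ A).card := by
    rw [mul_comm]
    refine sum_const_nat fun e he => ?_
    obtain ⟨he1, he2, he3⟩ := mem_edgesMeeting.1 he
    rw [← h.ridge e he1 he2]
    congr 1
    ext τ
    simp only [bipartiteAbove, mem_filter, mem_trianglesMeeting]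
    refine ⟨fun hτ => ⟨hτ.1.1, hτ.2, hτ.1.2.1⟩, fun hτ => ⟨⟨hτ.1, hτ.2.2, fun hd => ?_⟩, hτ.2.1⟩⟩
    exact he3 (disjoint_of_subset_left hτ.2.1 hd)
  have hsub : boundaryTriangles Δ A ⊆ trianglesMeeting Δ A := by
    intro τ hτ
    obtain ⟨h1, h2, h3⟩ := mem_boundaryTriangles.1 hτ
    refine mem_trianglesMeeting.2 ⟨h1, h2, fun hd => ?_⟩
    rw [disjoint_iff_inter_eq_empty.1 hd] at h3
    simp at h3
  have h2 : ∑ τ ∈ trianglesMeeting Δ A,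
      (#(bipartiteBelow (fun e τ => e ⊆ τ) (edgesMeeting Δ A) τ) +
        if τ ∈ boundaryTriangles Δ A then 1 else 0) ≤ 3 * (trianglesMeeting Δ A).card := by
    rw [mul_comm, ← smul_eq_mul]
    refine sum_le_card_nsmul _ _ _ fun τ hτ => ?_
    have hτc := (mem_trianglesMeeting.1 hτ).2.1
    have hsub1 : bipartiteBelow (fun e τ => e ⊆ τ) (edgesMeeting Δ A) τ ⊆ powersetCard 2 τ := by
      intro e he
      have := mem_filter.1 he
      exact mem_powersetCard.2 ⟨this.2, (mem_edgesMeeting.1 this.1).2.1⟩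
    have hc3 : (powersetCard 2 τ).card = 3 := by rw [card_powersetCard, hτc]; rfl
    split_ifs with hb
    · obtain ⟨-, -, hb⟩ := mem_boundaryTriangles.1 hb
      have hlt : bipartiteBelow (fun e τ => e ⊆ τ) (edgesMeeting Δ A) τ ⊂ powersetCard 2 τ := by
        refine (ssubset_iff_of_subset hsub1).2 ⟨τ \ A, mem_powersetCard.2 ⟨sdiff_subset, ?_⟩, ?_⟩
        · have := card_sdiff_add_card_inter τ A
          omega
        · intro hmem
          exact (mem_edgesMeeting.1 (mem_filter.1 hmem).1).2.2 sdiff_disjoint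
      have := card_lt_card hlt
      omega
    · have := card_le_card hsub1
      omega
  rw [sum_add_distrib, ← hcount, h1, sum_ite_mem, inter_eq_right.2 hsub] at h2
  simpa using h2

/-- A vertex outside `A` lies in an even number of triangles with exactly one vertex in `A`. -/
lemma even_boundaryTriangles (h : IsNormalPseudomanifold 3 Δ) {A : Finset V} {b : V}
    (hb : b ∉ A) : Even ((boundaryTriangles Δ A).filter fun τ => b ∈ τ).card := by
  set T := Δ.filter fun τ => τ.card = 3 ∧ b ∈ τ with hT
  have hcount := sum_card_bipartiteAbove_eq_sum_card_bipartiteBelow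
    (s := A) (t := T) (fun a τ => a ∈ τ)
  have h1 : Even (∑ a ∈ A, #(bipartiteAbove (fun a τ => a ∈ τ) T a)) := by
    refine even_sum _ fun a ha => ?_
    have hba : b ≠ a := fun e => hb (e ▸ ha)
    have heq : bipartiteAbove (fun a τ => a ∈ τ) T a =
        Δ.filter fun G => ({b, a} : Finset V) ⊆ G ∧ G.card = 3 := by
      ext τ
      simp only [bipartiteAbove, hT, mem_filter, insert_subset_iff, singleton_subset_iff]
      tauto
    rw [heq]
    by_cases hΔ : ({b, a} : Finset V) ∈ Δ
    · rw [h.ridge _ hΔ (card_pair hba)]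
      exact even_two
    · rw [filter_eq_empty_iff.2 fun G hG hsub => hΔ (h.down _ hG _ hsub.1)]
      simp
  rw [hcount, even_sum_iff_even_card_odd] at h1
  convert h1 using 2
  ext τ
  simp only [mem_filter, mem_boundaryTriangles, hT, bipartiteBelow]
  have hcomm : A.filter (fun a => a ∈ τ) = τ ∩ A := by
    ext; simp [and_comm]
  rw [hcomm]
  constructor
  · rintro ⟨⟨h1, h2, h3⟩, h4⟩
    exact ⟨⟨h1, h2, h4⟩, by rw [h3]; exact odd_one⟩
  · rintro ⟨⟨h1, h2, h3⟩, h4⟩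
    refine ⟨⟨h1, h2, ?_⟩, h3⟩
    have hlt : (τ ∩ A).card < τ.card :=
      card_lt_card ((ssubset_iff_of_subset inter_subset_left).2 ⟨b, h3, by simp [hb]⟩)
    rw [h2] at hlt
    interval_cases hk : (τ ∩ A).card
    · simp at h4
    · rfl
    · exact absurd h4 (by decide)

lemma exists_boundary_triangle (h : IsNormalPseudomanifold 3 Δ) {A : Finset V} {a b c c' : V}
    (hb : b ∉ A) (ha : a ∈ A) (hba : Adj Δ b a) (hc : c ∉ A) (hbc : Adj Δ b c) (hc' : c' ∉ A)
    (hbc' : Adj Δ b c') (hcc : c ≠ c') (x : V) :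
    ∃ a' ∈ A, ∃ y, y ∉ A ∧ y ≠ x ∧ b ≠ y ∧ {b, a', y} ∈ Δ := by
  by_contra! hcon
  obtain ⟨z, hzA, hzx, hbz⟩ : ∃ z, z ∉ A ∧ z ≠ x ∧ Adj Δ b z := by
    by_cases hcx : c = x
    · exact ⟨c', hc', fun e => hcc (hcx.trans e.symm), hbc'⟩
    · exact ⟨c, hc, hcx, hbc⟩
  have hpath := h.link_path hbz hba
  obtain ⟨w, w', hww, hwA, hwA'⟩ := exists_step_of_reflTransGen (Q := fun y => y ∉ A) hpath hzA
    (not_not.2 ha)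
  rw [not_not] at hwA'
  rw [h.adj_link_singleton] at hww
  have hbw : ({b, w', w} : Finset V) ∈ Δ := by rw [pair_comm]; exact hww.2.2.2
  have hwx : w = x := by
    by_contra hne
    exact hcon w' hwA' w hwA hne hww.2.1 hbw
  subst hwx
  have hmem1 : {b, w', w} ∈ (boundaryTriangles Δ A).filter fun τ => b ∈ τ :=
    mem_filter.2 ⟨triple_mem_boundaryTriangles hbw hwA' hb hwA hww.2.1, by simp⟩
  have hall : ∀ τ ∈ (boundaryTriangles Δ A).filter fun τ => b ∈ τ, {b, w} ⊆ τ := by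
    intro τ hτ
    obtain ⟨hτ, hbτ⟩ := mem_filter.1 hτ
    obtain ⟨hτ, hτc, hτA⟩ := mem_boundaryTriangles.1 hτ
    obtain ⟨a', ha'⟩ := card_eq_one.1 hτA
    have ha'm : a' ∈ τ ∩ A := by rw [ha']; simp
    obtain ⟨ha'τ, ha'A⟩ := mem_inter.1 ha'm
    have hba' : b ≠ a' := fun e => hb (e ▸ ha'A)
    obtain ⟨y, hy⟩ : ((τ.erase b).erase a').Nonempty := by
      rw [← card_pos, card_erase_of_mem (mem_erase.2 ⟨hba'.symm, ha'τ⟩), card_erase_of_mem hbτ]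
      omega
    simp only [mem_erase] at hy
    have hyA : y ∉ A := fun hyA => hy.1 (by
      have : y ∈ τ ∩ A := mem_inter.2 ⟨hy.2.2, hyA⟩
      rw [ha'] at this
      exact mem_singleton.1 this)
    have hyw : y = w := by
      by_contra hne
      refine hcon a' ha'A y hyA hne hy.2.1.symm (h.down _ hτ _ ?_)
      simp [insert_subset_iff, hbτ, ha'τ, hy.2.2]
    subst hyw
    simp [insert_subset_iff, hbτ, hy.2.2]
  obtain ⟨τ, hτ, hτne⟩ : ∃ τ ∈ (boundaryTriangles Δ A).filter fun τ => b ∈ τ,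
      τ ≠ {b, w', w} := by
    refine exists_mem_ne ?_ _
    have hpos : 0 < _ := card_pos.2 ⟨_, hmem1⟩
    have := h.even_boundaryTriangles (Δ := Δ) hb
    rcases this with ⟨k, hk⟩
    omega
  have hB1 := mem_boundaryTriangles.1 (mem_filter.1 hmem1).1
  have hB2 := mem_boundaryTriangles.1 (mem_filter.1 hτ).1
  obtain ⟨p, q, hpq, ⟨hpA, hpw⟩, hq⟩ := exists_step_of_reflTransGen
    (Q := fun y => y ∉ A ∧ y ≠ w) hpath ⟨hzA, hzx⟩ (fun hq => hq.1 ha)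
  rw [h.adj_link_singleton] at hpq
  have hbq : ({b, q, p} : Finset V) ∈ Δ := by rw [pair_comm]; exact hpq.2.2.2
  by_cases hqA : q ∈ A
  · exact hcon q hqA p hpA hpw hpq.2.1 hbq
  · have hqw : q = w := by
      by_contra hne
      exact hq ⟨hqA, hne⟩
    subst hqw
    have hcc : ({b, q, p} : Finset V).card = 3 := by
      rw [card_insert_of_notMem (by simp [hpq.2.1, hpq.2.2.1]), card_pair hpq.1.symm]
    have hAne : ({b, q, p} : Finset V) ∩ A = ∅ := by
      ext y
      simp only [mem_inter, mem_insert, mem_singleton, notMem_empty, iff_false, not_and]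
      rintro (rfl | rfl | rfl) <;> assumption
    rcases h.eq_or_eq_of_edge_subset (card_pair hww.2.1) hB1.1 hB1.2.1 (hall _ hmem1) hB2.1
      hB2.2.1 (hall _ hτ) hτne.symm hbq hcc (by simp [insert_subset_iff]) with e | e
    · have := hB1.2.2
      rw [← e, hAne] at this
      simp at this
    · have := hB2.2.2
      rw [← e, hAne] at this
      simp at this

/-- If each vertex outside `A` adjacent to `A` has two neighbours outside `A`, then at least three
triangles have exactly one vertex in `A`. -/
lemma three_le_boundaryTriangles (h : IsNormalPseudomanifold 3 Δ) {A : Finset V} {a₀ b₀ : V}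
    (ha₀ : a₀ ∈ A) (hb₀ : b₀ ∉ A) (hab₀ : Adj Δ b₀ a₀)
    (hnbr : ∀ b a, b ∉ A → a ∈ A → Adj Δ b a →
      ∃ c c', c ∉ A ∧ c' ∉ A ∧ c ≠ c' ∧ Adj Δ b c ∧ Adj Δ b c') :
    3 ≤ (boundaryTriangles Δ A).card := by
  have key : ∀ b a, b ∉ A → a ∈ A → Adj Δ b a → ∀ x,
      ∃ a' ∈ A, ∃ y, y ∉ A ∧ y ≠ x ∧ b ≠ y ∧ {b, a', y} ∈ Δ := by
    intro b a hb ha hba x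
    obtain ⟨c, c', hc, hc', hcc, hbc, hbc'⟩ := hnbr b a hb ha hba
    exact h.exists_boundary_triangle hb ha hba hc hbc hc' hbc' hcc x
  obtain ⟨a₁, ha₁, b₁, hb₁, -, hbb₁, hΔ₁⟩ := key b₀ a₀ hb₀ ha₀ hab₀ b₀
  obtain ⟨a₂, ha₂, b₂, hb₂, hne₂, hbb₂, hΔ₂⟩ := key b₀ a₀ hb₀ ha₀ hab₀ b₁
  have hadj : Adj Δ b₁ a₁ := ⟨fun e => hb₁ (e ▸ ha₁), h.down _ hΔ₁ _ (by simp [insert_subset_iff])⟩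
  obtain ⟨a₃, ha₃, b₃, hb₃, hne₃, hbb₃, hΔ₃⟩ := key b₁ a₁ hb₁ ha₁ hadj b₀
  have hm₁ := triple_mem_boundaryTriangles hΔ₁ ha₁ hb₀ hb₁ hbb₁
  have hm₂ := triple_mem_boundaryTriangles hΔ₂ ha₂ hb₀ hb₂ hbb₂
  have hm₃ := triple_mem_boundaryTriangles hΔ₃ ha₃ hb₁ hb₃ hbb₃
  have hb₀₃ : b₀ ∉ ({b₁, a₃, b₃} : Finset V) := by
    simp only [mem_insert, mem_singleton, not_or]
    exact ⟨hbb₁, fun e => hb₀ (e ▸ ha₃), hne₃.symm⟩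
  have hb₁₂ : b₁ ∉ ({b₀, a₂, b₂} : Finset V) := by
    simp only [mem_insert, mem_singleton, not_or]
    exact ⟨hbb₁.symm, fun e => hb₁ (e ▸ ha₂), hne₂.symm⟩
  have h12 : ({b₀, a₁, b₁} : Finset V) ≠ {b₀, a₂, b₂} := fun e => hb₁₂ (e ▸ by simp)
  have h13 : ({b₀, a₁, b₁} : Finset V) ≠ {b₁, a₃, b₃} := fun e => hb₀₃ (e ▸ by simp)
  have h23 : ({b₀, a₂, b₂} : Finset V) ≠ {b₁, a₃, b₃} := fun e => hb₀₃ (e ▸ by simp)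
  calc 3 = #{({b₀, a₁, b₁} : Finset V), {b₀, a₂, b₂}, {b₁, a₃, b₃}} := by
        rw [card_insert_of_notMem (by simp [h12, h13]), card_pair h23]
    _ ≤ _ := card_le_card (by
        intro τ hτ
        simp only [mem_insert, mem_singleton] at hτ
        rcases hτ with rfl | rfl | rfl <;> assumption)

lemma even_card_edgesMeeting_subset (h : IsNormalPseudomanifold 3 Δ) {A τ : Finset V} {a : V} (ha : a ∈ A)
    (hτ : τ ∈ Δ) (hτc : τ.card = 3) :
    Even #{e ∈ edgesMeeting Δ A | a ∈ e ∧ e ⊆ τ} := by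
  by_cases haτ : a ∈ τ
  · have heq : {e ∈ edgesMeeting Δ A | a ∈ e ∧ e ⊆ τ} =
        (τ.erase a).image fun x => ({a, x} : Finset V) := by
      ext e
      simp only [mem_filter, mem_image, mem_edgesMeeting, mem_erase]
      constructor
      · rintro ⟨⟨h1, h2, h3⟩, hae, heτ⟩
        obtain ⟨x, hx⟩ := card_eq_one.1 (by rw [card_erase_of_mem hae, h2] : (e.erase a).card = 1)
        have hxe : x ∈ e.erase a := by rw [hx]; simp
        refine ⟨x, ⟨(mem_erase.1 hxe).1, heτ (mem_erase.1 hxe).2⟩, ?_⟩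
        rw [← insert_erase hae, hx]
      · rintro ⟨x, ⟨hxa, hxτ⟩, rfl⟩
        have hs : ({a, x} : Finset V) ⊆ τ := by simp [insert_subset_iff, haτ, hxτ]
        exact ⟨⟨h.down _ hτ _ hs, card_pair hxa.symm, not_disjoint_iff.2 ⟨a, by simp, ha⟩⟩,
          by simp, hs⟩
    rw [heq, card_image_of_injOn, card_erase_of_mem haτ, hτc]
    · exact even_two
    · intro x hx y hy hxy
      have hxa : x ≠ a := (mem_erase.1 hx).1
      have hxm : x ∈ ({a, y} : Finset V) := by
        rw [← show ({a, x} : Finset V) = {a, y} from hxy]; simp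
      simpa [hxa] using hxm
  · rw [filter_eq_empty_iff.2 fun e _ he => haτ (he.2 he.1)]
    simp

lemma constant_of_eq_across_edges (h : IsNormalPseudomanifold 3 Δ) {α : Type*} {A : Finset V}
    {u : V} (hA : ∀ a ∈ A, ReachableWithin Δ A u a) (x : Finset V → α)
    (hx : ∀ e ∈ edgesMeeting Δ A, ∀ τ ∈ Δ, ∀ τ' ∈ Δ, τ.card = 3 → τ'.card = 3 → e ⊆ τ → e ⊆ τ' →
      x τ = x τ') {τ τ' : Finset V} (hτ : τ ∈ trianglesMeeting Δ A)
    (hτ' : τ' ∈ trianglesMeeting Δ A) : x τ = x τ' := by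
  have hedge : ∀ a ∈ A, ∀ v, Adj Δ a v → ({a, v} : Finset V) ∈ edgesMeeting Δ A := fun a ha v hv =>
    mem_edgesMeeting.2 ⟨hv.2, card_pair hv.1, not_disjoint_iff.2 ⟨a, by simp, ha⟩⟩
  have hlink : ∀ a ∈ A, ∀ v w, Adj Δ a v → Relation.ReflTransGen (Adj (lk Δ {a})) v w →
      ∀ τ ∈ Δ, ∀ τ' ∈ Δ, τ.card = 3 → τ'.card = 3 → {a, v} ⊆ τ → {a, w} ⊆ τ' → x τ = x τ' := by
    intro a ha v w hv hvw τ hτ τ' hτ' hc hc' hs hs'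
    induction hvw generalizing τ' with
    | refl => exact hx _ (hedge a ha v hv) τ hτ τ' hτ' hc hc' hs hs'
    | @tail b c _ hbc ih =>
      rw [h.adj_link_singleton] at hbc
      have hρc : ({a, b, c} : Finset V).card = 3 := by
        rw [card_insert_of_notMem (by simp [hbc.2.1, hbc.2.2.1]), card_pair hbc.1]
      refine (ih _ hbc.2.2.2 hρc (by simp [insert_subset_iff])).trans ?_
      have hac : Adj Δ a c := ⟨hbc.2.2.1, h.down _ hτ' _ hs'⟩
      exact hx _ (hedge a ha c hac) _ hbc.2.2.2 τ' hτ' hρc hc' (by simp [insert_subset_iff]) hs'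
  have hvertex : ∀ a ∈ A, ∀ τ ∈ Δ, ∀ τ' ∈ Δ, τ.card = 3 → τ'.card = 3 → a ∈ τ → a ∈ τ' →
      x τ = x τ' := by
    intro a ha τ hτ τ' hτ' hc hc' hs hs'
    obtain ⟨v, hv, hva⟩ := exists_mem_ne (by omega : 1 < τ.card) a
    obtain ⟨w, hw, hwa⟩ := exists_mem_ne (by omega : 1 < τ'.card) a
    have hs1 : ({a, v} : Finset V) ⊆ τ := by simp [insert_subset_iff, *]
    have hs2 : ({a, w} : Finset V) ⊆ τ' := by simp [insert_subset_iff, *]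
    have hav : Adj Δ a v := ⟨hva.symm, h.down _ hτ _ hs1⟩
    have haw : Adj Δ a w := ⟨hwa.symm, h.down _ hτ' _ hs2⟩
    exact hlink a ha v w hav (h.link_path hav haw) τ hτ τ' hτ' hc hc' hs1 hs2
  have hroot : ∀ a, ReachableWithin Δ A u a → a ∈ A → ∀ τ ∈ Δ, ∀ τ' ∈ Δ, τ.card = 3 → τ'.card = 3 →
      u ∈ τ → a ∈ τ' → x τ = x τ' := by
    intro a hua ha τ hτ τ' hτ' hc hc' hs hs'
    induction hua generalizing τ' with
    | refl => exact hvertex u ha τ hτ τ' hτ' hc hc' hs hs'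
    | @tail b c _ hbc ih =>
      obtain ⟨ρ, hρ, hsub, hρc⟩ := h.pure _ hbc.1.2
      exact (ih hbc.2.1 ρ hρ hρc (hsub (by simp))).trans
        (hvertex c ha ρ hρ τ' hτ' hρc hc' (hsub (by simp)) hs')
  obtain ⟨h1, h2, h3⟩ := mem_trianglesMeeting.1 hτ
  obtain ⟨h1', h2', h3'⟩ := mem_trianglesMeeting.1 hτ'
  obtain ⟨a, haτ, ha⟩ := not_disjoint_iff.1 h3
  obtain ⟨a', haτ', ha'⟩ := not_disjoint_iff.1 h3'
  have huA : u ∈ A ∧ {u} ∈ Δ := by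
    rcases Relation.ReflTransGen.cases_head (hA a ha) with rfl | ⟨w, hw, -⟩
    · exact ⟨ha, h.down _ h1 _ (by simpa using haτ)⟩
    · exact ⟨hw.2.1, h.adj_left_mem hw.1⟩
  obtain ⟨ρ, hρ, hsub, hρc⟩ := h.pure _ huA.2
  have huρ : u ∈ ρ := hsub (by simp)
  exact (hroot a (hA a ha) ha ρ hρ τ h1 hρc h2 huρ haτ).symm.trans
    (hroot a' (hA a' ha') ha' ρ hρ τ' h1' hρc h2' huρ haτ')

/-- The Euler characteristic of a connected open neighbourhood of `A` is at most one. -/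
lemma card_add_trianglesMeeting_le (h : IsNormalPseudomanifold 3 Δ) {A : Finset V} {u a₀ b₀ : V}
    (hA : ∀ a ∈ A, ReachableWithin Δ A u a) (ha₀ : a₀ ∈ A) (hb₀ : b₀ ∉ A) (hab : Adj Δ b₀ a₀) :
    A.card + (trianglesMeeting Δ A).card ≤ (edgesMeeting Δ A).card + 1 := by
  let E := edgesMeeting Δ A
  let T := trianglesMeeting Δ A
  let M : Matrix E T (ZMod 2) := fun e τ => if e.1 ⊆ τ.1 then 1 else 0
  let N : Matrix A E (ZMod 2) := fun a e => if a.1 ∈ e.1 then 1 else 0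
  have hNM : N * M = 0 := by
    ext a τ
    have hτ := mem_trianglesMeeting.1 τ.2
    have heven := h.even_card_edgesMeeting_subset a.2 hτ.1 hτ.2.1
    rw [Matrix.mul_apply, Matrix.zero_apply]
    simp only [M, N, mul_ite, mul_one, mul_zero]
    refine Eq.trans ?_ (ZMod.natCast_eq_zero_iff_even.2 heven)
    rw [Finset.sum_coe_sort E
      (fun e => if e ⊆ τ.1 then (if a.1 ∈ e then (1 : ZMod 2) else 0) else 0)]
    simp only [← ite_and, sum_boole]
    congr 3
    ext e
    simp only [and_comm]
  have hsurj : Function.Surjective N.mulVecLin := by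
    rw [← LinearMap.range_eq_top]
    have hcol : ∀ e ∈ E, (fun a : A => if a.1 ∈ e then (1 : ZMod 2) else 0) ∈
        LinearMap.range N.mulVecLin := by
      intro e he
      refine ⟨Pi.single ⟨e, he⟩ 1, ?_⟩
      rw [Matrix.mulVecLin_apply, Matrix.mulVec_single_one]
      rfl
    have hbase : (Pi.single ⟨a₀, ha₀⟩ 1 : A → ZMod 2) ∈ LinearMap.range N.mulVecLin := by
      convert hcol {b₀, a₀} (mem_edgesMeeting.2 ⟨hab.2, card_pair hab.1,
        not_disjoint_iff.2 ⟨a₀, by simp, ha₀⟩⟩) using 1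
      ext a
      have : a.1 ≠ b₀ := fun e => hb₀ (e ▸ a.2)
      simp [Pi.single_apply, Subtype.ext_iff, this]
    have hstep : ∀ a b (ha : a ∈ A) (hb : b ∈ A), Adj Δ a b →
        ((Pi.single ⟨a, ha⟩ 1 : A → ZMod 2) ∈ LinearMap.range N.mulVecLin ↔
        (Pi.single ⟨b, hb⟩ 1 : A → ZMod 2) ∈ LinearMap.range N.mulVecLin) := by
      intro a b ha hb hadj
      have hsum : (Pi.single ⟨a, ha⟩ 1 + Pi.single ⟨b, hb⟩ 1 : A → ZMod 2) ∈
          LinearMap.range N.mulVecLin := by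
        convert hcol {a, b} (mem_edgesMeeting.2 ⟨hadj.2, card_pair hadj.1,
          not_disjoint_iff.2 ⟨a, by simp, ha⟩⟩) using 1
        ext c
        by_cases hca : c.1 = a
        · simp [Pi.single_apply, Subtype.ext_iff, hca, hadj.1]
        · simp [Pi.single_apply, Subtype.ext_iff, hca]
      exact ⟨fun hm => (Submodule.add_mem_iff_right _ hm).1 hsum,
        fun hm => (Submodule.add_mem_iff_left _ hm).1 hsum⟩
    have huA : u ∈ A := by
      rcases Relation.ReflTransGen.cases_head (hA a₀ ha₀) with rfl | ⟨w, hw, -⟩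
      · exact ha₀
      · exact hw.2.1
    have hroot : ∀ a, ReachableWithin Δ A u a → ∀ ha : a ∈ A,
        ((Pi.single ⟨u, huA⟩ 1 : A → ZMod 2) ∈ LinearMap.range N.mulVecLin ↔
        (Pi.single ⟨a, ha⟩ 1 : A → ZMod 2) ∈ LinearMap.range N.mulVecLin) := by
      intro a hua ha
      induction hua with
      | refl => rfl
      | tail _ hbc ih => exact (ih hbc.2.1).trans (hstep _ _ hbc.2.1 ha hbc.1)
    rw [eq_top_iff]
    intro φ _
    rw [← Finset.univ_sum_single φ]
    refine Submodule.sum_mem _ fun a _ => ?_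
    have : (Pi.single a (φ a) : A → ZMod 2) = φ a • Pi.single a 1 := by
      rw [← Pi.single_smul, smul_eq_mul, mul_one]
    rw [this]
    refine Submodule.smul_mem _ _ ((hroot a.1 (hA a.1 a.2) a.2).1 ?_)
    exact (hroot a₀ (hA a₀ ha₀) ha₀).2 hbase
  have hconst : ∀ x ∈ LinearMap.ker M.mulVecLin, ∀ τ τ' : T, x τ = x τ' := by
    intro x hx τ τ'
    let y : Finset V → ZMod 2 := fun σ => if hσ : σ ∈ T then x ⟨σ, hσ⟩ else 0
    have hy : ∀ σ : T, y σ = x σ := fun σ => by simp [y]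
    rw [← hy, ← hy]
    refine h.constant_of_eq_across_edges hA y ?_ τ.2 τ'.2
    intro e he σ hσ σ' hσ' hc hc' hs hs'
    by_cases hne : σ = σ'
    · rw [hne]
    obtain ⟨-, hec, heA⟩ := mem_edgesMeeting.1 he
    have hmem : ∀ ρ ∈ Δ, ρ.card = 3 → e ⊆ ρ → ρ ∈ T := fun ρ hρ hρc hρs =>
      mem_trianglesMeeting.2 ⟨hρ, hρc, fun hd => heA (disjoint_of_subset_left hρs hd)⟩
    have h0 := congrFun (LinearMap.mem_ker.1 hx) ⟨e, he⟩
    rw [Matrix.mulVecLin_apply, Matrix.mulVec, dotProduct] at h0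
    simp only [M, ite_mul, one_mul, zero_mul, ← hy] at h0
    rw [Finset.sum_coe_sort T (fun ρ => if e ⊆ ρ then y ρ else 0), ← sum_filter] at h0
    have hpair : T.filter (fun ρ => e ⊆ ρ) = {σ, σ'} := by
      ext ρ
      simp only [mem_filter, mem_insert, mem_singleton]
      constructor
      · rintro ⟨hρ, hρs⟩
        have hρ' := mem_trianglesMeeting.1 hρ
        exact h.eq_or_eq_of_edge_subset hec hσ hc hs hσ' hc' hs' hne hρ'.1 hρ'.2.1 hρs
      · rintro (rfl | rfl)
        · exact ⟨hmem _ hσ hc hs, hs⟩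
        · exact ⟨hmem _ hσ' hc' hs', hs'⟩
    rw [hpair, sum_pair hne] at h0
    exact CharTwo.add_eq_zero.1 h0
  have hker : Module.finrank (ZMod 2) (LinearMap.ker M.mulVecLin) ≤ 1 := by
    have hle : LinearMap.ker M.mulVecLin ≤ Submodule.span (ZMod 2) {fun _ => 1} := by
      intro x hx
      rw [Submodule.mem_span_singleton]
      rcases isEmpty_or_nonempty T with hT | ⟨⟨τ⟩⟩
      · exact ⟨0, funext fun τ => hT.elim τ⟩
      · exact ⟨x τ, funext fun τ' => by simpa using hconst x hx τ τ'⟩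
    refine (Submodule.finrank_mono hle).trans ?_
    simpa using finrank_span_le_card (R := ZMod 2) ({fun _ => 1} : Set (T → ZMod 2))
  have hcomp : N.mulVecLin ∘ₗ M.mulVecLin = 0 := by
    rw [← Matrix.mulVecLin_mul, hNM, Matrix.mulVecLin_zero]
  simpa [E, T] using finrank_add_le_of_comp_eq_zero _ _ hcomp hsurj hker

lemma edge_estimate_of_reachable (h : IsNormalPseudomanifold 3 Δ) {σ : Finset V} (hσ : σ ∈ Δ)
    (hσc : σ.card = 3) {u : V} (A : Finset V) (hA : ∀ a ∈ A, {a} ∈ Δ) (hu : u ∈ A)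
    (hAu : ∀ a ∈ A, ReachableWithin Δ A u a) (hAσ : Disjoint A σ) :
    3 * A.card ≤ (edgesMeeting Δ A).card := by
  induction hn : (Δ.biUnion id \ A).card using Nat.strong_induction_on generalizing A with
  | _ n ih =>
  subst hn
  obtain ⟨s, hs⟩ : σ.Nonempty := card_pos.1 (by omega)
  have hsΔ : {s} ∈ Δ := h.down _ hσ _ (by simpa using hs)
  obtain ⟨b₀, a₀, hab₀, hb₀, ha₀⟩ := exists_step_of_reflTransGen (Q := fun v => v ∉ A)
    (h.connected s u hsΔ (hA u hu)) (disjoint_right.1 hAσ hs) (not_not.2 hu)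
  rw [not_not] at ha₀
  have hadd : ∀ b a, b ∉ A → a ∈ A → Adj Δ b a → b ∉ σ →
      3 * A.card + 3 ≤ (edgesMeeting Δ (insert b A)).card := by
    intro b a hb ha hba hbσ
    have hbΔ := h.adj_left_mem hba
    have hstep : Adj Δ a b ∧ a ∈ insert b A ∧ b ∈ insert b A :=
      ⟨⟨hba.1.symm, by rw [pair_comm]; exact hba.2⟩, by simp [ha], by simp⟩
    have hmono : ∀ c ∈ A, ReachableWithin Δ (insert b A) u c := fun c hc =>
      Relation.ReflTransGen.mono
        (fun x y hxy => ⟨hxy.1, mem_insert_of_mem hxy.2.1, mem_insert_of_mem hxy.2.2⟩) _ _ (hAu c hc)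
    have := ih (Δ.biUnion id \ insert b A).card ?_ (insert b A) ?_ (by simp [hu]) ?_ ?_ rfl
    · rw [card_insert_of_notMem hb] at this
      omega
    · refine card_lt_card ((ssubset_iff_of_subset
        (sdiff_subset_sdiff subset_rfl (subset_insert _ _))).2 ⟨b, ?_, by simp⟩)
      exact mem_sdiff.2 ⟨mem_biUnion.2 ⟨{b}, hbΔ, by simp⟩, hb⟩
    · intro c hc
      rcases mem_insert.1 hc with rfl | hc
      · exact hbΔ
      · exact hA c hc
    · intro c hc
      rcases mem_insert.1 hc with rfl | hc
      · exact (hmono a ha).tail hstep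
      · exact hmono c hc
    · exact disjoint_insert_left.2 ⟨hbσ, hAσ⟩
  by_contra! hlt
  have hnbr : ∀ b a, b ∉ A → a ∈ A → Adj Δ b a →
      ∃ c c', c ∉ A ∧ c' ∉ A ∧ c ≠ c' ∧ Adj Δ b c ∧ Adj Δ b c' := by
    intro b a hb ha hba
    set C := (Δ.biUnion id \ A).filter fun c => b ≠ c ∧ {b, c} ∈ Δ with hC
    suffices hlt : 1 < C.card by
      obtain ⟨c, hc, c', hc', hne⟩ := one_lt_card.1 hlt
      simp only [hC, mem_filter, mem_sdiff] at hc hc'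
      exact ⟨c, c', hc.1.2, hc'.1.2, hne, hc.2, hc'.2⟩
    have hmemC : ∀ e ∈ Δ, b ∈ e → ∀ c ∈ e, c ≠ b → c ∉ A → c ∈ C := by
      intro e he hbe c hce hcb hcA
      exact mem_filter.2 ⟨mem_sdiff.2 ⟨mem_biUnion.2 ⟨e, he, hce⟩, hcA⟩, hcb.symm,
        h.down _ he _ (by simp [insert_subset_iff, hbe, hce])⟩
    by_cases hbσ : b ∈ σ
    · have hsub : σ.erase b ⊆ C := fun c hc =>
        hmemC σ hσ hbσ c (mem_erase.1 hc).2 (mem_erase.1 hc).1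
          (disjoint_right.1 hAσ (mem_erase.1 hc).2)
      have := card_le_card hsub
      rw [card_erase_of_mem hbσ] at this
      omega
    · have hsub : edgesMeeting Δ (insert b A) ⊆
          edgesMeeting Δ A ∪ C.image fun c => ({b, c} : Finset V) := by
        intro e he
        obtain ⟨h1, h2, h3⟩ := mem_edgesMeeting.1 he
        by_cases heA : Disjoint e A
        · have hbe : b ∈ e := by
            by_contra hbe
            exact h3 (disjoint_insert_right.2 ⟨hbe, heA⟩)
          obtain ⟨c, hc⟩ := card_eq_one.1 (by rw [card_erase_of_mem hbe, h2] : #(e.erase b) = 1)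
          have hce : c ∈ e.erase b := by rw [hc]; simp
          refine mem_union_right _ (mem_image.2 ⟨c, hmemC e h1 hbe c (mem_erase.1 hce).2
            (mem_erase.1 hce).1 (disjoint_left.1 heA (mem_erase.1 hce).2), ?_⟩)
          rw [← insert_erase hbe, hc]
        · exact mem_union_left _ (mem_edgesMeeting.2 ⟨h1, h2, heA⟩)
      have h1 := (card_le_card hsub).trans (card_union_le _ _)
      have h2 : #(C.image fun c => ({b, c} : Finset V)) ≤ _ := card_image_le
      have h3 := hadd b a hb ha hba hbσ
      omega
  have h1 := h.three_le_boundaryTriangles ha₀ hb₀ hab₀ hnbr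
  have h2 := h.two_mul_edgesMeeting_add_le A
  have h3 := h.card_add_trianglesMeeting_le hAu ha₀ hb₀ hab₀
  omega

lemma edge_estimate_surface (h : IsNormalPseudomanifold 3 Δ) {σ : Finset V} (hσ : σ ∈ Δ)
    (hσc : σ.card = 3) (A : Finset V) (hA : ∀ a ∈ A, {a} ∈ Δ) (hAσ : Disjoint A σ) :
    3 * A.card ≤ (edgesMeeting Δ A).card := by
  classical
  induction A using Finset.strongInduction with
  | H A ih =>
  rcases A.eq_empty_or_nonempty with rfl | ⟨u, hu⟩
  · simp
  set B := A.filter fun a => ReachableWithin Δ A u a with hB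
  have hBA : B ⊆ A := filter_subset _ _
  have huB : u ∈ B := mem_filter.2 ⟨hu, Relation.ReflTransGen.refl⟩
  have hreach : ∀ a, ReachableWithin Δ A u a → ReachableWithin Δ B u a := by
    intro a ha
    induction ha with
    | refl => exact Relation.ReflTransGen.refl
    | tail hab hbc ih =>
      exact ih.tail ⟨hbc.1, mem_filter.2 ⟨hbc.2.1, hab⟩, mem_filter.2 ⟨hbc.2.2, hab.tail hbc⟩⟩
  have h1 := h.edge_estimate_of_reachable hσ hσc B (fun a ha => hA a (hBA ha)) huB
    (fun a ha => hreach a (mem_filter.1 ha).2) (disjoint_of_subset_left hBA hAσ)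
  have h2 := ih (A \ B) (sdiff_ssubset hBA ⟨u, huB⟩) (fun a ha => hA a (sdiff_subset ha))
    (disjoint_of_subset_left sdiff_subset hAσ)
  have hdisj : Disjoint (edgesMeeting Δ B) (edgesMeeting Δ (A \ B)) := by
    refine disjoint_left.2 fun e he he' => ?_
    obtain ⟨he1, -, he3⟩ := mem_edgesMeeting.1 he
    obtain ⟨x, hxe, hxB⟩ := not_disjoint_iff.1 he3
    obtain ⟨y, hye, hy⟩ := not_disjoint_iff.1 (mem_edgesMeeting.1 he').2.2
    obtain ⟨hyA, hyB⟩ := mem_sdiff.1 hy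
    have hadj : Adj Δ x y :=
      ⟨fun e => hyB (e ▸ hxB), h.down _ he1 _ (by simp [insert_subset_iff, hxe, hye])⟩
    exact hyB (mem_filter.2 ⟨hyA, (mem_filter.1 hxB).2.tail ⟨hadj, hBA hxB, hyA⟩⟩)
  have hsub : edgesMeeting Δ B ∪ edgesMeeting Δ (A \ B) ⊆ edgesMeeting Δ A := by
    refine union_subset ?_ ?_ <;> intro e he <;> rw [mem_edgesMeeting] at he ⊢
    · exact ⟨he.1, he.2.1, fun hd => he.2.2 (disjoint_of_subset_right hBA hd)⟩
    · exact ⟨he.1, he.2.1, fun hd => he.2.2 (disjoint_of_subset_right sdiff_subset hd)⟩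
  have hle := card_le_card hsub
  rw [card_union_of_disjoint hdisj] at hle
  have := card_sdiff_add_card_eq_card hBA
  omega

/-- In a normal pseudomanifold of dimension `d - 1 ≥ 2`, a set `A` of vertices disjoint from some
facet meets at least `d * |A|` edges. -/
theorem edge_estimate (hd : 3 ≤ d) (h : IsNormalPseudomanifold d Δ) {σ : Finset V} (hσ : σ ∈ Δ)
    (hσc : σ.card = d) (A : Finset V) (hA : ∀ a ∈ A, {a} ∈ Δ) (hAσ : Disjoint A σ) :
    d * A.card ≤ (edgesMeeting Δ A).card := by
  induction d, hd using Nat.le_induction generalizing Δ σ A with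
  | base => exact h.edge_estimate_surface hσ hσc A hA hAσ
  | succ d hd ih =>
    exact h.edge_estimate_of_links (fun v hv τ hτ hτc B hB hBτ =>
      ih (h.link_singleton (by omega) hv) hτ hτc B hB hBτ) hσ hσc A hA hAσ

end IsNormalPseudomanifold

end LowerBound

/-- The lower bound theorem for connected normal pseudomanifolds of dimension `d-1 ≥ 3`:
`g₂ ≥ 0`, i.e. `f₁ ≥ d·f₀ - C(d+1,2)`. -/
theorem stmt19 {V : Type*} [DecidableEq V] (d : ℕ) (hd : 4 ≤ d)
    (Δ : Finset (Finset V))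
    (hempty : ∅ ∈ Δ)
    (hdown : ∀ F ∈ Δ, ∀ G, G ⊆ F → G ∈ Δ)
    (hdimle : ∀ F ∈ Δ, F.card ≤ d)
    (hpure : ∀ F ∈ Δ, ∃ G ∈ Δ, F ⊆ G ∧ G.card = d)
    (hridge : ∀ F ∈ Δ, F.card = d - 1 →
      (Δ.filter fun G => F ⊆ G ∧ G.card = d).card = 2)
    (hconn : ConnComplex Δ)
    (hlinks : ∀ F ∈ Δ, F.card ≤ d - 2 → ConnComplex (lk Δ F)) :
    (d : ℤ) * (fnum Δ 1) - ((d + 1).choose 2 : ℤ) ≤ (fnum Δ 2 : ℤ) := by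
  have h : IsNormalPseudomanifold d Δ := ⟨hempty, hdown, hdimle, hpure, hridge, hlinks⟩
  obtain ⟨σ, hσ, -, hσc⟩ := hpure ∅ hempty
  set U := Δ.biUnion id with hU
  have hmemU : ∀ v, v ∈ U ↔ {v} ∈ Δ := by
    intro v
    rw [hU, mem_biUnion]
    exact ⟨fun ⟨F, hF, hv⟩ => hdown F hF _ (by simpa using hv), fun hv => ⟨{v}, hv, by simp⟩⟩
  have hσU : σ ⊆ U := fun v hv => (hmemU v).2 (hdown σ hσ _ (by simpa using hv))
  have hf0 : fnum Δ 1 = U.card := by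
    rw [← card_image_of_injective U (singleton_injective (α := V)), fnum]
    congr 1
    ext F
    simp only [mem_filter, mem_image, hmemU]
    constructor
    · rintro ⟨hF, hc⟩
      obtain ⟨v, rfl⟩ := card_eq_one.1 hc
      exact ⟨v, hF, rfl⟩
    · rintro ⟨v, hv, rfl⟩
      exact ⟨hv, card_singleton v⟩
  have hest := h.edge_estimate (by omega) hσ hσc (U \ σ)
    (fun a ha => (hmemU a).1 (mem_sdiff.1 ha).1) sdiff_disjoint
  have hdisj : Disjoint (edgesMeeting Δ (U \ σ)) (powersetCard 2 σ) := by
    refine disjoint_left.2 fun e he he' => (mem_edgesMeeting.1 he).2.2 ?_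
    exact disjoint_of_subset_left (mem_powersetCard.1 he').1 disjoint_sdiff
  have hsub : edgesMeeting Δ (U \ σ) ∪ powersetCard 2 σ ⊆ Δ.filter fun F => F.card = 2 := by
    intro e he
    rw [mem_filter]
    rcases mem_union.1 he with he | he
    · exact ⟨(mem_edgesMeeting.1 he).1, (mem_edgesMeeting.1 he).2.1⟩
    · exact ⟨hdown σ hσ _ (mem_powersetCard.1 he).1, (mem_powersetCard.1 he).2⟩
  have hf1 : d * (U \ σ).card + d.choose 2 ≤ fnum Δ 2 := by
    have hle := card_le_card hsub
    rw [card_union_of_disjoint hdisj, card_powersetCard, hσc] at hle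
    exact (Nat.add_le_add_right hest _).trans hle
  have hcard : (U \ σ).card + d = U.card := by
    rw [← hσc, card_sdiff_add_card_eq_card hσU]
  have hchoose : (d + 1).choose 2 + d.choose 2 = d * d := by
    have hs : (d + 1).choose 2 = d + d.choose 2 := by
      rw [Nat.choose_succ_succ' d 1, Nat.choose_one_right]
    have htwo := Nat.triangle_succ d
    rw [← Nat.choose_two_right, ← Nat.choose_two_right] at htwo
    have hdouble : d.choose 2 * 2 = d * (d - 1) := by
      rw [Nat.choose_two_right]
      exact Nat.div_mul_cancel (Nat.even_mul_pred_self d).two_dvd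
    obtain ⟨k, rfl⟩ : ∃ k, d = k + 1 := ⟨d - 1, by omega⟩
    simp only [Nat.add_sub_cancel] at hdouble
    nlinarith
  rw [hf0, ← hcard]
  zify at hf1 hchoose
  push_cast
  linarith
end
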